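/- Let d = 2 and suppose hypotheses (H0)-(H4) hold, that the minimum of the function a ↦ max(φ(a), φ₀(a)) over ℝ² is attained at a unique point a* = (α*, β*), that inf_{a∈ℝ²} max(φ(a), φ₀(a)) > inf_{a∈ℝ²} φ(a), and that (∂φ/∂β)(a*) < 0. Then the t-Martin compactification of the kernel P is unstable: there exist t, t' > ρ(P) with t ≠ t' and a sequence z_n ∈ ℤ × ℕ with |z_n| → ∞ such that for every z ∈ ℤ × ℕ the sequence K_{t'}(z, z_n) converges as n → ∞, while for some z ∈ ℤ × ℕ the sequence K_t(z, z_n) does not converge. -/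

import Mathlib

open scoped Classical BigOperators
open Filter

noncomputable section

namespace RWHalfspace

/-- `ℤ^d` modeled as `ℤ^{d-1} × ℤ`; the Lean parameter `d` is the paper's `d-1`,
so that the paper's hypothesis `d ≥ 1` is automatic. -/
abbrev Zd (d : ℕ) := (Fin d → ℤ) × ℤ
/-- The state space `E = ℤ^{d-1} × ℕ`. -/
abbrev Ed (d : ℕ) := (Fin d → ℤ) × ℕ
/-- `ℝ^d` modeled as `ℝ^{d-1} × ℝ`. -/
abbrev Rd (d : ℕ) := (Fin d → ℝ) × ℝ

variable {d : ℕ}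

/-- The scalar product `a · z` for `a ∈ ℝ^d`, `z ∈ ℤ^d`. -/
def dotZ (a : Rd d) (z : Zd d) : ℝ := (∑ i, a.1 i * (z.1 i : ℝ)) + a.2 * (z.2 : ℝ)

/-- The scalar product on `ℝ^d`. -/
def dotR (a b : Rd d) : ℝ := (∑ i, a.1 i * b.1 i) + a.2 * b.2

/-- The scalar product `a · z` for `a ∈ ℝ^d`, `z ∈ E = ℤ^{d-1} × ℕ`. -/
def dotE (a : Rd d) (z : Ed d) : ℝ := (∑ i, a.1 i * (z.1 i : ℝ)) + a.2 * (z.2 : ℝ)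

/-- The jump generating function `φ(a) = ∑_{z ∈ ℤ^d} μ(z) e^{a·z}`. -/
def phi (μ : Zd d → ℝ) (a : Rd d) : ℝ := ∑' z, μ z * Real.exp (dotZ a z)

/-- The difference `z' - z ∈ ℤ^d` of two points of `E`. -/
def jump (z z' : Ed d) : Zd d := (z'.1 - z.1, (z'.2 : ℤ) - (z.2 : ℤ))

/-- The transition kernel of the reflected random walk on `E = ℤ^{d-1} × ℕ`. -/
def ker (μ μ₀ : Zd d → ℝ) (z z' : Ed d) : ℝ :=
  if z.2 = 0 then μ₀ (jump z z') else μ (jump z z')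

/-- The `n`-step transition kernel `p^(n)`. -/
def kerN (μ μ₀ : Zd d → ℝ) : ℕ → Ed d → Ed d → ℝ
  | 0 => fun z z' => if z = z' then 1 else 0
  | n + 1 => fun z z' => ∑' w, kerN μ μ₀ n z w * ker μ μ₀ w z'

/-- The `n`-step kernel of the homogeneous random walk on `ℤ^d` with step distribution `μ`. -/
def homN (μ : Zd d → ℝ) : ℕ → Zd d → Zd d → ℝ
  | 0 => fun z z' => if z = z' then 1 else 0
  | n + 1 => fun z z' => ∑' w, homN μ n z w * μ (z' - w)

/-- The step distribution of the last coordinate of the homogeneous random walk. -/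
def lastStep (μ : Zd d → ℝ) (k : ℤ) : ℝ := ∑' x : Fin d → ℤ, μ (x, k)

/-- The `n`-step kernel of the last coordinate random walk on `ℤ`. -/
def lastN (μ : Zd d → ℝ) : ℕ → ℤ → ℤ → ℝ
  | 0 => fun k k' => if k = k' then 1 else 0
  | n + 1 => fun k k' => ∑' j, lastN μ n k j * lastStep μ (k' - j)

/-- The convergence norm `ρ(P) = limsup_n (p^(n)(z,z'))^{1/n}` (independent of `z, z'`
by irreducibility; we take `z = z' = 0`). -/
def rho (μ μ₀ : Zd d → ℝ) : ℝ :=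
  limsup (fun n : ℕ => (kerN μ μ₀ n 0 0) ^ ((n : ℝ)⁻¹)) atTop

/-- `μ` is a nonnegative measure on `ℤ^d` with `0 < μ(ℤ^d) ≤ 1`. -/
def IsMeasure (μ : Zd d → ℝ) : Prop := (∀ z, 0 ≤ μ z) ∧ 0 < ∑' z, μ z ∧ ∑' z, μ z ≤ 1

/-- (H0): `μ(x,y) = 0` for `y < -1` and `μ₀(x,y) = 0` for `y < 0`. -/
def H0 (μ μ₀ : Zd d → ℝ) : Prop :=
  (∀ z : Zd d, z.2 < -1 → μ z = 0) ∧ (∀ z : Zd d, z.2 < 0 → μ₀ z = 0)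

/-- (H1): the kernel `P` is irreducible on `E`. -/
def H1 (μ μ₀ : Zd d → ℝ) : Prop := ∀ z z' : Ed d, ∃ n, 0 < kerN μ μ₀ n z z'

/-- (H2): the homogeneous random walk with step distribution `μ` is irreducible on `ℤ^d`. -/
def H2 (μ : Zd d → ℝ) : Prop := ∀ z z' : Zd d, ∃ n, 0 < homN μ n z z'

/-- (H3) for a single measure: the jump generating function is finite everywhere
(the defining series converges for every `a ∈ ℝ^d`). -/
def H3 (μ : Zd d → ℝ) : Prop := ∀ a : Rd d, Summable fun z => μ z * Real.exp (dotZ a z)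

/-- (H4): the last coordinate of the `μ`-random walk is aperiodic
(the gcd of `{n : p^n(0,0) > 0}` equals `1`). -/
def H4 (μ : Zd d → ℝ) : Prop := ∀ m : ℕ, (∀ n : ℕ, 0 < lastN μ n 0 0 → m ∣ n) → m = 1

/-- The sublevel set `D^t = {a : φ(a) ≤ t}`. -/
def Dset (μ : Zd d → ℝ) (t : ℝ) : Set (Rd d) := {a | phi μ a ≤ t}

/-- `Θ^t = {α ∈ ℝ^{d-1} : inf_β max(φ(α,β), φ₀(α,β)) ≤ t}`. -/
def Theta (μ μ₀ : Zd d → ℝ) (t : ℝ) : Set (Fin d → ℝ) :=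
  {α | sInf (Set.range fun β : ℝ => max (phi μ (α, β)) (phi μ₀ (α, β))) ≤ t}

/-- `Ĥ^t = (Θ^t × ℝ) ∩ D^t`. -/
def Hhat (μ μ₀ : Zd d → ℝ) (t : ℝ) : Set (Rd d) :=
  {a | a.1 ∈ Theta μ μ₀ t ∧ phi μ a ≤ t}

/-- Partial derivative of `f : ℝ^d → ℝ` in the last coordinate. -/
def dBeta (f : Rd d → ℝ) (a : Rd d) : ℝ := fderiv ℝ f a (0, 1)

/-- The (coordinate) gradient of `f : ℝ^d → ℝ`. -/
def gradV (f : Rd d → ℝ) (a : Rd d) : Rd d :=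
  (fun i => fderiv ℝ f a (Pi.single i 1, 0), fderiv ℝ f a (0, 1))

/-- `∂₊D^t`: boundary points of `D^t` where the last coordinate of `∇φ` is `≥ 0`. -/
def dPlus (μ : Zd d → ℝ) (t : ℝ) : Set (Rd d) :=
  {a | a ∈ frontier (Dset μ t) ∧ 0 ≤ dBeta (phi μ) a}

/-- `∂₀D^t`: boundary points of `D^t` where the last coordinate of `∇φ` is `0`. -/
def dZero (μ : Zd d → ℝ) (t : ℝ) : Set (Rd d) :=
  {a | a ∈ frontier (Dset μ t) ∧ dBeta (phi μ) a = 0}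

/-- `Γ₊^t = Ĥ^t ∩ ∂₊D^t`. -/
def GammaPlus (μ μ₀ : Zd d → ℝ) (t : ℝ) : Set (Rd d) := Hhat μ μ₀ t ∩ dPlus μ t

/-- The normal cone `V_t(a)` to `Ĥ^t` at `a`. -/
def Vcone (μ μ₀ : Zd d → ℝ) (t : ℝ) (a : Rd d) : Set (Rd d) :=
  {q | ∀ a' ∈ Hhat μ μ₀ t, dotR q (a' - a) ≤ 0}

/-- `β̄ = min{b : φ(α,b) ≤ t}`. -/
def betaBar (μ : Zd d → ℝ) (t : ℝ) (α : Fin d → ℝ) : ℝ := sInf {b : ℝ | phi μ (α, b) ≤ t}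

/-- `ā^t`: the lowest point of `D^t` with the same first `d-1` coordinates as `a`. -/
def abar (μ : Zd d → ℝ) (t : ℝ) (a : Rd d) : Rd d := (a.1, betaBar μ t a.1)

/-- The Green function `G_t(z,z') = ∑_n t^{-n} p^(n)(z,z')`. -/
def green (μ μ₀ : Zd d → ℝ) (t : ℝ) (z z' : Ed d) : ℝ :=
  ∑' n, (t ^ n)⁻¹ * kerN μ μ₀ n z z'

/-- The `t`-Martin kernel `K_t(z,z') = G_t(z,z')/G_t(z₀,z')` with reference point `z₀`. -/
def martin (μ μ₀ : Zd d → ℝ) (t : ℝ) (z₀ z z' : Ed d) : ℝ :=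
  green μ μ₀ t z z' / green μ μ₀ t z₀ z'

/-- Euclidean norm on `ℝ^d = ℝ^{d-1} × ℝ`. -/
def euclNorm (a : Rd d) : ℝ := Real.sqrt ((∑ i, a.1 i ^ 2) + a.2 ^ 2)

/-- The point of `ℝ^d` corresponding to `z ∈ E`. -/
def vecE (z : Ed d) : Rd d := (fun i => (z.1 i : ℝ), (z.2 : ℝ))

/-- Euclidean distance from a point `v` to a set `S ⊆ ℝ^d`. -/
def distTo (S : Set (Rd d)) (v : Rd d) : ℝ := sInf ((fun q => euclNorm (v - q)) '' S)

/-- The function `h_{a,t}` of the paper. -/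
def hFun (μ μ₀ : Zd d → ℝ) (t : ℝ) (a : Rd d) (z : Ed d) : ℝ :=
  if a ∉ dZero μ t ∧ phi μ₀ (abar μ t a) < t then
    Real.exp (dotE a z)
      - ((t - phi μ₀ a) / (t - phi μ₀ (abar μ t a))) * Real.exp (dotE (abar μ t a) z)
  else if a = abar μ t a ∧ a ∈ dZero μ t ∧ phi μ₀ a < t then
    ((z.2 : ℝ) + dBeta (phi μ₀) a / (t - phi μ₀ a)) * Real.exp (dotE a z)
  else Real.exp (dotE (abar μ t a) z)

section

lemma hasSum_cg {ι : Type*} {f g : ι → ℝ} {a : ℝ} (hf : HasSum f a) (h : ∀ i, g i = f i) :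
    HasSum g a := by
  have : g = f := funext h
  rwa [this]

/-- The exponential weight. -/
def ew (α β : ℝ) (z : Zd 1) : ℝ := Real.exp (α * (z.1 0 : ℝ) + β * (z.2 : ℝ))

/-- Weighted exponential moments. -/
def mom (ν : Zd 1 → ℝ) (k : Zd 1 → ℝ) (α β : ℝ) : ℝ := ∑' z, ν z * (k z * ew α β z)

/-- `φ` in coordinates. -/
def ph (ν : Zd 1 → ℝ) (α β : ℝ) : ℝ := mom ν (fun _ => 1) α β
/-- partial derivative in the first coordinate -/
def d1 (ν : Zd 1 → ℝ) (α β : ℝ) : ℝ := mom ν (fun z => (z.1 0 : ℝ)) α β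
/-- partial derivative in the second coordinate -/
def d2 (ν : Zd 1 → ℝ) (α β : ℝ) : ℝ := mom ν (fun z => (z.2 : ℝ)) α β

lemma ew_pos (α β : ℝ) (z : Zd 1) : 0 < ew α β z := Real.exp_pos _

lemma ew_eq (a : Rd 1) (z : Zd 1) : Real.exp (dotZ a z) = ew (a.1 0) a.2 z := by
  simp [dotZ, ew]

lemma phi_eq (ν : Zd 1 → ℝ) (a : Rd 1) : phi ν a = ph ν (a.1 0) a.2 := by
  simp [phi, ph, mom, ew_eq]

lemma phi_eq' (ν : Zd 1 → ℝ) (α β : ℝ) : phi ν (fun _ => α, β) = ph ν α β := by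
  rw [phi_eq]

lemma summ_ew {ν : Zd 1 → ℝ} (h3 : H3 ν) (α β : ℝ) : Summable fun z => ν z * ew α β z := by
  have := h3 (fun _ => α, β)
  simpa [ew_eq] using this

/-- the dominating function -/
def domf (α β : ℝ) (z : Zd 1) : ℝ :=
  ew (α + 2) (β + 2) z + ew (α + 2) (β - 2) z + ew (α - 2) (β + 2) z + ew (α - 2) (β - 2) z

lemma dom_bound (α β α' β' : ℝ) (z : Zd 1) (h1 : |α' - α| ≤ 1) (h2 : |β' - β| ≤ 1) :
    Real.exp (|(z.1 0 : ℝ)| + |(z.2 : ℝ)|) * ew α' β' z ≤ domf α β z := by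
  set x : ℝ := (z.1 0 : ℝ) with hx
  set y : ℝ := (z.2 : ℝ) with hy
  have hb : Real.exp (|x| + |y|) * ew α' β' z
      ≤ Real.exp (α * x + β * y + 2 * |x| + 2 * |y|) := by
    unfold ew
    rw [← Real.exp_add]
    apply Real.exp_le_exp.2
    have e1 : (α' - α) * x ≤ |x| := by
      calc (α' - α) * x ≤ |(α' - α) * x| := le_abs_self _
        _ = |α' - α| * |x| := abs_mul _ _
        _ ≤ 1 * |x| := by gcongr
        _ = |x| := one_mul _
    have e2 : (β' - β) * y ≤ |y| := by
      calc (β' - β) * y ≤ |(β' - β) * y| := le_abs_self _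
        _ = |β' - β| * |y| := abs_mul _ _
        _ ≤ 1 * |y| := by gcongr
        _ = |y| := one_mul _
    rw [← hx, ← hy]
    nlinarith
  refine hb.trans ?_
  have p1 := ew_pos (α + 2) (β + 2) z
  have p2 := ew_pos (α + 2) (β - 2) z
  have p3 := ew_pos (α - 2) (β + 2) z
  have p4 := ew_pos (α - 2) (β - 2) z
  unfold domf
  rcases abs_cases x with ⟨ex, _⟩ | ⟨ex, _⟩ <;> rcases abs_cases y with ⟨ey, _⟩ | ⟨ey, _⟩ <;>
    rw [ex, ey]
  · have : Real.exp (α * x + β * y + 2 * x + 2 * y) = ew (α + 2) (β + 2) z := by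
      unfold ew; congr 1; ring
    linarith
  · have : Real.exp (α * x + β * y + 2 * x + 2 * -y) = ew (α + 2) (β - 2) z := by
      unfold ew; congr 1; ring
    linarith
  · have : Real.exp (α * x + β * y + 2 * -x + 2 * y) = ew (α - 2) (β + 2) z := by
      unfold ew; congr 1; ring
    linarith
  · have : Real.exp (α * x + β * y + 2 * -x + 2 * -y) = ew (α - 2) (β - 2) z := by
      unfold ew; congr 1; ring
    linarith

lemma summ_domf {ν : Zd 1 → ℝ} (h3 : H3 ν) (α β : ℝ) : Summable fun z => ν z * domf α β z := by
  have := (((summ_ew h3 (α + 2) (β + 2)).add (summ_ew h3 (α + 2) (β - 2))).add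
    (summ_ew h3 (α - 2) (β + 2))).add (summ_ew h3 (α - 2) (β - 2))
  refine this.congr ?_
  intro z; simp only [domf]; ring

/-- admissible weights -/
def adm (k : Zd 1 → ℝ) : Prop := ∀ z, |k z| ≤ Real.exp (|(z.1 0 : ℝ)| + |(z.2 : ℝ)|)

lemma adm_one : adm (fun _ => 1) := by
  intro z; simp; positivity

lemma adm_x : adm (fun z => (z.1 0 : ℝ)) := by
  intro z
  have h := Real.add_one_le_exp (|(z.1 0 : ℝ)| + |(z.2 : ℝ)|)
  have := abs_nonneg (z.2 : ℝ)
  dsimp only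
  linarith

lemma adm_y : adm (fun z => (z.2 : ℝ)) := by
  intro z
  have h := Real.add_one_le_exp (|(z.1 0 : ℝ)| + |(z.2 : ℝ)|)
  have := abs_nonneg (z.1 0 : ℝ)
  dsimp only
  linarith

lemma mom_bound {ν : Zd 1 → ℝ} (hν : ∀ z, 0 ≤ ν z) {k : Zd 1 → ℝ} (hk : adm k) (α β α' β' : ℝ)
    (z : Zd 1) (h1 : |α' - α| ≤ 1) (h2 : |β' - β| ≤ 1) :
    ‖ν z * (k z * ew α' β' z)‖ ≤ ν z * domf α β z := by
  rw [Real.norm_eq_abs, abs_mul, abs_mul, abs_of_nonneg (hν z), abs_of_pos (ew_pos _ _ _)]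
  refine mul_le_mul_of_nonneg_left ?_ (hν z)
  refine le_trans ?_ (dom_bound α β α' β' z h1 h2)
  exact mul_le_mul_of_nonneg_right (hk z) (ew_pos _ _ _).le

lemma summ_mom {ν : Zd 1 → ℝ} (hν : ∀ z, 0 ≤ ν z) (h3 : H3 ν) {k : Zd 1 → ℝ} (hk : adm k)
    (α β : ℝ) : Summable fun z => ν z * (k z * ew α β z) :=
  Summable.of_norm_bounded (summ_domf h3 α β)
    (fun z => mom_bound hν hk α β α β z (by simp) (by simp))

lemma cont_mom {ν : Zd 1 → ℝ} (hν : ∀ z, 0 ≤ ν z) (h3 : H3 ν) {k : Zd 1 → ℝ} (hk : adm k) :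
    Continuous fun q : ℝ × ℝ => mom ν k q.1 q.2 := by
  rw [continuous_iff_continuousAt]
  rintro ⟨α, β⟩
  unfold ContinuousAt mom
  refine tendsto_tsum_of_dominated_convergence (bound := fun z => ν z * domf α β z)
    (summ_domf h3 α β) ?_ ?_
  · intro z
    have : Continuous fun q : ℝ × ℝ => ν z * (k z * ew q.1 q.2 z) := by
      unfold ew; fun_prop
    exact this.tendsto (α, β)
  · have : ∀ᶠ q : ℝ × ℝ in nhds (α, β), q ∈ Metric.ball (α, β) 1 :=
      Metric.ball_mem_nhds _ one_pos
    filter_upwards [this] with q hq z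
    rw [Metric.mem_ball, Prod.dist_eq, max_lt_iff] at hq
    exact mom_bound hν hk α β q.1 q.2 z hq.1.le hq.2.le

lemma cont_ph {ν : Zd 1 → ℝ} (hν : ∀ z, 0 ≤ ν z) (h3 : H3 ν) :
    Continuous fun q : ℝ × ℝ => ph ν q.1 q.2 := cont_mom hν h3 adm_one
lemma cont_d1 {ν : Zd 1 → ℝ} (hν : ∀ z, 0 ≤ ν z) (h3 : H3 ν) :
    Continuous fun q : ℝ × ℝ => d1 ν q.1 q.2 := cont_mom hν h3 adm_x
lemma cont_d2 {ν : Zd 1 → ℝ} (hν : ∀ z, 0 ≤ ν z) (h3 : H3 ν) :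
    Continuous fun q : ℝ × ℝ => d2 ν q.1 q.2 := cont_mom hν h3 adm_y

lemma ew_sub (α β α' β' : ℝ) (z : Zd 1) :
    ew α' β' z - ew α β z - ((α' - α) * ((z.1 0 : ℝ) * ew α β z) + (β' - β) * ((z.2 : ℝ) * ew α β z))
    = ew α β z * (Real.exp ((α' - α) * (z.1 0 : ℝ) + (β' - β) * (z.2 : ℝ)) - 1
      - ((α' - α) * (z.1 0 : ℝ) + (β' - β) * (z.2 : ℝ))) := by
  have : ew α' β' z = ew α β z * Real.exp ((α' - α) * (z.1 0 : ℝ) + (β' - β) * (z.2 : ℝ)) := by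
    unfold ew; rw [← Real.exp_add]; congr 1; ring
  rw [this]; ring

lemma hasSum_rem {ν : Zd 1 → ℝ} (hν : ∀ z, 0 ≤ ν z) (h3 : H3 ν) (α β α' β' : ℝ) :
    HasSum (fun z => ν z * (ew α β z * (Real.exp ((α' - α) * (z.1 0 : ℝ) + (β' - β) * (z.2 : ℝ)) - 1
      - ((α' - α) * (z.1 0 : ℝ) + (β' - β) * (z.2 : ℝ)))))
     (ph ν α' β' - ph ν α β - ((α' - α) * d1 ν α β + (β' - β) * d2 ν α β)) := by
  have h1 := (summ_mom hν h3 adm_one α' β').hasSum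
  have h2 := (summ_mom hν h3 adm_one α β).hasSum
  have h4 := (summ_mom hν h3 adm_x α β).hasSum
  have h5 := (summ_mom hν h3 adm_y α β).hasSum
  have := (h1.sub h2).sub ((h4.mul_left (α' - α)).add (h5.mul_left (β' - β)))
  refine hasSum_cg this ?_
  intro z
  rw [← ew_sub]; ring

lemma rem_nonneg (x : ℝ) : 0 ≤ Real.exp x - 1 - x := by
  have := Real.add_one_le_exp x; linarith

lemma subgrad {ν : Zd 1 → ℝ} (hν : ∀ z, 0 ≤ ν z) (h3 : H3 ν) (α β α' β' : ℝ) :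
    ph ν α β + ((α' - α) * d1 ν α β + (β' - β) * d2 ν α β) ≤ ph ν α' β' := by
  have := (hasSum_rem hν h3 α β α' β').nonneg
    (fun z => mul_nonneg (hν z) (mul_nonneg (ew_pos _ _ _).le (rem_nonneg _)))
  linarith

lemma subgrad_strict {ν : Zd 1 → ℝ} (hν : ∀ z, 0 ≤ ν z) (h3 : H3 ν) (α β α' β' : ℝ)
    (hz : ∃ z, 0 < ν z ∧ (α' - α) * (z.1 0 : ℝ) + (β' - β) * (z.2 : ℝ) ≠ 0) :
    ph ν α β + ((α' - α) * d1 ν α β + (β' - β) * d2 ν α β) < ph ν α' β' := by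
  obtain ⟨z, hz, hne⟩ := hz
  have hs := hasSum_rem hν h3 α β α' β'
  have hnn : ∀ z, 0 ≤ ν z * (ew α β z * (Real.exp ((α' - α) * (z.1 0 : ℝ) + (β' - β) * (z.2 : ℝ)) - 1
      - ((α' - α) * (z.1 0 : ℝ) + (β' - β) * (z.2 : ℝ)))) :=
    (fun z => mul_nonneg (hν z) (mul_nonneg (ew_pos _ _ _).le (rem_nonneg _)))
  have hpos := hs.summable.tsum_pos hnn z (mul_pos hz (mul_pos (ew_pos _ _ _) (by
    have := Real.add_one_lt_exp hne; linarith)))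
  rw [hs.tsum_eq] at hpos
  linarith

lemma ph_convex {ν : Zd 1 → ℝ} (hν : ∀ z, 0 ≤ ν z) (h3 : H3 ν) (α β α' β' θ : ℝ)
    (h0 : 0 ≤ θ) (h1 : θ ≤ 1) :
    ph ν ((1 - θ) * α + θ * α') ((1 - θ) * β + θ * β') ≤ (1 - θ) * ph ν α β + θ * ph ν α' β' := by
  have e1 := subgrad hν h3 ((1 - θ) * α + θ * α') ((1 - θ) * β + θ * β') α β
  have e2 := subgrad hν h3 ((1 - θ) * α + θ * α') ((1 - θ) * β + θ * β') α' β'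
  have := add_le_add (mul_le_mul_of_nonneg_left e1 (by linarith : 0 ≤ 1 - θ))
    (mul_le_mul_of_nonneg_left e2 h0)
  refine le_trans (le_of_eq ?_) this
  ring

/-- monotonicity in `β` when there are no downward jumps -/
lemma ph_mono {ν : Zd 1 → ℝ} (hν : ∀ z, 0 ≤ ν z) (h3 : H3 ν) (hdown : ∀ z : Zd 1, z.2 < 0 → ν z = 0)
    (α : ℝ) {β β' : ℝ} (h : β ≤ β') : ph ν α β ≤ ph ν α β' := by
  refine (summ_mom hν h3 adm_one α β).tsum_le_tsum ?_ (summ_mom hν h3 adm_one α β')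
  intro z
  by_cases hz : z.2 < 0
  · simp [hdown z hz]
  · have : (0 : ℝ) ≤ z.2 := by exact_mod_cast not_lt.1 hz
    refine mul_le_mul_of_nonneg_left ?_ (hν z)
    simp only [one_mul, ew]
    gcongr

lemma ph_smono {ν : Zd 1 → ℝ} (hν : ∀ z, 0 ≤ ν z) (h3 : H3 ν) (hdown : ∀ z : Zd 1, z.2 < 0 → ν z = 0)
    (hup : ∃ z : Zd 1, 0 < z.2 ∧ 0 < ν z)
    (α : ℝ) {β β' : ℝ} (h : β < β') : ph ν α β < ph ν α β' := by
  obtain ⟨w, hw, hw'⟩ := hup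
  refine (summ_mom hν h3 adm_one α β).tsum_lt_tsum (i := w) ?_ ?_ (summ_mom hν h3 adm_one α β')
  · intro z
    by_cases hz : z.2 < 0
    · simp [hdown z hz]
    · have : (0 : ℝ) ≤ z.2 := by exact_mod_cast not_lt.1 hz
      refine mul_le_mul_of_nonneg_left ?_ (hν z)
      simp only [one_mul, ew]
      gcongr
  · have : (0 : ℝ) < w.2 := by exact_mod_cast hw
    refine mul_lt_mul_of_pos_left ?_ hw'
    simp only [one_mul, ew]
    gcongr

lemma ph_pos {ν : Zd 1 → ℝ} (hν : ∀ z, 0 ≤ ν z) (h3 : H3 ν) (hz : ∃ z, 0 < ν z) (α β : ℝ) :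
    0 < ph ν α β := by
  obtain ⟨z, hz⟩ := hz
  refine (summ_mom hν h3 adm_one α β).tsum_pos ?_ z ?_
  · intro z; exact mul_nonneg (hν z) (by simpa using (ew_pos _ _ _).le)
  · exact mul_pos hz (by simpa using (ew_pos _ _ _))

/-- coercivity in `β` -/
lemma ph_large {ν : Zd 1 → ℝ} (hν : ∀ z, 0 ≤ ν z) (h3 : H3 ν) (hup : ∃ z : Zd 1, 0 < z.2 ∧ 0 < ν z)
    (α T β₀ : ℝ) : ∃ β, β₀ < β ∧ T < ph ν α β := by
  obtain ⟨z, hz, hz'⟩ := hup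
  have hle : ∀ β, ν z * (1 * ew α β z) ≤ ph ν α β := fun β =>
    (summ_mom hν h3 adm_one α β).le_tsum z
      (fun w _ => mul_nonneg (hν w) (by simpa using (ew_pos _ _ _).le))
  have hz1 : (0 : ℝ) < z.2 := by exact_mod_cast hz
  have ht : Tendsto (fun β => ν z * (1 * ew α β z)) atTop atTop := by
    refine Tendsto.const_mul_atTop hz' ?_
    simp only [one_mul, ew]
    refine Real.tendsto_exp_atTop.comp ?_
    refine tendsto_atTop_add_const_left _ _ ?_
    exact tendsto_id.atTop_mul_const hz1
  obtain ⟨β, h1, h2⟩ := ((ht.eventually_gt_atTop T).and (eventually_gt_atTop β₀)).exists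
  exact ⟨β, h2, h1.trans_le (hle β)⟩

end

section

/-- The hypotheses that are really used. -/
structure Hyp (μ μ₀ : Zd 1 → ℝ) : Prop where
  nn : ∀ z, 0 ≤ μ z
  nn0 : ∀ z, 0 ≤ μ₀ z
  low : ∀ z : Zd 1, z.2 < -1 → μ z = 0
  low0 : ∀ z : Zd 1, z.2 < 0 → μ₀ z = 0
  h1 : H1 μ μ₀
  h2 : H2 μ
  h3 : H3 μ
  h30 : H3 μ₀

/-- exponential weight on the half space -/
def ewE (α β : ℝ) (z : Ed 1) : ℝ := Real.exp (α * (z.1 0 : ℝ) + β * (z.2 : ℝ))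

lemma ewE_pos (α β : ℝ) (z : Ed 1) : 0 < ewE α β z := Real.exp_pos _

lemma ewE_zero (α β : ℝ) : ewE α β 0 = 1 := by simp [ewE]

/-- horizontal shift -/
def sh (k : ℤ) : Ed 1 ≃ Ed 1 where
  toFun z := (fun i => z.1 i + k, z.2)
  invFun z := (fun i => z.1 i - k, z.2)
  left_inv z := by ext <;> simp
  right_inv z := by ext <;> simp

lemma ewE_sh (α β : ℝ) (k : ℤ) (z : Ed 1) : ewE α β (sh k z) = Real.exp (α * k) * ewE α β z := by
  simp only [ewE, sh, Equiv.coe_fn_mk]; rw [← Real.exp_add]; congr 1; push_cast; ring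

lemma ker_sh (μ μ₀ : Zd 1 → ℝ) (k : ℤ) (z w : Ed 1) :
    ker μ μ₀ (sh k z) (sh k w) = ker μ μ₀ z w := by
  have : jump (sh k z) (sh k w) = jump z w := by
    simp only [jump, sh, Equiv.coe_fn_mk]
    congr 1
    ext i; simp
  unfold ker
  rw [this]; rfl

lemma jump_inj (z : Ed 1) : Function.Injective (jump z) := by
  intro a b h
  simp only [jump, Prod.mk.injEq] at h
  obtain ⟨h1, h2⟩ := h
  have e1 : a.1 = b.1 := by
    have := congrArg (fun f => f + z.1) h1
    simpa using this
  have e2 : a.2 = b.2 := by omega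
  exact Prod.ext e1 e2

lemma jump_range (z : Ed 1) (v : Zd 1) (hv : -(z.2 : ℤ) ≤ v.2) : v ∈ Set.range (jump z) := by
  refine ⟨(v.1 + z.1, (v.2 + z.2).toNat), ?_⟩
  have : (((v.2 + z.2).toNat : ℕ) : ℤ) = v.2 + z.2 := Int.toNat_of_nonneg (by omega)
  simp only [jump, this]
  ext <;> simp

lemma ew_jump (α β : ℝ) (z w : Ed 1) : ew α β (jump z w) * ewE α β z = ewE α β w := by
  simp only [ew, ewE, jump]; rw [← Real.exp_add]; congr 1; push_cast; simp; ring

variable {μ μ₀ : Zd 1 → ℝ}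

lemma ker_nn (H : Hyp μ μ₀) (z w : Ed 1) : 0 ≤ ker μ μ₀ z w := by
  unfold ker; split_ifs
  · exact H.nn0 _
  · exact H.nn _

/-- the generating function seen from `z` -/
def phz (μ μ₀ : Zd 1 → ℝ) (α β : ℝ) (z : Ed 1) : ℝ := if z.2 = 0 then ph μ₀ α β else ph μ α β

lemma ker_hasSum (H : Hyp μ μ₀) (α β : ℝ) (z : Ed 1) :
    HasSum (fun w => ker μ μ₀ z w * ewE α β w) (phz μ μ₀ α β z * ewE α β z) := by
  unfold phz
  by_cases hz : z.2 = 0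
  · rw [if_pos hz]
    have h := (summ_mom H.nn0 H.h30 adm_one α β).hasSum
    have h2 := ((jump_inj z).hasSum_iff (f := fun v => μ₀ v * (1 * ew α β v)) (a := ph μ₀ α β)
      (by
        intro v hv
        have : v.2 < 0 := by
          by_contra hc
          exact hv (jump_range z v (by omega))
        simp [H.low0 v this])).2 h
    refine hasSum_cg (h2.mul_right (ewE α β z)) ?_
    intro w
    simp only [Function.comp, ker, if_pos hz, one_mul]
    rw [mul_assoc, ew_jump]
  · rw [if_neg hz]
    have h := (summ_mom H.nn H.h3 adm_one α β).hasSum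
    have h2 := ((jump_inj z).hasSum_iff (f := fun v => μ v * (1 * ew α β v)) (a := ph μ α β)
      (by
        intro v hv
        have : v.2 < -1 := by
          by_contra hc
          exact hv (jump_range z v (by omega))
        simp [H.low v this])).2 h
    refine hasSum_cg (h2.mul_right (ewE α β z)) ?_
    intro w
    simp only [Function.comp, ker, if_neg hz, one_mul]
    rw [mul_assoc, ew_jump]

open scoped ENNReal

/-- one-step kernel in `ℝ≥0∞` -/
def pE (μ μ₀ : Zd 1 → ℝ) (z w : Ed 1) : ℝ≥0∞ := ENNReal.ofReal (ker μ μ₀ z w)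

/-- n-step kernel in `ℝ≥0∞` -/
def kE (μ μ₀ : Zd 1 → ℝ) : ℕ → Ed 1 → Ed 1 → ℝ≥0∞
  | 0 => fun z z' => if z = z' then 1 else 0
  | n + 1 => fun z z' => ∑' w, kE μ μ₀ n z w * pE μ μ₀ w z'

lemma kE_succ (n : ℕ) (z z' : Ed 1) :
    kE μ μ₀ (n + 1) z z' = ∑' w, kE μ μ₀ n z w * pE μ μ₀ w z' := rfl

lemma kE_op (n : ℕ) (z : Ed 1) (F : Ed 1 → ℝ≥0∞) :
    ∑' w, kE μ μ₀ (n + 1) z w * F w = ∑' w, kE μ μ₀ n z w * ∑' v, pE μ μ₀ w v * F v := by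
  simp only [kE, ← ENNReal.tsum_mul_left, ← ENNReal.tsum_mul_right]
  rw [ENNReal.tsum_comm]
  simp only [mul_assoc]

lemma kE_op_zero (z : Ed 1) (F : Ed 1 → ℝ≥0∞) : ∑' w, kE μ μ₀ 0 z w * F w = F z := by
  rw [tsum_eq_single z]
  · simp [kE]
  · intro b hb; simp [kE, hb.symm]

lemma kE_left (n : ℕ) : ∀ (z z' : Ed 1),
    kE μ μ₀ (n + 1) z z' = ∑' w, pE μ μ₀ z w * kE μ μ₀ n w z' := by
  induction n with
  | zero =>
    intro z z'
    rw [kE_succ, kE_op_zero, tsum_eq_single z']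
    · simp [kE]
    · intro b hb; simp [kE, hb]
  | succ n ih =>
    intro z z'
    rw [kE_succ]
    simp only [ih, ← ENNReal.tsum_mul_right]
    rw [ENNReal.tsum_comm]
    congr 1; ext w
    rw [← ih, kE_succ, ← ENNReal.tsum_mul_left]
    simp only [mul_assoc]

lemma kE_add (n m : ℕ) (z z' : Ed 1) :
    kE μ μ₀ (n + m) z z' = ∑' w, kE μ μ₀ n z w * kE μ μ₀ m w z' := by
  induction m generalizing z' with
  | zero =>
    rw [tsum_eq_single z']
    · simp [kE]
    · intro b hb; simp [kE, hb]
  | succ m ih =>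
    rw [← add_assoc, kE_succ]
    simp only [ih, kE_succ, ← ENNReal.tsum_mul_right, ← ENNReal.tsum_mul_left]
    rw [ENNReal.tsum_comm]
    simp only [mul_assoc]

lemma kE_mul_le (n m : ℕ) (z w z' : Ed 1) :
    kE μ μ₀ n z w * kE μ μ₀ m w z' ≤ kE μ μ₀ (n + m) z z' := by
  rw [kE_add]
  exact ENNReal.le_tsum (f := fun w => kE μ μ₀ n z w * kE μ μ₀ m w z') w

lemma kE_super {F : Ed 1 → ℝ≥0∞} {τ : ℝ≥0∞} (hF : ∀ z, ∑' w, pE μ μ₀ z w * F w ≤ τ * F z) (n : ℕ)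
    (z : Ed 1) : ∑' w, kE μ μ₀ n z w * F w ≤ τ ^ n * F z := by
  induction n with
  | zero => rw [kE_op_zero]; simp
  | succ n ih =>
    rw [kE_op]
    calc ∑' w, kE μ μ₀ n z w * ∑' v, pE μ μ₀ w v * F v
        ≤ ∑' w, τ * (kE μ μ₀ n z w * F w) := by
          refine ENNReal.tsum_le_tsum fun w => ?_
          rw [mul_left_comm]
          exact mul_le_mul_right (hF w) _
      _ = τ * ∑' w, (kE μ μ₀ n z w * F w) := ENNReal.tsum_mul_left
      _ ≤ τ * (τ ^ n * F z) := mul_le_mul_right ih _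
      _ = τ ^ (n + 1) * F z := by ring

lemma pE_hasSum (H : Hyp μ μ₀) {h : Ed 1 → ℝ} (hh : ∀ z, 0 ≤ h z) {z : Ed 1} {a : ℝ}
    (hs : HasSum (fun w => ker μ μ₀ z w * h w) a) :
    ∑' w, pE μ μ₀ z w * ENNReal.ofReal (h w) = ENNReal.ofReal a := by
  rw [← hs.tsum_eq, ENNReal.ofReal_tsum_of_nonneg (fun w => mul_nonneg (ker_nn H _ _) (hh _))
    hs.summable]
  congr 1; ext w
  rw [ENNReal.ofReal_mul (ker_nn H _ _)]; rfl

lemma pE_ew (H : Hyp μ μ₀) (α β : ℝ) (z : Ed 1) :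
    ∑' w, pE μ μ₀ z w * ENNReal.ofReal (ewE α β w) = ENNReal.ofReal (phz μ μ₀ α β z * ewE α β z) :=
  pE_hasSum H (fun _ => (ewE_pos _ _ _).le) (ker_hasSum H α β z)

lemma phz_le_max (α β : ℝ) (z : Ed 1) : phz μ μ₀ α β z ≤ max (ph μ α β) (ph μ₀ α β) := by
  unfold phz; split_ifs
  · exact le_max_right _ _
  · exact le_max_left _ _

lemma ph_nonneg {ν : Zd 1 → ℝ} (hν : ∀ z, 0 ≤ ν z) (α β : ℝ) : 0 ≤ ph ν α β :=
  tsum_nonneg fun z => mul_nonneg (hν z) (by simpa using (ew_pos _ _ _).le)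

lemma kE_ew_le (H : Hyp μ μ₀) (α β : ℝ) (n : ℕ) (z w : Ed 1) :
    kE μ μ₀ n z w * ENNReal.ofReal (ewE α β w)
      ≤ ENNReal.ofReal (max (ph μ α β) (ph μ₀ α β)) ^ n * ENNReal.ofReal (ewE α β z) := by
  refine le_trans ?_ (kE_super (μ := μ) (μ₀ := μ₀) (F := fun w => ENNReal.ofReal (ewE α β w)) ?_ n z)
  · exact ENNReal.le_tsum (f := fun w => kE μ μ₀ n z w * ENNReal.ofReal (ewE α β w)) w
  · intro z
    rw [pE_ew H, ENNReal.ofReal_mul' (ewE_pos _ _ _).le]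
    exact mul_le_mul_left (ENNReal.ofReal_le_ofReal (phz_le_max _ _ _)) _

lemma kE_ne_top (H : Hyp μ μ₀) (n : ℕ) (z w : Ed 1) : kE μ μ₀ n z w ≠ ∞ := by
  have h := kE_ew_le H 0 0 n z w
  simp only [ewE, zero_mul, add_zero, Real.exp_zero, ENNReal.ofReal_one, mul_one] at h
  exact ne_top_of_le_ne_top (by finiteness) h

lemma kerN_eq (H : Hyp μ μ₀) (n : ℕ) : ∀ z w, kerN μ μ₀ n z w = (kE μ μ₀ n z w).toReal := by
  induction n with
  | zero => intro z w; simp only [kerN, kE]; split_ifs <;> simp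
  | succ n ih =>
    intro z w
    rw [kE_succ, ENNReal.tsum_toReal_eq]
    · refine tsum_congr fun v => ?_
      rw [ENNReal.toReal_mul, ih, pE, ENNReal.toReal_ofReal (ker_nn H _ _)]
    · intro v; exact ENNReal.mul_ne_top (kE_ne_top H _ _ _) (by simp [pE])

lemma kE_sh (k : ℤ) (n : ℕ) : ∀ z w : Ed 1, kE μ μ₀ n (sh k z) (sh k w) = kE μ μ₀ n z w := by
  induction n with
  | zero => intro z w; simp [kE]
  | succ n ih =>
    intro z w
    rw [kE_succ, kE_succ, ← (sh k).tsum_eq]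
    simp only [ih, pE, ker_sh]

/-- Green function in `ℝ≥0∞` -/
def GE (μ μ₀ : Zd 1 → ℝ) (t : ℝ) (z z' : Ed 1) : ℝ≥0∞ :=
  ∑' n, ENNReal.ofReal t⁻¹ ^ n * kE μ μ₀ n z z'

lemma green_eq (H : Hyp μ μ₀) {t : ℝ} (ht : 0 < t) (z z' : Ed 1) :
    green μ μ₀ t z z' = (GE μ μ₀ t z z').toReal := by
  rw [green, GE, ENNReal.tsum_toReal_eq]
  · congr 1; ext n
    rw [ENNReal.toReal_mul, kerN_eq H, ENNReal.toReal_pow, ENNReal.toReal_ofReal (by positivity),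
      inv_pow]
  · intro n; exact ENNReal.mul_ne_top (by finiteness) (kE_ne_top H _ _ _)

lemma GE_sh (t : ℝ) (k : ℤ) (z w : Ed 1) : GE μ μ₀ t (sh k z) (sh k w) = GE μ μ₀ t z w := by
  simp only [GE, kE_sh]

lemma GE_rec (t : ℝ) (z z' : Ed 1) : GE μ μ₀ t z z' =
    (if z = z' then 1 else 0) + ENNReal.ofReal t⁻¹ * ∑' w, pE μ μ₀ z w * GE μ μ₀ t w z' := by
  conv_lhs => rw [GE, tsum_eq_zero_add' ENNReal.summable]
  simp only [pow_zero, one_mul]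
  congr 1
  simp only [GE, ← ENNReal.tsum_mul_left]
  rw [ENNReal.tsum_comm]
  congr 1; ext n
  rw [kE_left, ← ENNReal.tsum_mul_left]
  congr 1; ext w
  ring

lemma GE_ge_left (t : ℝ) (m : ℕ) (z w z' : Ed 1) :
    (ENNReal.ofReal t⁻¹ ^ m * kE μ μ₀ m z w) * GE μ μ₀ t w z' ≤ GE μ μ₀ t z z' := by
  rw [GE, GE, ← ENNReal.tsum_mul_left]
  calc ∑' n, (ENNReal.ofReal t⁻¹ ^ m * kE μ μ₀ m z w) * (ENNReal.ofReal t⁻¹ ^ n * kE μ μ₀ n w z')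
      ≤ ∑' n, ENNReal.ofReal t⁻¹ ^ (m + n) * kE μ μ₀ (m + n) z z' := by
        refine ENNReal.tsum_le_tsum fun n => ?_
        calc _ = ENNReal.ofReal t⁻¹ ^ (m + n) * (kE μ μ₀ m z w * kE μ μ₀ n w z') := by
              rw [pow_add]; ring
          _ ≤ _ := mul_le_mul_right (kE_mul_le _ _ _ _ _) _
    _ ≤ _ := ENNReal.tsum_comp_le_tsum_of_injective (add_right_injective m)
        (fun n => ENNReal.ofReal t⁻¹ ^ n * kE μ μ₀ n z z')

lemma GE_ge_right (t : ℝ) (m : ℕ) (z w z' : Ed 1) :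
    GE μ μ₀ t z w * (ENNReal.ofReal t⁻¹ ^ m * kE μ μ₀ m w z') ≤ GE μ μ₀ t z z' := by
  rw [GE, GE, ← ENNReal.tsum_mul_right]
  calc ∑' n, (ENNReal.ofReal t⁻¹ ^ n * kE μ μ₀ n z w) * (ENNReal.ofReal t⁻¹ ^ m * kE μ μ₀ m w z')
      ≤ ∑' n, ENNReal.ofReal t⁻¹ ^ (n + m) * kE μ μ₀ (n + m) z z' := by
        refine ENNReal.tsum_le_tsum fun n => ?_
        calc _ = ENNReal.ofReal t⁻¹ ^ (n + m) * (kE μ μ₀ n z w * kE μ μ₀ m w z') := by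
              rw [pow_add]; ring
          _ ≤ _ := mul_le_mul_right (kE_mul_le _ _ _ _ _) _
    _ ≤ _ := ENNReal.tsum_comp_le_tsum_of_injective (add_left_injective m)
        (fun n => ENNReal.ofReal t⁻¹ ^ n * kE μ μ₀ n z z')

end

section

variable {μ μ₀ : Zd 1 → ℝ}
open scoped ENNReal

lemma homN_nn (H : Hyp μ μ₀) (n : ℕ) : ∀ z w : Zd 1, 0 ≤ homN μ n z w := by
  induction n with
  | zero => intro z w; simp only [homN]; split_ifs <;> simp
  | succ n ih => intro z w; exact tsum_nonneg fun v => mul_nonneg (ih _ _) (H.nn _)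

lemma homN_succ_pos (H : Hyp μ μ₀) {n : ℕ} {z w : Zd 1} (h : 0 < homN μ (n + 1) z w) :
    ∃ v, 0 < homN μ n z v ∧ 0 < μ (w - v) := by
  by_contra hc
  push Not at hc
  have : homN μ (n + 1) z w = 0 := by
    show ∑' v, homN μ n z v * μ (w - v) = 0
    rw [← tsum_zero (β := Zd 1)]
    refine tsum_congr fun v => ?_
    rcases (homN_nn H n z v).lt_or_eq with h1 | h1
    · have := le_antisymm (hc v h1) (H.nn _)
      simp [this]
    · simp [← h1]
  linarith

lemma hom_ind (H : Hyp μ μ₀) (Q : Zd 1 → Prop) (hQ0 : Q 0)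
    (hQ : ∀ w s, Q w → 0 < μ s → Q (w + s)) (w : Zd 1) : Q w := by
  have key : ∀ n w, 0 < homN μ n 0 w → Q w := by
    intro n
    induction n with
    | zero =>
      intro w h
      simp only [homN] at h
      split_ifs at h with h1
      · rwa [← h1]
      · exact absurd h (lt_irrefl _)
    | succ n ih =>
      intro w h
      obtain ⟨v, hv, hv'⟩ := homN_succ_pos H h
      have := hQ v (w - v) (ih v hv) hv'
      simpa using this
  obtain ⟨n, hn⟩ := H.h2 0 w
  exact key n w hn

lemma kE_pos_of_H1 (H : Hyp μ μ₀) (z w : Ed 1) : ∃ n, kE μ μ₀ n z w ≠ 0 := by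
  obtain ⟨n, hn⟩ := H.h1 z w
  refine ⟨n, fun h => ?_⟩
  rw [kerN_eq H, h] at hn
  simp at hn

lemma ker_ind (H : Hyp μ μ₀) (Q : Ed 1 → Prop) (z : Ed 1) (hQ0 : Q z)
    (hQ : ∀ w v, Q w → 0 < ker μ μ₀ w v → Q v) (w : Ed 1) : Q w := by
  have key : ∀ n w, kE μ μ₀ n z w ≠ 0 → Q w := by
    intro n
    induction n with
    | zero =>
      intro w h
      simp only [kE] at h
      split_ifs at h with h1
      · rwa [← h1]
      · exact absurd rfl h
    | succ n ih =>
      intro w h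
      rw [kE_succ] at h
      by_contra hc
      apply h
      rw [ENNReal.tsum_eq_zero]
      intro v
      by_contra hv
      rw [mul_eq_zero, not_or] at hv
      refine hc (hQ v w (ih v hv.1) ?_)
      have := hv.2
      simpa [pE] using this
  obtain ⟨n, hn⟩ := kE_pos_of_H1 H z w
  exact key n w hn

/-- there is a downward jump in the interior -/
lemma exists_down (H : Hyp μ μ₀) : ∃ z : Zd 1, z.2 = -1 ∧ 0 < μ z := by
  by_contra hc
  push Not at hc
  have := ker_ind H (fun z => 1 ≤ z.2) ((fun _ => 0, 1) : Ed 1) (by simp) (by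
    intro w v hw hk
    unfold ker at hk
    rw [if_neg (by omega)] at hk
    by_contra hv
    by_cases hj : (jump w v).2 = -1
    · exact absurd hk (not_lt.2 (hc _ hj))
    · have : (jump w v).2 < -1 := by
        simp only [jump] at hj ⊢
        omega
      rw [H.low _ this] at hk
      exact lt_irrefl _ hk) 0
  simp at this

lemma exists_up0 (H : Hyp μ μ₀) : ∃ z : Zd 1, 0 < z.2 ∧ 0 < μ₀ z := by
  by_contra hc
  push Not at hc
  have := ker_ind H (fun z => z.2 = 0) (0 : Ed 1) (by simp) (by
    intro w v hw hk
    unfold ker at hk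
    rw [if_pos hw] at hk
    by_contra hv
    have : 0 < (jump w v).2 := by
      simp only [jump]; omega
    exact absurd hk (not_lt.2 (hc _ this))) ((fun _ => 0, 1) : Ed 1)
  simp at this

lemma exists_up (H : Hyp μ μ₀) : ∃ z : Zd 1, 0 < z.2 ∧ 0 < μ z := by
  by_contra hc
  push Not at hc
  have := hom_ind H (fun z => z.2 ≤ 0) (by simp) (by
    intro w v hw hk
    by_contra hv
    have : 0 < v.2 := by
      simp only [Prod.snd_add] at hv; omega
    exact absurd hk (not_lt.2 (hc _ this))) ((fun _ => 0, 1) : Zd 1)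
  simp at this

lemma exists_nonorth (H : Hyp μ μ₀) (p q : ℝ) (hpq : p ≠ 0 ∨ q ≠ 0) :
    ∃ z : Zd 1, 0 < μ z ∧ p * (z.1 0 : ℝ) + q * (z.2 : ℝ) ≠ 0 := by
  by_contra hc
  push Not at hc
  have key := hom_ind H (fun z => p * (z.1 0 : ℝ) + q * (z.2 : ℝ) = 0) (by simp) (by
    intro w v hw hk
    have := hc v hk
    simp only [Prod.snd_add, Prod.fst_add, Pi.add_apply]
    push_cast
    linarith)
  have k1 := key ((fun _ => 1, 0) : Zd 1)
  have k2 := key ((fun _ => 0, 1) : Zd 1)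
  simp at k1 k2
  tauto

lemma sgs (H : Hyp μ μ₀) {α β α' β' : ℝ} (h : α' - α ≠ 0 ∨ β' - β ≠ 0) :
    ph μ α β + ((α' - α) * d1 μ α β + (β' - β) * d2 μ α β) < ph μ α' β' :=
  subgrad_strict H.nn H.h3 α β α' β' (exists_nonorth H _ _ h)

/-- quantitative reachability -/
def RA (μ μ₀ : Zd 1 → ℝ) (t : ℝ) (c : ℝ) (z z' : Ed 1) : Prop :=
  ∃ m, ENNReal.ofReal c ≤ ENNReal.ofReal t⁻¹ ^ m * kE μ μ₀ m z z'

lemma RA.mono {t c c' : ℝ} {z z' : Ed 1} (h : RA μ μ₀ t c z z') (hc : c' ≤ c) :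
    RA μ μ₀ t c' z z' := by
  obtain ⟨m, hm⟩ := h
  exact ⟨m, (ENNReal.ofReal_le_ofReal hc).trans hm⟩

lemma RA.trans {t c c' : ℝ} {z w z' : Ed 1} (hc : 0 ≤ c) (h : RA μ μ₀ t c z w)
    (h' : RA μ μ₀ t c' w z') :
    RA μ μ₀ t (c * c') z z' := by
  obtain ⟨m, hm⟩ := h
  obtain ⟨n, hn⟩ := h'
  refine ⟨m + n, ?_⟩
  rw [ENNReal.ofReal_mul hc]
  calc _ ≤ (ENNReal.ofReal t⁻¹ ^ m * kE μ μ₀ m z w) * (ENNReal.ofReal t⁻¹ ^ n * kE μ μ₀ n w z') :=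
        mul_le_mul' hm hn
    _ = ENNReal.ofReal t⁻¹ ^ (m + n) * (kE μ μ₀ m z w * kE μ μ₀ n w z') := by rw [pow_add]; ring
    _ ≤ _ := mul_le_mul_right (kE_mul_le _ _ _ _ _) _

lemma RA.sh {t c : ℝ} {z z' : Ed 1} (k : ℤ) (h : RA μ μ₀ t c z z') :
    RA μ μ₀ t c (sh k z) (sh k z') := by
  obtain ⟨m, hm⟩ := h
  exact ⟨m, by rwa [kE_sh]⟩

lemma hom_lower (H : Hyp μ μ₀) (n : ℕ) : ∀ e : Zd 1, 0 < homN μ n 0 e → -(n : ℤ) ≤ e.2 ∧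
    ∃ κ : ℝ, 0 < κ ∧ ∀ z z' : Ed 1, n ≤ z.2 → jump z z' = e → ENNReal.ofReal κ ≤ kE μ μ₀ n z z' := by
  induction n with
  | zero =>
    intro e he
    simp only [homN] at he
    split_ifs at he with h
    · subst h
      refine ⟨by simp, 1, one_pos, ?_⟩
      intro z z' _ hj
      have : z' = z := jump_inj z (by rw [hj]; simp [jump]; rfl)
      simp [kE, this]
    · exact absurd he (lt_irrefl _)
  | succ n ih =>
    intro e he
    obtain ⟨v, hv, hv'⟩ := homN_succ_pos H he
    obtain ⟨hl, κ, hκ, hk⟩ := ih v hv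
    have hev : -1 ≤ (e - v).2 := by
      by_contra hc
      rw [H.low _ (by omega)] at hv'
      exact lt_irrefl _ hv'
    simp only [Prod.snd_sub] at hev
    refine ⟨by push_cast; omega, κ * μ (e - v), by positivity, ?_⟩
    intro z z' hz hj
    obtain ⟨w, hw⟩ := jump_range z v (by omega)
    have hw2 : w.2 ≠ 0 := by
      have := congrArg Prod.snd hw
      simp only [jump] at this
      omega
    have hjw : jump w z' = e - v := by
      rw [← hj, ← hw]
      simp only [jump]
      ext <;> simp
    rw [kE_succ, ENNReal.ofReal_mul hκ.le]
    calc ENNReal.ofReal κ * ENNReal.ofReal (μ (e - v)) ≤ kE μ μ₀ n z w * pE μ μ₀ w z' := by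
          refine mul_le_mul' (hk z w (by omega) hw) ?_
          unfold pE ker
          rw [if_neg hw2, hjw]
      _ ≤ _ := ENNReal.le_tsum (f := fun w => kE μ μ₀ n z w * pE μ μ₀ w z') w

lemma RA_of_H1 (H : Hyp μ μ₀) {t : ℝ} (ht : 0 < t) (z z' : Ed 1) : ∃ c : ℝ, 0 < c ∧ RA μ μ₀ t c z z' := by
  obtain ⟨n, hn⟩ := kE_pos_of_H1 H z z'
  have h1 : ENNReal.ofReal t⁻¹ ^ n * kE μ μ₀ n z z' ≠ 0 := by
    refine mul_ne_zero (pow_ne_zero _ ?_) hn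
    simpa using ht
  have h2 : ENNReal.ofReal t⁻¹ ^ n * kE μ μ₀ n z z' ≠ ∞ :=
    ENNReal.mul_ne_top (by finiteness) (kE_ne_top H _ _ _)
  exact ⟨_, ENNReal.toReal_pos h1 h2, n, by rw [ENNReal.ofReal_toReal h2]⟩

lemma sh_zero_x (z : Ed 1) : sh (z.1 0) (0, z.2) = z := by
  simp only [sh, Equiv.coe_fn_mk]
  ext i
  · simp [Subsingleton.elim i 0]
  · simp

lemma jump_sh (k : ℤ) (z z' : Ed 1) : jump (sh k z) (sh k z') = jump z z' := by
  simp only [jump, sh, Equiv.coe_fn_mk]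
  congr 1
  ext i; simp

lemma step_lower (H : Hyp μ μ₀) {t : ℝ} (ht : 0 < t) (e : Zd 1) :
    ∃ c : ℝ, 0 < c ∧ ∀ z z' : Ed 1, jump z z' = e → RA μ μ₀ t c z z' := by
  obtain ⟨n, hn⟩ := H.h2 0 e
  obtain ⟨-, κ, hκ, hk⟩ := hom_lower H n e hn
  have small : ∀ N : ℕ, ∃ c : ℝ, 0 < c ∧ ∀ z z' : Ed 1, z.2 < N → jump z z' = e → RA μ μ₀ t c z z' := by
    intro N
    induction N with
    | zero => exact ⟨1, one_pos, fun z z' h => absurd h (by simp)⟩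
    | succ N ih =>
      obtain ⟨c, hc, hc'⟩ := ih
      by_cases hex : ∃ z', jump (0, N) z' = e
      · obtain ⟨w, hw⟩ := hex
        obtain ⟨c2, hc2, hr⟩ := RA_of_H1 H ht (0, N) w
        refine ⟨min c c2, lt_min hc hc2, ?_⟩
        intro z z' hz hj
        by_cases hzN : z.2 < N
        · exact (hc' z z' hzN hj).mono (min_le_left _ _)
        · have hz2 : z.2 = N := by omega
          have e1 : sh (z.1 0) (0, N) = z := by rw [← hz2]; exact sh_zero_x z
          have e2 : sh (z.1 0) w = z' := by
            apply jump_inj z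
            have hh := jump_sh (z.1 0) ((0, N) : Ed 1) w
            rw [e1, hw] at hh
            rw [hj]
            exact hh
          have := (hr.sh (z.1 0)).mono (min_le_right c c2)
          rwa [e1, e2] at this
      · refine ⟨c, hc, ?_⟩
        intro z z' hz hj
        by_cases hzN : z.2 < N
        · exact hc' z z' hzN hj
        · exfalso
          have hz2 : z.2 = N := by omega
          have e1 : sh (z.1 0) (0, N) = z := by rw [← hz2]; exact sh_zero_x z
          apply hex
          refine ⟨(sh (z.1 0)).symm z', ?_⟩
          rw [← jump_sh (z.1 0), e1]
          simpa using hj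
  obtain ⟨c, hc, hc'⟩ := small n
  refine ⟨min c (t⁻¹ ^ n * κ), lt_min hc (by positivity), ?_⟩
  intro z z' hj
  by_cases hz : z.2 < n
  · exact (hc' z z' hz hj).mono (min_le_left _ _)
  · refine RA.mono ⟨n, ?_⟩ (min_le_right _ _)
    rw [ENNReal.ofReal_mul (by positivity), ENNReal.ofReal_pow (by positivity)]
    exact mul_le_mul_right (hk z z' (by omega) hj) _

/-- lattice distance -/
def dd (z z' : Ed 1) : ℕ := (z'.1 0 - z.1 0).natAbs + ((z'.2 : ℤ) - z.2).natAbs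

lemma Ed_ext {z z' : Ed 1} (h1 : z.1 0 = z'.1 0) (h2 : z.2 = z'.2) : z = z' := by
  ext i
  · rw [Subsingleton.elim i 0, h1]
  · exact h2

theorem harnack (H : Hyp μ μ₀) {t : ℝ} (ht : 0 < t) :
    ∃ c : ℝ, 0 < c ∧ c < 1 ∧ ∀ z z' : Ed 1, RA μ μ₀ t (c ^ dd z z') z z' := by
  obtain ⟨c1, h1, h1'⟩ := step_lower H ht ((fun _ => 1, 0) : Zd 1)
  obtain ⟨c2, h2, h2'⟩ := step_lower H ht ((fun _ => -1, 0) : Zd 1)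
  obtain ⟨c3, h3, h3'⟩ := step_lower H ht ((fun _ => 0, 1) : Zd 1)
  obtain ⟨c4, h4, h4'⟩ := step_lower H ht ((fun _ => 0, -1) : Zd 1)
  obtain ⟨c, hc0, hc1, hcc1, hcc2, hcc3, hcc4⟩ : ∃ c : ℝ, 0 < c ∧ c < 1 ∧ c ≤ c1 ∧ c ≤ c2 ∧ c ≤ c3 ∧ c ≤ c4 := by
    refine ⟨min (1/2) (min (min c1 c2) (min c3 c4)), by positivity, ?_, ?_, ?_, ?_, ?_⟩
    · exact (min_le_left _ _).trans_lt (by norm_num)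
    all_goals simp
  refine ⟨c, hc0, hc1, ?_⟩
  have key : ∀ n : ℕ, ∀ z z' : Ed 1, dd z z' = n → RA μ μ₀ t (c ^ n) z z' := by
    intro n
    induction n with
    | zero =>
      intro z z' hd
      have : z = z' := by
        unfold dd at hd
        apply Ed_ext <;> omega
      subst this
      exact ⟨0, by simp [kE]⟩
    | succ n ih =>
      intro z z' hd
      rw [pow_succ']
      unfold dd at hd
      have fin : ∀ w : Ed 1, RA μ μ₀ t c z w → dd w z' = n → RA μ μ₀ t (c * c ^ n) z z' :=
        fun w hw hdw => RA.trans hc0.le hw (ih w z' hdw)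
      rcases lt_trichotomy (z.1 0) (z'.1 0) with h | h | h
      · refine fin (fun _ => z.1 0 + 1, z.2) ((h1' _ _ ?_).mono hcc1) ?_
        · simp only [jump]; ext i
          · simp [Subsingleton.elim i 0]
          · simp
        · simp only [dd]; omega
      · rcases lt_trichotomy z.2 z'.2 with g | g | g
        · refine fin (fun _ => z.1 0, z.2 + 1) ((h3' _ _ ?_).mono hcc3) ?_
          · simp only [jump]; ext i
            · simp [Subsingleton.elim i 0]
            · simp
          · simp only [dd]; push_cast; omega
        · omega
        · refine fin (fun _ => z.1 0, z.2 - 1) ((h4' _ _ ?_).mono hcc4) ?_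
          · simp only [jump]; ext i
            · simp [Subsingleton.elim i 0]
            · simp; omega
          · simp only [dd]; omega
      · refine fin (fun _ => z.1 0 - 1, z.2) ((h2' _ _ ?_).mono hcc2) ?_
        · simp only [jump]; ext i
          · simp [Subsingleton.elim i 0]
          · simp
        · simp only [dd]; omega
  intro z z'
  exact key _ z z' rfl

end

section

variable {μ μ₀ : Zd 1 → ℝ}
open scoped ENNReal

lemma supF (H : Hyp μ μ₀) {α β β₁ τ : ℝ} (h1 : ph μ α β ≤ τ) (h2 : ph μ α β₁ ≤ τ)
    (h3 : ph μ₀ α β₁ < τ) : ∃ A : ℝ, 0 ≤ A ∧ ∀ n,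
    ∑' w, kE μ μ₀ n 0 w * ENNReal.ofReal (ewE α β w)
      ≤ ENNReal.ofReal τ ^ n * ENNReal.ofReal (1 + A) := by
  have hτ : 0 ≤ τ := (ph_nonneg H.nn _ _).trans h1
  set A := |ph μ₀ α β - τ| / (τ - ph μ₀ α β₁) with hA
  have hpos : 0 < τ - ph μ₀ α β₁ := by linarith
  have hA0 : 0 ≤ A := div_nonneg (abs_nonneg _) hpos.le
  have hAe : A * (τ - ph μ₀ α β₁) = |ph μ₀ α β - τ| := by
    rw [hA]; field_simp
  refine ⟨A, hA0, fun n => ?_⟩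
  have key := kE_super (μ := μ) (μ₀ := μ₀) (τ := ENNReal.ofReal τ)
    (F := fun w => ENNReal.ofReal (ewE α β w + A * ewE α β₁ w)) (by
      intro z
      have hs := (ker_hasSum H α β z).add ((ker_hasSum H α β₁ z).mul_left A)
      have hs' : HasSum (fun w => ker μ μ₀ z w * (ewE α β w + A * ewE α β₁ w))
          (phz μ μ₀ α β z * ewE α β z + A * (phz μ μ₀ α β₁ z * ewE α β₁ z)) :=
        hasSum_cg hs (fun w => by ring)
      rw [pE_hasSum H (fun w => add_nonneg (ewE_pos _ _ _).le
        (mul_nonneg hA0 (ewE_pos _ _ _).le)) hs', ← ENNReal.ofReal_mul hτ]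
      apply ENNReal.ofReal_le_ofReal
      unfold phz
      split_ifs with hz
      · have e1 : ewE α β z = ewE α 0 z := by simp [ewE, hz]
        have e2 : ewE α β₁ z = ewE α 0 z := by simp [ewE, hz]
        rw [e1, e2]
        have := le_abs_self (ph μ₀ α β - τ)
        have hp := ewE_pos α 0 z
        have : ph μ₀ α β + A * ph μ₀ α β₁ ≤ τ * (1 + A) := by nlinarith
        nlinarith
      · have hp := ewE_pos α β z
        have hp1 := mul_nonneg hA0 (ewE_pos α β₁ z).le
        nlinarith) n 0
  simp only [ewE_zero, mul_one] at key
  refine le_trans (ENNReal.tsum_le_tsum fun w => ?_) key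
  refine mul_le_mul_right (ENNReal.ofReal_le_ofReal ?_) _
  have := mul_nonneg hA0 (ewE_pos α β₁ w).le
  linarith

lemma geomE {τ t : ℝ} (hτ : 0 ≤ τ) (ht : τ < t) :
    ∑' n, (ENNReal.ofReal t⁻¹ * ENNReal.ofReal τ) ^ n ≠ ∞ := by
  have ht0 : 0 < t := lt_of_le_of_lt hτ ht
  rw [ENNReal.tsum_geometric, ← ENNReal.ofReal_mul (by positivity)]
  simp only [ne_eq, ENNReal.inv_eq_top]
  apply (tsub_pos_of_lt _).ne'
  rw [← ENNReal.ofReal_one]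
  apply (ENNReal.ofReal_lt_ofReal_iff one_pos).2
  rw [inv_mul_eq_div, div_lt_one ht0]; exact ht

lemma GE_upper (H : Hyp μ μ₀) {α β β₁ τ t : ℝ} (h1 : ph μ α β ≤ τ) (h2 : ph μ α β₁ ≤ τ)
    (h3 : ph μ₀ α β₁ < τ) (ht : τ < t) : ∃ C : ℝ, 0 < C ∧ ∀ w,
    GE μ μ₀ t 0 w * ENNReal.ofReal (ewE α β w) ≤ ENNReal.ofReal C := by
  obtain ⟨A, hA0, hA⟩ := supF H h1 h2 h3
  have hτ : 0 ≤ τ := (ph_nonneg H.nn _ _).trans h1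
  have hfin := geomE hτ ht
  set S := ∑' n, (ENNReal.ofReal t⁻¹ * ENNReal.ofReal τ) ^ n with hS
  have hfin2 : S * ENNReal.ofReal (1 + A) ≠ ∞ := ENNReal.mul_ne_top hfin (by simp)
  refine ⟨(S * ENNReal.ofReal (1 + A)).toReal + 1, by positivity, fun w => ?_⟩
  have : GE μ μ₀ t 0 w * ENNReal.ofReal (ewE α β w) ≤ S * ENNReal.ofReal (1 + A) := by
    rw [GE, ← ENNReal.tsum_mul_right, hS, ← ENNReal.tsum_mul_right]
    refine ENNReal.tsum_le_tsum fun n => ?_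
    rw [mul_assoc, mul_pow, mul_assoc]
    refine mul_le_mul_right (le_trans ?_ (hA n)) _
    exact ENNReal.le_tsum (f := fun w => kE μ μ₀ n 0 w * ENNReal.ofReal (ewE α β w)) w
  refine this.trans ?_
  rw [← ENNReal.ofReal_toReal hfin2]
  apply ENNReal.ofReal_le_ofReal
  rw [ENNReal.toReal_ofReal (by positivity)]
  linarith

lemma GE_ne_top (H : Hyp μ μ₀) {α β t : ℝ} (h1 : ph μ α β < t) (h2 : ph μ₀ α β < t) (z w : Ed 1) :
    GE μ μ₀ t z w ≠ ∞ := by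
  set τ := max (ph μ α β) (ph μ₀ α β) with hτ
  have hτ0 : 0 ≤ τ := (ph_nonneg H.nn _ _).trans (le_max_left _ _)
  have hfin := geomE hτ0 (max_lt h1 h2)
  have : GE μ μ₀ t z w * ENNReal.ofReal (ewE α β w) ≤
      (∑' n, (ENNReal.ofReal t⁻¹ * ENNReal.ofReal τ) ^ n) * ENNReal.ofReal (ewE α β z) := by
    rw [GE, ← ENNReal.tsum_mul_right, ← ENNReal.tsum_mul_right]
    refine ENNReal.tsum_le_tsum fun n => ?_
    rw [mul_assoc, mul_pow, mul_assoc]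
    exact mul_le_mul_right (kE_ew_le H α β n z w) _
  intro htop
  rw [htop, ENNReal.top_mul (by simpa using ewE_pos _ _ _)] at this
  exact ENNReal.mul_ne_top hfin (by simp) (top_le_iff.1 this)

lemma GE_ne_zero (H : Hyp μ μ₀) {t : ℝ} (ht : 0 < t) (z w : Ed 1) : GE μ μ₀ t z w ≠ 0 := by
  obtain ⟨n, hn⟩ := kE_pos_of_H1 H z w
  intro h
  rw [GE, ENNReal.tsum_eq_zero] at h
  have := h n
  rcases mul_eq_zero.1 this with h' | h'
  · exact absurd h' (pow_ne_zero _ (by simpa using ht))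
  · exact hn h'

lemma rho_le (H : Hyp μ μ₀) (α β : ℝ) : rho μ μ₀ ≤ max (ph μ α β) (ph μ₀ α β) := by
  set τ := max (ph μ α β) (ph μ₀ α β) with hτ
  have hτ0 : 0 ≤ τ := (ph_nonneg H.nn _ _).trans (le_max_left _ _)
  have hnn : ∀ n, 0 ≤ kerN μ μ₀ n 0 0 := fun n => by rw [kerN_eq H]; positivity
  have hle : ∀ n, kerN μ μ₀ n 0 0 ≤ τ ^ n := by
    intro n
    have := kE_ew_le H α β n 0 0
    simp only [ewE_zero, ENNReal.ofReal_one, mul_one] at this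
    rw [kerN_eq H, ← ENNReal.toReal_ofReal (pow_nonneg hτ0 n), ENNReal.ofReal_pow hτ0]
    exact ENNReal.toReal_mono (by finiteness) this
  refine limsup_le_of_le ?_ ?_
  · refine isCoboundedUnder_le_of_le atTop (x := 0) fun n => ?_
    exact Real.rpow_nonneg (hnn n) _
  · filter_upwards [eventually_ge_atTop 1] with n hn
    calc (kerN μ μ₀ n 0 0) ^ ((n : ℝ)⁻¹) ≤ (τ ^ n) ^ ((n : ℝ)⁻¹) :=
          Real.rpow_le_rpow (hnn n) (hle n) (by positivity)
      _ = τ := Real.pow_rpow_inv_natCast hτ0 (by omega)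

end

section

variable {μ μ₀ : Zd 1 → ℝ}
open scoped ENNReal

lemma cont_comp2 {f : ℝ → ℝ → ℝ} (hf : Continuous fun q : ℝ × ℝ => f q.1 q.2) {g h : ℝ → ℝ}
    (hg : Continuous g) (hh : Continuous h) : Continuous fun e => f (g e) (h e) :=
  hf.comp (hg.prodMk hh)

/-- weighted mass -/
def fm (μ μ₀ : Zd 1 → ℝ) (α β : ℝ) (n : ℕ) (w : Ed 1) : ℝ≥0∞ :=
  kE μ μ₀ n 0 w * ENNReal.ofReal (ewE α β w)

lemma chernoff (H : Hyp μ μ₀) {α β β₁ t : ℝ} (ht : ph μ α β = t) (h1 : ph μ α β₁ < t)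
    (h2 : ph μ₀ α β₁ < t) (p q : ℝ) {δ : ℝ} (hδ : 0 < δ) :
    ∃ C r : ℝ, 0 ≤ C ∧ 0 < r ∧ ∀ n : ℕ,
      ∑' w : Ed 1, (if (n : ℝ) * ((p * d1 μ α β + q * d2 μ α β) / t + δ)
          ≤ p * (w.1 0 : ℝ) + q * (w.2 : ℝ) then fm μ μ₀ α β n w else 0)
        ≤ ENNReal.ofReal (C * Real.exp (-r) ^ n * t ^ n) := by
  have ht0 : 0 < t := lt_of_le_of_lt (ph_nonneg H.nn _ _) h1
  have cp : ∀ c : ℝ, ∀ k : ℝ, Continuous fun e : ℝ => c + e * k := fun c k => by fun_prop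
  have ev1 : ∀ᶠ e in nhdsWithin (0:ℝ) (Set.Ioi 0),
      ph μ (α + e * p) β₁ < ph μ (α + e * p) (β + e * q) := by
    apply eventually_nhdsWithin_of_eventually_nhds
    apply (cont_comp2 (cont_ph H.nn H.h3) (cp α p) continuous_const).continuousAt.eventually_lt
      (cont_comp2 (cont_ph H.nn H.h3) (cp α p) (cp β q)).continuousAt
    simpa [ht] using h1
  have ev2 : ∀ᶠ e in nhdsWithin (0:ℝ) (Set.Ioi 0),
      ph μ₀ (α + e * p) β₁ < ph μ (α + e * p) (β + e * q) := by
    apply eventually_nhdsWithin_of_eventually_nhds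
    apply (cont_comp2 (cont_ph H.nn0 H.h30) (cp α p) continuous_const).continuousAt.eventually_lt
      (cont_comp2 (cont_ph H.nn H.h3) (cp α p) (cp β q)).continuousAt
    simpa [ht] using h2
  have ev3 : ∀ᶠ e in nhdsWithin (0:ℝ) (Set.Ioi 0),
      p * d1 μ (α + e * p) (β + e * q) + q * d2 μ (α + e * p) (β + e * q)
        < p * d1 μ α β + q * d2 μ α β + t * (δ / 2) := by
    apply eventually_nhdsWithin_of_eventually_nhds
    have c1 : Continuous fun e => p * d1 μ (α + e * p) (β + e * q)
        + q * d2 μ (α + e * p) (β + e * q) :=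
      ((cont_comp2 (cont_d1 H.nn H.h3) (cp α p) (cp β q)).const_mul p).add
        ((cont_comp2 (cont_d2 H.nn H.h3) (cp α p) (cp β q)).const_mul q)
    apply c1.continuousAt.eventually_lt continuousAt_const
    simp only [zero_mul, add_zero]
    nlinarith
  obtain ⟨e, ⟨⟨e1, e2⟩, e3⟩, he⟩ :=
    (((ev1.and ev2).and ev3).and self_mem_nhdsWithin).exists
  have he : 0 < e := he
  obtain ⟨A, hA0, hA⟩ := supF H (α := α + e * p) (β := β + e * q) (β₁ := β₁) le_rfl e1.le e2
  set τ := ph μ (α + e * p) (β + e * q) with hτ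
  have hτ0 : 0 ≤ τ := ph_nonneg H.nn _ _
  set M := (p * d1 μ α β + q * d2 μ α β) / t with hM
  have hMt : p * d1 μ α β + q * d2 μ α β = M * t := by rw [hM]; field_simp
  have hτt : τ ≤ t * Real.exp (e * (M + δ / 2)) := by
    have sg := subgrad H.nn H.h3 (α + e * p) (β + e * q) α β
    rw [← hτ, ht] at sg
    have : τ ≤ t * (e * (M + δ / 2) + 1) := by
      have h5 : e * (p * d1 μ (α + e * p) (β + e * q) + q * d2 μ (α + e * p) (β + e * q))
          ≤ e * (M * t + t * (δ / 2)) := by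
        apply mul_le_mul_of_nonneg_left _ he.le
        rw [← hMt]; exact e3.le
      nlinarith
    exact this.trans (mul_le_mul_of_nonneg_left (Real.add_one_le_exp _) ht0.le)
  refine ⟨1 + A, e * δ / 2, by linarith, by positivity, fun n => ?_⟩
  have step : ∀ w : Ed 1, (if (n : ℝ) * (M + δ)
          ≤ p * (w.1 0 : ℝ) + q * (w.2 : ℝ) then fm μ μ₀ α β n w else 0)
      ≤ ENNReal.ofReal (Real.exp (-(e * (n * (M + δ))))) *
        (kE μ μ₀ n 0 w * ENNReal.ofReal (ewE (α + e * p) (β + e * q) w)) := by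
    intro w
    split_ifs with hc
    · rw [mul_left_comm, fm, ← ENNReal.ofReal_mul (Real.exp_pos _).le]
      refine mul_le_mul_right (ENNReal.ofReal_le_ofReal ?_) _
      simp only [ewE]
      rw [← Real.exp_add]
      apply Real.exp_le_exp.2
      have := mul_le_mul_of_nonneg_left hc he.le
      nlinarith
    · exact zero_le
  refine (ENNReal.tsum_le_tsum step).trans ?_
  rw [ENNReal.tsum_mul_left]
  refine (mul_le_mul_right (hA n) _).trans ?_
  rw [← ENNReal.ofReal_pow hτ0, ← ENNReal.ofReal_mul (by positivity),
    ← ENNReal.ofReal_mul (by positivity)]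
  apply ENNReal.ofReal_le_ofReal
  have h6 : τ ^ n ≤ (t * Real.exp (e * (M + δ / 2))) ^ n := pow_le_pow_left₀ hτ0 hτt n
  have h7 : Real.exp (-(e * (n * (M + δ)))) * (t * Real.exp (e * (M + δ / 2))) ^ n
      = Real.exp (-(e * δ / 2)) ^ n * t ^ n := by
    rw [mul_pow, ← Real.exp_nat_mul, ← Real.exp_nat_mul, mul_left_comm, ← Real.exp_add, mul_comm]
    congr 2; ring
  calc Real.exp (-(e * (n * (M + δ)))) * (τ ^ n * (1 + A))
      ≤ Real.exp (-(e * (n * (M + δ)))) * ((t * Real.exp (e * (M + δ / 2))) ^ n * (1 + A)) := by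
        gcongr
    _ = (1 + A) * Real.exp (-(e * δ / 2)) ^ n * t ^ n := by rw [← mul_assoc, h7]; ring

lemma mass_lower (H : Hyp μ μ₀) {α β β₁ t : ℝ} (ht : ph μ α β = t) (h1 : ph μ α β₁ < t)
    (h2 : ph μ₀ α β₁ < t) (hb : ph μ₀ α β₁ < ph μ₀ α β) :
    ∃ κ : ℝ, 0 < κ ∧ ∀ n : ℕ, ENNReal.ofReal (κ * t ^ n) ≤ ∑' w, fm μ μ₀ α β n w := by
  have ht0 : 0 < t := lt_of_le_of_lt (ph_nonneg H.nn _ _) h1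
  obtain ⟨A, hA0, hA⟩ := supF H ht.le h1.le h2
  obtain ⟨B, hB0, hB⟩ := supF H h1.le h1.le h2
  set c := max 0 ((t - ph μ₀ α β) / (t - ph μ₀ α β₁)) with hc
  have hp : 0 < t - ph μ₀ α β₁ := by linarith
  have hc0 : 0 ≤ c := le_max_left _ _
  have hc1 : c < 1 := by
    apply max_lt one_pos
    rw [div_lt_one hp]; linarith
  have hcp : t - ph μ₀ α β ≤ c * (t - ph μ₀ α β₁) := by
    rw [← div_le_iff₀ hp]; exact le_max_right _ _
  have fa : ∀ n, ∑' w, fm μ μ₀ α β n w ≠ ∞ := fun n => ne_top_of_le_ne_top (by finiteness) (hA n)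
  have fb : ∀ n, ∑' w, fm μ μ₀ α β₁ n w ≠ ∞ := fun n => ne_top_of_le_ne_top (by finiteness) (hB n)
  set a := fun n => (∑' w, fm μ μ₀ α β n w).toReal with ha
  set b := fun n => (∑' w, fm μ μ₀ α β₁ n w).toReal with hb
  have ea : ∀ n, ∑' w, fm μ μ₀ α β n w = ENNReal.ofReal (a n) := fun n =>
    (ENNReal.ofReal_toReal (fa n)).symm
  have eb : ∀ n, ∑' w, fm μ μ₀ α β₁ n w = ENNReal.ofReal (b n) := fun n =>
    (ENNReal.ofReal_toReal (fb n)).symm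
  have a0 : ∀ n, 0 ≤ a n := fun n => ENNReal.toReal_nonneg
  have b0 : ∀ n, 0 ≤ b n := fun n => ENNReal.toReal_nonneg
  have hrec : ∀ n, t * a n + c * b (n + 1) ≤ a (n + 1) + t * c * b n := by
    intro n
    have E : ENNReal.ofReal t * (∑' w, fm μ μ₀ α β n w) + ENNReal.ofReal c * (∑' w, fm μ μ₀ α β₁ (n+1) w)
        ≤ (∑' w, fm μ μ₀ α β (n+1) w) + ENNReal.ofReal (t * c) * (∑' w, fm μ μ₀ α β₁ n w) := by
      have o1 : ∑' w, fm μ μ₀ α β (n+1) w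
          = ∑' w, kE μ μ₀ n 0 w * ENNReal.ofReal (phz μ μ₀ α β w * ewE α β w) := by
        simp only [fm]; rw [kE_op]; simp only [pE_ew H]
      have o2 : ∑' w, fm μ μ₀ α β₁ (n+1) w
          = ∑' w, kE μ μ₀ n 0 w * ENNReal.ofReal (phz μ μ₀ α β₁ w * ewE α β₁ w) := by
        simp only [fm]; rw [kE_op]; simp only [pE_ew H]
      rw [o1, o2]
      simp only [fm, ← ENNReal.tsum_mul_left, ← ENNReal.tsum_add]
      refine ENNReal.tsum_le_tsum fun w => ?_
      have e1 : 0 ≤ phz μ μ₀ α β w := by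
        unfold phz; split_ifs
        · exact ph_nonneg H.nn0 _ _
        · exact ph_nonneg H.nn _ _
      have e2 : 0 ≤ phz μ μ₀ α β₁ w := by
        unfold phz; split_ifs
        · exact ph_nonneg H.nn0 _ _
        · exact ph_nonneg H.nn _ _
      have w1 := ewE_pos α β w
      have w2 := ewE_pos α β₁ w
      calc _ = kE μ μ₀ n 0 w * ENNReal.ofReal (t * ewE α β w + c * (phz μ μ₀ α β₁ w * ewE α β₁ w)) := by
            rw [ENNReal.ofReal_add (by positivity) (by positivity), ENNReal.ofReal_mul ht0.le,
              ENNReal.ofReal_mul (p := c) hc0]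
            ring
        _ ≤ kE μ μ₀ n 0 w * ENNReal.ofReal (phz μ μ₀ α β w * ewE α β w + t * c * ewE α β₁ w) := by
            refine mul_le_mul_right (ENNReal.ofReal_le_ofReal ?_) _
            unfold phz
            split_ifs with hz
            · have e1 : ewE α β w = ewE α 0 w := by simp [ewE, hz]
              have e2 : ewE α β₁ w = ewE α 0 w := by simp [ewE, hz]
              rw [e1, e2]
              have hp := ewE_pos α 0 w
              nlinarith
            · rw [ht]
              have := mul_le_mul_of_nonneg_left h1.le (mul_nonneg hc0 w2.le)
              nlinarith
        _ = _ := by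
            rw [ENNReal.ofReal_add (by positivity) (by positivity), ENNReal.ofReal_mul (p := t * c) (by positivity)]
            ring
    rw [ea, ea, eb, eb, ← ENNReal.ofReal_mul ht0.le, ← ENNReal.ofReal_mul hc0,
      ← ENNReal.ofReal_mul (by positivity),
      ← ENNReal.ofReal_add (mul_nonneg ht0.le (a0 _)) (mul_nonneg hc0 (b0 _)),
      ← ENNReal.ofReal_add (a0 _) (mul_nonneg (mul_nonneg ht0.le hc0) (b0 _))] at E
    exact (ENNReal.ofReal_le_ofReal_iff (add_nonneg (a0 _)
      (mul_nonneg (mul_nonneg ht0.le hc0) (b0 _)))).1 E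
  have i0 : a 0 = 1 ∧ b 0 = 1 := by
    constructor <;> simp only [ha, hb, fm] <;> rw [kE_op_zero] <;> simp [ewE_zero]
  have fin : ∀ n, (1 - c) * t ^ n ≤ a n - c * b n := by
    intro n
    induction n with
    | zero => rw [i0.1, i0.2]; simp
    | succ n ih =>
      have := mul_le_mul_of_nonneg_left ih ht0.le
      have := hrec n
      rw [pow_succ]
      nlinarith
  refine ⟨1 - c, by linarith, fun n => ?_⟩
  rw [ea]
  apply ENNReal.ofReal_le_ofReal
  have := fin n
  have := mul_nonneg hc0 (b0 n)
  linarith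

end

section

variable {μ μ₀ : Zd 1 → ℝ}
open scoped ENNReal

lemma tail_small (C r ε : ℝ) (hr : 0 < r) (hε : 0 < ε) :
    ∀ᶠ n : ℕ in atTop, C * Real.exp (-r) ^ n < ε := by
  have h1 : Tendsto (fun n : ℕ => C * Real.exp (-r) ^ n) atTop (nhds (C * 0)) :=
    (tendsto_pow_atTop_nhds_zero_of_lt_one (Real.exp_pos _).le
      (by rw [Real.exp_lt_one_iff]; linarith)).const_mul C
  rw [mul_zero] at h1
  exact h1.eventually_lt_const hε

lemma poly_small (R : ℕ) (ε κ : ℝ) (hε : 0 < ε) (hκ : 0 < κ) :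
    ∀ᶠ n : ℕ in atTop, ((2 * (R * n) + 1) * (R * n + 1) : ℝ) * Real.exp (-ε) ^ n < κ := by
  have hlt : Real.exp (-ε) < 1 := by rw [Real.exp_lt_one_iff]; linarith
  have h0 : 0 ≤ Real.exp (-ε) := (Real.exp_pos _).le
  have t0 := tendsto_pow_atTop_nhds_zero_of_lt_one h0 hlt
  have t1 := tendsto_pow_const_mul_const_pow_of_lt_one 1 h0 hlt
  have t2 := tendsto_pow_const_mul_const_pow_of_lt_one 2 h0 hlt
  have := ((t2.const_mul (2 * (R:ℝ) ^ 2)).add (t1.const_mul (3 * (R:ℝ)))).add t0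
  simp only [mul_zero, add_zero] at this
  filter_upwards [this.eventually_lt_const hκ] with n hn
  refine lt_of_eq_of_lt ?_ hn
  ring

lemma exp_pow_eq (ε : ℝ) (n : ℕ) : Real.exp (-ε) ^ n = Real.exp (-(ε * n)) := by
  rw [← Real.exp_nat_mul]; congr 1; ring

lemma window (H : Hyp μ μ₀) {α β β₁ t : ℝ} (ht : ph μ α β = t) (h1 : ph μ α β₁ < t)
    (h2 : ph μ₀ α β₁ < t) (hb : ph μ₀ α β₁ < ph μ₀ α β) {δ ε : ℝ} (hδ : 0 < δ) (hε : 0 < ε) :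
    ∀ᶠ n : ℕ in atTop, ∃ w : Ed 1, |(w.1 0 : ℝ) - n * (d1 μ α β / t)| ≤ δ * n ∧
      |(w.2 : ℝ) - n * (d2 μ α β / t)| ≤ δ * n ∧
      ENNReal.ofReal (Real.exp (-(ε * n))) ≤ GE μ μ₀ t 0 w * ENNReal.ofReal (ewE α β w) := by
  have ht0 : 0 < t := lt_of_le_of_lt (ph_nonneg H.nn _ _) h1
  obtain ⟨κ, hκ, hmass⟩ := mass_lower H ht h1 h2 hb
  obtain ⟨C1, r1, hC1, hr1, T1⟩ := chernoff H ht h1 h2 1 0 hδ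
  obtain ⟨C2, r2, hC2, hr2, T2⟩ := chernoff H ht h1 h2 (-1) 0 hδ
  obtain ⟨C3, r3, hC3, hr3, T3⟩ := chernoff H ht h1 h2 0 1 hδ
  obtain ⟨C4, r4, hC4, hr4, T4⟩ := chernoff H ht h1 h2 0 (-1) hδ
  set m1 := d1 μ α β / t with hm1
  set m2 := d2 μ α β / t with hm2
  obtain ⟨R, hR⟩ := exists_nat_gt (|m1| + |m2| + δ)
  filter_upwards [tail_small C1 r1 (κ / 8) hr1 (by positivity),
    tail_small C2 r2 (κ / 8) hr2 (by positivity),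
    tail_small C3 r3 (κ / 8) hr3 (by positivity), tail_small C4 r4 (κ / 8) hr4 (by positivity),
    poly_small R ε (κ / 8) hε (by positivity)] with n s1 s2 s3 s4 sp
  by_contra hcon
  push Not at hcon
  have tn : 0 < t ^ n := by positivity
  have small : ∀ w : Ed 1, |(w.1 0 : ℝ) - n * m1| ≤ δ * n → |(w.2 : ℝ) - n * m2| ≤ δ * n →
      fm μ μ₀ α β n w ≤ ENNReal.ofReal (Real.exp (-ε) ^ n * t ^ n) := by
    intro w a b
    have hw := hcon w a b
    have : ENNReal.ofReal t⁻¹ ^ n * fm μ μ₀ α β n w ≤ ENNReal.ofReal (Real.exp (-(ε * n))) := by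
      refine le_trans ?_ hw.le
      rw [fm, ← mul_assoc]
      refine mul_le_mul_left ?_ _
      exact ENNReal.le_tsum (f := fun n => ENNReal.ofReal t⁻¹ ^ n * kE μ μ₀ n 0 w) n
    have h2 := mul_le_mul_right this (ENNReal.ofReal (t ^ n))
    rw [← mul_assoc, ← ENNReal.ofReal_pow (by positivity), ← ENNReal.ofReal_mul tn.le, ← mul_pow,
      mul_inv_cancel₀ ht0.ne', one_pow, ENNReal.ofReal_one, one_mul, ← ENNReal.ofReal_mul tn.le] at h2
    rw [exp_pow_eq, mul_comm (Real.exp _)]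
    exact h2
  set g : Ed 1 → ℝ≥0∞ := fun w => if |(w.1 0 : ℝ) - n * m1| ≤ δ * n ∧ |(w.2 : ℝ) - n * m2| ≤ δ * n
    then fm μ μ₀ α β n w else 0 with hg
  set F : Finset (Ed 1) := ((Finset.Icc (-((R * n : ℕ) : ℤ)) ((R * n : ℕ) : ℤ)) ×ˢ
    (Finset.range (R * n + 1))).image (fun q => ((fun _ => q.1, q.2) : Ed 1)) with hF
  have hgF : ∀ w, w ∉ F → g w = 0 := by
    intro w hw
    rw [hg]
    simp only
    rw [if_neg]
    rintro ⟨a, b⟩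
    apply hw
    rw [hF, Finset.mem_image]
    refine ⟨(w.1 0, w.2), ?_, Ed_ext rfl rfl⟩
    have n0 : (0:ℝ) ≤ n := by positivity
    have q1 : |(w.1 0 : ℝ)| ≤ R * n := by
      have := abs_sub_abs_le_abs_sub (w.1 0 : ℝ) (n * m1)
      rw [abs_mul, abs_of_nonneg n0] at this
      have := abs_nonneg m2
      nlinarith
    have q2 : |(w.2 : ℝ)| ≤ R * n := by
      have := abs_sub_abs_le_abs_sub (w.2 : ℝ) (n * m2)
      rw [abs_mul, abs_of_nonneg n0] at this
      have := abs_nonneg m1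
      nlinarith
    rw [abs_le] at q1
    have q2 := (le_abs_self _).trans q2
    simp only [Finset.mem_product, Finset.mem_Icc, Finset.mem_range]
    refine ⟨⟨?_, ?_⟩, ?_⟩
    · exact_mod_cast q1.1
    · exact_mod_cast q1.2
    · have : w.2 ≤ R * n := by exact_mod_cast q2
      omega
  have hcard : (F.card : ℝ) ≤ (2 * (R * n) + 1) * (R * n + 1) := by
    have : F.card ≤ (2 * (R * n) + 1) * (R * n + 1) := by
      refine Finset.card_image_le.trans ?_
      rw [Finset.card_product, Int.card_Icc, Finset.card_range]
      apply le_of_eq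
      congr 1
      omega
    exact_mod_cast this
  have hgsum : ∑' w, g w ≤ ENNReal.ofReal (κ / 8 * t ^ n) := by
    rw [tsum_eq_sum (s := F) hgF]
    calc ∑ w ∈ F, g w ≤ ∑ w ∈ F, ENNReal.ofReal (Real.exp (-ε) ^ n * t ^ n) := by
          refine Finset.sum_le_sum fun w _ => ?_
          rw [hg]; simp only
          split_ifs with h
          · exact small w h.1 h.2
          · exact zero_le
      _ = ENNReal.ofReal (F.card * (Real.exp (-ε) ^ n * t ^ n)) := by
          rw [Finset.sum_const, nsmul_eq_mul, ENNReal.ofReal_mul (p := (F.card : ℝ)) (by positivity),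
            ENNReal.ofReal_natCast]
      _ ≤ _ := by
          apply ENNReal.ofReal_le_ofReal
          rw [← mul_assoc]
          apply mul_le_mul_of_nonneg_right _ tn.le
          refine le_trans ?_ sp.le
          exact mul_le_mul_of_nonneg_right hcard (by positivity)
  have T1' := (T1 n).trans (ENNReal.ofReal_le_ofReal (mul_le_mul_of_nonneg_right s1.le tn.le))
  have T2' := (T2 n).trans (ENNReal.ofReal_le_ofReal (mul_le_mul_of_nonneg_right s2.le tn.le))
  have T3' := (T3 n).trans (ENNReal.ofReal_le_ofReal (mul_le_mul_of_nonneg_right s3.le tn.le))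
  have T4' := (T4 n).trans (ENNReal.ofReal_le_ofReal (mul_le_mul_of_nonneg_right s4.le tn.le))
  have tot := add_le_add (add_le_add (add_le_add (add_le_add hgsum T1') T2') T3') T4'
  simp only [← ENNReal.tsum_add] at tot
  have hk : 0 ≤ κ / 8 * t ^ n := by positivity
  rw [← ENNReal.ofReal_add hk hk, ← ENNReal.ofReal_add (by linarith) hk,
    ← ENNReal.ofReal_add (by linarith) hk, ← ENNReal.ofReal_add (by linarith) hk] at tot
  have fin := (hmass n).trans (le_trans (ENNReal.tsum_le_tsum fun w => ?_) tot)
  · rw [ENNReal.ofReal_le_ofReal_iff (by linarith)] at fin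
    nlinarith
  · have e1 : ∀ p q : ℝ, (p * d1 μ α β + q * d2 μ α β) / t = p * m1 + q * m2 := by
      intro p q; rw [hm1, hm2]; ring
    simp only [e1]
    by_cases c1 : (n : ℝ) * (1 * m1 + 0 * m2 + δ) ≤ 1 * (w.1 0 : ℝ) + 0 * (w.2 : ℝ)
    · rw [if_pos c1]; exact le_add_right (le_add_right (le_add_right (le_add_left le_rfl)))
    by_cases c2 : (n : ℝ) * (-1 * m1 + 0 * m2 + δ) ≤ -1 * (w.1 0 : ℝ) + 0 * (w.2 : ℝ)
    · rw [if_pos c2]; exact le_add_right (le_add_right (le_add_left le_rfl))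
    by_cases c3 : (n : ℝ) * (0 * m1 + 1 * m2 + δ) ≤ 0 * (w.1 0 : ℝ) + 1 * (w.2 : ℝ)
    · rw [if_pos c3]; exact le_add_right (le_add_left le_rfl)
    by_cases c4 : (n : ℝ) * (0 * m1 + -1 * m2 + δ) ≤ 0 * (w.1 0 : ℝ) + -1 * (w.2 : ℝ)
    · rw [if_pos c4]; exact le_add_left le_rfl
    have : g w = fm μ μ₀ α β n w := by
      rw [hg]; simp only
      rw [if_pos]
      rw [abs_le, abs_le]
      rw [not_le] at c1 c2 c3 c4
      refine ⟨⟨?_, ?_⟩, ⟨?_, ?_⟩⟩ <;> linarith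
    rw [this]
    exact le_add_right (le_add_right (le_add_right (le_add_right le_rfl)))

/-- lattice point -/
def pt (x : ℤ) (y : ℕ) : Ed 1 := (fun _ => x, y)

/-- logarithm of the Green function from the origin -/
def lg (μ μ₀ : Zd 1 → ℝ) (t : ℝ) (x : ℤ) (y : ℕ) : ℝ := Real.log (GE μ μ₀ t 0 (pt x y)).toReal

lemma exp_lg (H : Hyp μ μ₀) {t : ℝ} (ht : 0 < t) (hf : ∀ z w, GE μ μ₀ t z w ≠ ∞) (x : ℤ) (y : ℕ) :
    ENNReal.ofReal (Real.exp (lg μ μ₀ t x y)) = GE μ μ₀ t 0 (pt x y) := by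
  rw [lg, Real.exp_log (ENNReal.toReal_pos (GE_ne_zero H ht _ _) (hf _ _)),
    ENNReal.ofReal_toReal (hf _ _)]

set_option maxHeartbeats 1000000 in
theorem lowerG (H : Hyp μ μ₀) {α β β₁ t : ℝ} (ht : ph μ α β = t) (h1 : ph μ α β₁ < t)
    (h2 : ph μ₀ α β₁ < t) (hb : ph μ₀ α β₁ < ph μ₀ α β) (hd : 0 < d2 μ α β) {ε : ℝ} (hε : 0 < ε) :
    ∃ Y : ℕ, ∀ y : ℕ, Y ≤ y → ∀ x : ℤ, |(x : ℝ) - d1 μ α β / d2 μ α β * y| ≤ 1 →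
      -α * x - β * y - ε * y ≤ lg μ μ₀ t x y := by
  have ht0 : 0 < t := lt_of_le_of_lt (ph_nonneg H.nn _ _) h1
  obtain ⟨c, hc0, hc1, har⟩ := harnack H ht0
  have hft := GE_ne_top H h1 h2
  set m1 := d1 μ α β / t with hm1
  set m2 := d2 μ α β / t with hm2
  have hm2p : 0 < m2 := div_pos hd ht0
  have hv : d1 μ α β / d2 μ α β = m1 / m2 := by rw [hm1, hm2]; field_simp
  rw [hv]
  set l := -Real.log c with hl
  have hlp : 0 < l := by have := Real.log_neg hc0 hc1; linarith
  set B := |α| + |β| + l with hB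
  have hBp : 0 < B := by positivity
  set δ := ε * m2 / (8 * B) with hδ
  have hδp : 0 < δ := by positivity
  set K := 1 + |m1| + m2 with hK
  have hw := window H ht h1 h2 hb hδp (show 0 < ε * m2 / 4 by positivity)
  obtain ⟨N, hN⟩ := eventually_atTop.1 hw
  obtain ⟨Y1, hY1⟩ := exists_nat_gt ((N + 1) * m2)
  obtain ⟨Y2, hY2⟩ := exists_nat_gt (B * K / (ε / 4))
  refine ⟨max Y1 Y2, fun y hy x hx => ?_⟩
  have hy1 : (N + 1) * m2 < y := hY1.trans_le (by exact_mod_cast (le_max_left _ _).trans hy)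
  have hy2 : B * K < ε / 4 * y := by
    have : B * K / (ε / 4) < y := hY2.trans_le (by exact_mod_cast (le_max_right _ _).trans hy)
    rw [div_lt_iff₀ (by positivity)] at this; linarith
  set n := ⌊(y : ℝ) / m2⌋₊ with hn
  have n1 : (n : ℝ) * m2 ≤ y := by
    rw [← le_div_iff₀ hm2p]; exact Nat.floor_le (by positivity)
  have n2 : (y : ℝ) < (n + 1) * m2 := by
    rw [← div_lt_iff₀ hm2p]; exact Nat.lt_floor_add_one _
  have hNn : N ≤ n := by
    by_contra hc
    have : (n : ℝ) + 1 ≤ N := by exact_mod_cast (by omega : n + 1 ≤ N)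
    nlinarith
  obtain ⟨w, w1, w2, w3⟩ := hN n hNn
  have q2 : |(y : ℝ) - w.2| ≤ m2 + δ * n := by
    rw [abs_le] at w2 ⊢; constructor <;> linarith [w2.1, w2.2]
  have q1 : |(x : ℝ) - w.1 0| ≤ 1 + |m1| + δ * n := by
    have e : m1 / m2 * y - n * m1 = m1 * (y / m2 - n) := by field_simp
    have e2 : |m1 / m2 * y - n * m1| ≤ |m1| := by
      rw [e, abs_mul]
      have : |(y : ℝ) / m2 - n| ≤ 1 := by
        rw [abs_le]; constructor
        · have := Nat.floor_le (show 0 ≤ (y:ℝ) / m2 by positivity); rw [← hn] at this; linarith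
        · have := Nat.lt_floor_add_one ((y:ℝ) / m2); rw [← hn] at this; linarith
      have := abs_nonneg m1
      nlinarith
    rw [abs_le] at e2 w1 hx ⊢; constructor <;> linarith [e2.1, e2.2, w1.1, w1.2, hx.1, hx.2]
  obtain ⟨m, hm⟩ := har w (pt x y)
  have hddR : (dd w (pt x y) : ℝ) = |(x : ℝ) - w.1 0| + |(y : ℝ) - w.2| := by
    simp only [dd, pt]
    push_cast [Nat.cast_natAbs]
    rfl
  set D := dd w (pt x y) with hD
  have hDle : (D : ℝ) ≤ K + 2 * δ * n := by rw [hddR]; linarith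
  have chain : ENNReal.ofReal (Real.exp (-(ε * m2 / 4 * n))) * ENNReal.ofReal (c ^ D)
      ≤ ENNReal.ofReal (Real.exp (lg μ μ₀ t x y)) * ENNReal.ofReal (ewE α β w) := by
    rw [exp_lg H ht0 hft]
    calc _ ≤ (GE μ μ₀ t 0 w * ENNReal.ofReal (ewE α β w)) * (ENNReal.ofReal t⁻¹ ^ m * kE μ μ₀ m w (pt x y)) :=
          mul_le_mul' w3 hm
      _ = (GE μ μ₀ t 0 w * (ENNReal.ofReal t⁻¹ ^ m * kE μ μ₀ m w (pt x y))) * ENNReal.ofReal (ewE α β w) := by ring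
      _ ≤ _ := mul_le_mul_left (GE_ge_right _ _ _ _ _) _
  rw [← ENNReal.ofReal_mul (Real.exp_pos _).le, ← ENNReal.ofReal_mul (Real.exp_pos _).le,
    ENNReal.ofReal_le_ofReal_iff (mul_pos (Real.exp_pos _) (ewE_pos _ _ _)).le] at chain
  have hcD : c ^ D = Real.exp (-(l * D)) := by
    rw [hl, ← Real.rpow_natCast, Real.rpow_def_of_pos hc0]; congr 1; ring
  rw [hcD, ewE, ← Real.exp_add, ← Real.exp_add, Real.exp_le_exp] at chain
  have k1 : α * (w.1 0 : ℝ) ≤ α * x + |α| * |(x : ℝ) - w.1 0| := by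
    rw [← abs_mul]; have := neg_abs_le (α * ((x : ℝ) - w.1 0)); linarith
  have k2 : β * (w.2 : ℝ) ≤ β * y + |β| * |(y : ℝ) - w.2| := by
    rw [← abs_mul]; have := neg_abs_le (β * ((y : ℝ) - w.2)); linarith
  have k3 : |α| * |(x : ℝ) - w.1 0| + |β| * |(y : ℝ) - w.2| + l * D ≤ B * D := by
    rw [hB, hddR]
    have := mul_nonneg (abs_nonneg α) (abs_nonneg ((y : ℝ) - w.2))
    have := mul_nonneg (abs_nonneg β) (abs_nonneg ((x : ℝ) - w.1 0))
    linarith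
  have k4 : B * D ≤ B * K + ε * m2 / 4 * n := by
    have : B * (2 * δ * n) = ε * m2 / 4 * n := by rw [hδ]; field_simp; ring
    have h := mul_le_mul_of_nonneg_left hDle hBp.le
    rw [mul_add, this] at h; exact h
  have k5 : ε * m2 / 4 * n ≤ ε / 4 * y := by
    have := mul_le_mul_of_nonneg_left n1 (show 0 ≤ ε / 4 by positivity)
    linarith
  have : 0 ≤ ε * y := by positivity
  linarith

end

section

variable {μ μ₀ : Zd 1 → ℝ}
open scoped ENNReal

/-- nonnegative `t`-harmonic functions -/
def Har (μ μ₀ : Zd 1 → ℝ) (t : ℝ) (h : Ed 1 → ℝ) : Prop :=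
  (∀ z, 0 ≤ h z) ∧ ∀ z, HasSum (fun w => ker μ μ₀ z w * h w) (t * h z)

/-- superharmonic functions -/
def SupR (μ μ₀ : Zd 1 → ℝ) (t : ℝ) (h : Ed 1 → ℝ) : Prop :=
  ∀ z, Summable (fun w => ker μ μ₀ z w * h w) ∧ ∑' w, ker μ μ₀ z w * h w ≤ t * h z

lemma Har.sup {t : ℝ} {h : Ed 1 → ℝ} (hh : Har μ μ₀ t h) : SupR μ μ₀ t h :=
  fun z => ⟨(hh.2 z).summable, (hh.2 z).tsum_eq.le⟩

lemma Har.lower (H : Hyp μ μ₀) {t : ℝ} (ht : 0 < t) {h : Ed 1 → ℝ} (hh : Har μ μ₀ t h)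
    {c : ℝ} (hc : 0 ≤ c) {z z' : Ed 1} (hr : RA μ μ₀ t c z z') : c * h z' ≤ h z := by
  obtain ⟨m, hm⟩ := hr
  have key := kE_super (μ := μ) (μ₀ := μ₀) (τ := ENNReal.ofReal t)
    (F := fun w => ENNReal.ofReal (h w)) (by
      intro z
      rw [pE_hasSum H hh.1 (hh.2 z), ENNReal.ofReal_mul ht.le]) m z
  have k2 : kE μ μ₀ m z z' * ENNReal.ofReal (h z') ≤ ENNReal.ofReal t ^ m * ENNReal.ofReal (h z) :=
    le_trans (ENNReal.le_tsum (f := fun w => kE μ μ₀ m z w * ENNReal.ofReal (h w)) z') key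
  have k3 := mul_le_mul_right k2 (ENNReal.ofReal t⁻¹ ^ m)
  rw [← mul_assoc, ← mul_assoc, ← mul_pow, ← ENNReal.ofReal_mul (by positivity),
    inv_mul_cancel₀ ht.ne', ENNReal.ofReal_one, one_pow, one_mul] at k3
  have k4 := (mul_le_mul_left hm (ENNReal.ofReal (h z'))).trans k3
  rw [← ENNReal.ofReal_mul hc, ENNReal.ofReal_le_ofReal_iff (hh.1 z)] at k4
  exact k4

lemma Har.ew (H : Hyp μ μ₀) {t α b : ℝ} (h1 : ph μ α b = t) (h2 : ph μ₀ α b = t) :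
    Har μ μ₀ t (ewE α b) := by
  refine ⟨fun z => (ewE_pos _ _ _).le, fun z => ?_⟩
  have := ker_hasSum H α b z
  unfold phz at this
  rw [h1, h2, ite_self] at this
  exact this

lemma Har.shift {t : ℝ} {h : Ed 1 → ℝ} (hh : Har μ μ₀ t h) (k : ℤ) :
    Har μ μ₀ t (fun z => h (sh k z)) := by
  refine ⟨fun z => hh.1 _, fun z => ?_⟩
  have := (sh k).hasSum_iff.2 (hh.2 (sh k z))
  refine hasSum_cg this fun w => ?_
  simp only [Function.comp, ker_sh]

/-- D1 : comparison from below -/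
lemma compD1 (H : Hyp μ μ₀) {t α b β : ℝ} {f : ℕ → ℝ} (hf : ∀ y, 0 ≤ f y)
    (hF : SupR μ μ₀ t (fun z => Real.exp (α * (z.1 0 : ℝ)) * f z.2)) (hb : t ≤ ph μ α b)
    (hβ : ph μ α β ≤ t) (hbβ : b < β) (y : ℕ) : f 0 * Real.exp (b * y) ≤ f y := by
  have main : ∀ δ : ℝ, 0 < δ → ∀ y : ℕ, f 0 * Real.exp (b * y) ≤ f y + δ * Real.exp (β * y) := by
    intro δ hδ
    by_contra hcon
    push Not at hcon
    obtain ⟨y₁, hy₁⟩ := hcon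
    set r : ℕ → ℝ := fun y => (f y + δ * Real.exp (β * y) - f 0 * Real.exp (b * y)) * Real.exp (-(β * y))
      with hr
    have hr1 : r y₁ < 0 := mul_neg_of_neg_of_pos (by linarith) (Real.exp_pos _)
    have hrlow : ∀ y : ℕ, δ - f 0 * Real.exp (-(β - b)) ^ y ≤ r y := by
      intro y
      have e1 : Real.exp (β * y) * Real.exp (-(β * y)) = 1 := by rw [← Real.exp_add]; simp
      have e2 : Real.exp (b * y) * Real.exp (-(β * y)) = Real.exp (-(β - b)) ^ y := by
        rw [exp_pow_eq, ← Real.exp_add]; congr 1; ring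
      have e3 := mul_nonneg (hf y) (Real.exp_pos (-(β * y))).le
      have : r y = f y * Real.exp (-(β * y)) + δ * (Real.exp (β * y) * Real.exp (-(β * y)))
          - f 0 * (Real.exp (b * y) * Real.exp (-(β * y))) := by rw [hr]; ring
      rw [this, e1, e2]
      linarith
    obtain ⟨N, hN⟩ := eventually_atTop.1 (tail_small (f 0) (β - b) δ (by linarith) hδ)
    obtain ⟨y₀, -, hmin⟩ := Finset.exists_min_image (Finset.range (N + y₁ + 1)) r ⟨y₁, by simp⟩
    have hmin1 : r y₀ < 0 := (hmin y₁ (by simp)).trans_lt hr1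
    have hminall : ∀ y, r y₀ ≤ r y := by
      intro y
      by_cases hy : y < N + y₁ + 1
      · exact hmin y (by simpa using hy)
      · have := hN y (by omega)
        have := hrlow y
        linarith
    set κ := - r y₀ with hκ
    have hκ0 : 0 < κ := by linarith
    set W : ℕ → ℝ := fun y => f y + (δ + κ) * Real.exp (β * y) - f 0 * Real.exp (b * y) with hW
    have hWr : ∀ y, W y = (r y + κ) * Real.exp (β * y) := by
      intro y
      have e1 : Real.exp (-(β * y)) * Real.exp (β * y) = 1 := by rw [← Real.exp_add]; simp
      rw [hW, hr]
      simp only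
      linear_combination -(f y + δ * Real.exp (β * y) - f 0 * Real.exp (b * y)) * e1
    have hW0 : ∀ y, 0 ≤ W y := fun y => by
      rw [hWr]; exact mul_nonneg (by linarith [hminall y]) (Real.exp_pos _).le
    have hdown : ∀ y, W (y + 1) = 0 → W y = 0 := by
      intro y hy
      obtain ⟨e, he2, he⟩ := exists_down H
      have hz2 : (pt 0 (y + 1)).2 ≠ 0 := by simp [pt]
      obtain ⟨w, hw⟩ := jump_range (pt 0 (y + 1)) e (by rw [he2]; simp [pt])
      have hker : ker μ μ₀ (pt 0 (y + 1)) w = μ e := by rw [ker, if_neg hz2, hw]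
      have hw2 : w.2 = y := by
        have := congrArg Prod.snd hw
        simp only [jump, pt, he2] at this
        push_cast at this
        omega
      have s1 := (hF (pt 0 (y + 1)))
      have s2 := (ker_hasSum H α β (pt 0 (y + 1))).mul_left (δ + κ)
      have s3 := (ker_hasSum H α b (pt 0 (y + 1))).mul_left (f 0)
      have s := (s1.1.hasSum.add s2).sub s3
      have s' : HasSum (fun w => ker μ μ₀ (pt 0 (y + 1)) w * (Real.exp (α * (w.1 0 : ℝ)) * W w.2)) _ :=
        hasSum_cg s (fun w => by
          rw [hW]; simp only [ewE, Real.exp_add]; ring)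
      have hle := le_hasSum s' w (fun v _ => mul_nonneg (ker_nn H _ _)
        (mul_nonneg (Real.exp_pos _).le (hW0 _)))
      have hval : ∑' (w : Ed 1), ker μ μ₀ (pt 0 (y + 1)) w * (Real.exp (α * (w.1 0:ℝ)) * f w.2) +
          (δ + κ) * (phz μ μ₀ α β (pt 0 (y + 1)) * ewE α β (pt 0 (y + 1))) -
          f 0 * (phz μ μ₀ α b (pt 0 (y + 1)) * ewE α b (pt 0 (y + 1))) ≤ t * W (y + 1) := by
        have q1 := s1.2
        have p1 : phz μ μ₀ α β (pt 0 (y + 1)) = ph μ α β := by rw [phz, if_neg hz2]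
        have p2 : phz μ μ₀ α b (pt 0 (y + 1)) = ph μ α b := by rw [phz, if_neg hz2]
        have p3 : ∀ β, ewE α β (pt 0 (y + 1)) = Real.exp (β * ((y + 1 : ℕ) : ℝ)) := by
          intro β; simp [ewE, pt]
        rw [p1, p2, p3, p3]
        have p4 : t * (Real.exp (α * ((pt 0 (y + 1)).1 0 : ℝ)) * f (pt 0 (y + 1)).2) = t * f (y + 1) := by
          simp [pt]
        rw [p4] at q1
        have q2 := mul_le_mul_of_nonneg_right hβ
          (mul_nonneg (show 0 ≤ δ + κ by linarith) (Real.exp_pos (β * ((y + 1 : ℕ) : ℝ))).le)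
        have q3 := mul_le_mul_of_nonneg_right hb
          (mul_nonneg (hf 0) (Real.exp_pos (b * ((y + 1 : ℕ) : ℝ))).le)
        rw [hW]; simp only
        linarith
      rw [hy, mul_zero] at hval
      have hle2 := hle.trans hval
      rw [hker, hw2] at hle2
      have hp : 0 < μ e * Real.exp (α * (w.1 0 : ℝ)) := mul_pos he (Real.exp_pos _)
      have : W y ≤ 0 := by
        by_contra hc
        push Not at hc
        have := mul_pos hp hc
        linarith
      exact le_antisymm this (hW0 y)
    have hz : W y₀ = 0 := by rw [hWr, hκ]; simp
    have hall : ∀ y, W y = 0 → W 0 = 0 := by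
      intro y
      induction y with
      | zero => exact id
      | succ y ih => exact fun h => ih (hdown y h)
    have hfin := hall y₀ hz
    rw [hW] at hfin
    simp only [Nat.cast_zero, mul_zero, Real.exp_zero, mul_one] at hfin
    linarith
  refine le_of_forall_pos_le_add fun ε hε => ?_
  have := main (ε * Real.exp (-(β * y))) (by positivity) y
  rw [mul_assoc, ← Real.exp_add] at this
  simpa using this

lemma interp (H : Hyp μ μ₀) {t : ℝ} {u v : Ed 1 → ℝ} (hu : Har μ μ₀ t u)
    (hv : Har μ μ₀ t v) (hup : ∀ z, 0 < u z) (hvp : ∀ z, 0 < v z) {θ : ℝ} (h0 : 0 ≤ θ) (h1 : θ ≤ 1) :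
    SupR μ μ₀ t (fun z => u z ^ θ * v z ^ (1 - θ)) := by
  intro z
  have hs : HasSum (fun w => u z ^ θ * v z ^ (1 - θ) * (θ * ((u z)⁻¹ * (ker μ μ₀ z w * u w))
      + (1 - θ) * ((v z)⁻¹ * (ker μ μ₀ z w * v w))))
      (u z ^ θ * v z ^ (1 - θ) * (θ * ((u z)⁻¹ * (t * u z)) + (1 - θ) * ((v z)⁻¹ * (t * v z)))) :=
    ((((hu.2 z).mul_left _).mul_left _).add (((hv.2 z).mul_left _).mul_left _)).mul_left _
  have hval : u z ^ θ * v z ^ (1 - θ) * (θ * ((u z)⁻¹ * (t * u z)) + (1 - θ) * ((v z)⁻¹ * (t * v z)))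
      = t * (u z ^ θ * v z ^ (1 - θ)) := by
    have a := (hup z).ne'
    have b := (hvp z).ne'
    field_simp
    ring
  rw [hval] at hs
  have hle : ∀ w, ker μ μ₀ z w * (u w ^ θ * v w ^ (1 - θ)) ≤
      u z ^ θ * v z ^ (1 - θ) * (θ * ((u z)⁻¹ * (ker μ μ₀ z w * u w))
      + (1 - θ) * ((v z)⁻¹ * (ker μ μ₀ z w * v w))) := by
    intro w
    have am := Real.geom_mean_le_arith_mean2_weighted h0 (sub_nonneg.2 h1)
      (div_pos (hup w) (hup z)).le (div_pos (hvp w) (hvp z)).le (by ring)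
    rw [Real.div_rpow (hup w).le (hup z).le, Real.div_rpow (hvp w).le (hvp z).le] at am
    have pz : 0 < u z ^ θ * v z ^ (1 - θ) :=
      mul_pos (Real.rpow_pos_of_pos (hup z) _) (Real.rpow_pos_of_pos (hvp z) _)
    have e : u w ^ θ * v w ^ (1 - θ) =
        u z ^ θ * v z ^ (1 - θ) * (u w ^ θ / u z ^ θ * (v w ^ (1 - θ) / v z ^ (1 - θ))) := by
      have a := (Real.rpow_pos_of_pos (hup z) θ).ne'
      have b := (Real.rpow_pos_of_pos (hvp z) (1 - θ)).ne'
      field_simp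
    have := mul_le_mul_of_nonneg_left (mul_le_mul_of_nonneg_left am pz.le) (ker_nn H z w)
    rw [← e] at this
    refine this.trans (le_of_eq ?_)
    have a := (hup z).ne'
    have b := (hvp z).ne'
    field_simp
  have hsm : Summable (fun w => ker μ μ₀ z w * (u w ^ θ * v w ^ (1 - θ))) :=
    Summable.of_nonneg_of_le (fun w => mul_nonneg (ker_nn H _ _)
      (mul_nonneg (Real.rpow_nonneg (hup w).le _) (Real.rpow_nonneg (hvp w).le _))) hle hs.summable
  exact ⟨hsm, hasSum_le hle hsm.hasSum hs⟩

end

section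

variable {μ μ₀ : Zd 1 → ℝ}
open scoped ENNReal

/-- data for the extremal analysis at the level `t` -/
structure ChD (μ μ₀ : Zd 1 → ℝ) (t α' b₂ : ℝ) (s : ℤ) : Prop where
  hs : s = 1 ∨ s = -1
  e1 : ph μ α' b₂ = t
  e2 : ph μ₀ α' b₂ = t
  dneg : d2 μ α' b₂ < 0
  hgt : ∀ α b, 0 < s * (α - α') → t < max (ph μ α b) (ph μ₀ α b)
  fin : ∃ α β, ph μ α β < t ∧ ph μ₀ α β < t

/-- majorant -/
def bw (l : ℝ) (w : Ed 1) : ℝ := ewE l l w + ewE (-l) l w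

lemma bw_summable (H : Hyp μ μ₀) (l : ℝ) (z : Ed 1) : Summable (fun w => ker μ μ₀ z w * bw l w) :=
  ((ker_hasSum H l l z).summable.add (ker_hasSum H (-l) l z).summable).congr
    (fun w => by simp only [bw]; ring)

lemma bw_ge {c : ℝ} (hc0 : 0 < c) (w : Ed 1) : (c ^ dd 0 w)⁻¹ ≤ bw (-Real.log c) w := by
  set l := -Real.log c with hl
  have hcD : (c ^ dd 0 w)⁻¹ = Real.exp (l * dd 0 w) := by
    rw [hl, ← Real.rpow_natCast, Real.rpow_def_of_pos hc0, ← Real.exp_neg]; congr 1; ring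
  have hddR : (dd 0 w : ℝ) = |(w.1 0 : ℝ)| + (w.2 : ℝ) := by
    simp only [dd]
    push_cast [Nat.cast_natAbs]
    simp
  rw [hcD, hddR, bw]
  rcases abs_cases (w.1 0 : ℝ) with h | h
  · have : Real.exp (l * (|(w.1 0 : ℝ)| + (w.2 : ℝ))) = ewE l l w := by
      rw [h.1, ewE]; congr 1; ring
    rw [this]; linarith [ewE_pos (-l) l w]
  · have : Real.exp (l * (|(w.1 0 : ℝ)| + (w.2 : ℝ))) = ewE (-l) l w := by
      rw [h.1, ewE]; congr 1; ring
    rw [this]; linarith [ewE_pos l l w]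

lemma har_lim (H : Hyp μ μ₀) {t l : ℝ} {ι : Type*} {F : Filter ι} [F.NeBot] {f : ι → Ed 1 → ℝ}
    {h : Ed 1 → ℝ} (hb : ∀ᶠ i in F, ∀ w, 0 ≤ f i w ∧ f i w ≤ bw l w)
    (hz : ∀ z, Tendsto (fun i => ∑' w, ker μ μ₀ z w * f i w - t * f i z) F (nhds 0))
    (hf : ∀ w, Tendsto (fun i => f i w) F (nhds (h w))) : Har μ μ₀ t h := by
  have h0 : ∀ w, 0 ≤ h w := fun w => ge_of_tendsto (hf w) (hb.mono fun i hi => (hi w).1)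
  have h1 : ∀ w, h w ≤ bw l w := fun w => le_of_tendsto (hf w) (hb.mono fun i hi => (hi w).2)
  refine ⟨h0, fun z => ?_⟩
  have hs : Summable (fun w => ker μ μ₀ z w * h w) :=
    Summable.of_nonneg_of_le (fun w => mul_nonneg (ker_nn H _ _) (h0 w))
      (fun w => mul_le_mul_of_nonneg_left (h1 w) (ker_nn H _ _)) (bw_summable H l z)
  have t1 : Tendsto (fun i => ∑' w, ker μ μ₀ z w * f i w) F (nhds (∑' w, ker μ μ₀ z w * h w)) := by
    refine tendsto_tsum_of_dominated_convergence (bw_summable H l z) (fun w => (hf w).const_mul _) ?_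
    filter_upwards [hb] with i hi w
    rw [Real.norm_of_nonneg (mul_nonneg (ker_nn H _ _) (hi w).1)]
    exact mul_le_mul_of_nonneg_left (hi w).2 (ker_nn H _ _)
  have t2 := tendsto_nhds_unique (t1.sub ((hf z).const_mul t)) (hz z)
  have : ∑' w, ker μ μ₀ z w * h w = t * h z := by linarith
  rw [← this]; exact hs.hasSum

/-- normalized harmonic functions -/
def CC (μ μ₀ : Zd 1 → ℝ) (t : ℝ) : Set (Ed 1 → ℝ) := {h | Har μ μ₀ t h ∧ h 0 = 1}

lemma CC_bound (H : Hyp μ μ₀) {t : ℝ} (ht : 0 < t) : ∃ l : ℝ, ∀ h ∈ CC μ μ₀ t, ∀ w, h w ≤ bw l w := by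
  obtain ⟨c, hc0, hc1, har⟩ := harnack H ht
  refine ⟨-Real.log c, fun h hh w => ?_⟩
  have := hh.1.lower H ht (by positivity) (har 0 w)
  rw [hh.2] at this
  refine le_trans ?_ (bw_ge hc0 w)
  rw [← one_div, le_div_iff₀ (by positivity)]
  linarith

lemma CC_compact (H : Hyp μ μ₀) {t : ℝ} (ht : 0 < t) : IsCompact (CC μ μ₀ t) := by
  obtain ⟨l, hl⟩ := CC_bound H ht
  have hbox : IsCompact (Set.pi Set.univ fun w : Ed 1 => Set.Icc (0:ℝ) (bw l w)) :=
    isCompact_univ_pi fun w => isCompact_Icc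
  refine hbox.of_isClosed_subset ?_ (fun h hh w _ => ⟨hh.1.1 w, hl h hh w⟩)
  refine isClosed_of_closure_subset fun h hh => ?_
  rw [mem_closure_iff_nhdsWithin_neBot] at hh
  have hmem : ∀ᶠ f in nhdsWithin h (CC μ μ₀ t), f ∈ CC μ μ₀ t := self_mem_nhdsWithin
  have hten : ∀ w, Tendsto (fun f : Ed 1 → ℝ => f w) (nhdsWithin h (CC μ μ₀ t)) (nhds (h w)) :=
    fun w => ((continuous_apply w).tendsto h).mono_left nhdsWithin_le_nhds
  refine ⟨har_lim H (F := nhdsWithin h (CC μ μ₀ t)) (f := fun f => f) (l := l)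
    (hmem.mono fun f hf w => ⟨hf.1.1 w, hl f hf w⟩) (fun z => ?_) hten, ?_⟩
  · refine tendsto_const_nhds.congr' (hmem.mono fun f hf => ?_)
    simp only
    rw [(hf.1.2 z).tsum_eq, sub_self]
  · refine tendsto_nhds_unique (hten 0) (tendsto_const_nhds.congr' (hmem.mono fun f hf => ?_))
    exact hf.2.symm

lemma CC_convex {t : ℝ} : Convex ℝ (CC μ μ₀ t) := by
  rintro f ⟨hf, hf0⟩ g ⟨hg, hg0⟩ a b ha hb hab
  refine ⟨⟨fun z => ?_, fun z => ?_⟩, ?_⟩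
  · simp only [Pi.add_apply, Pi.smul_apply, smul_eq_mul]
    exact add_nonneg (mul_nonneg ha (hf.1 z)) (mul_nonneg hb (hg.1 z))
  · have := ((hf.2 z).mul_left a).add ((hg.2 z).mul_left b)
    have e : t * (a • f + b • g) z = a * (t * f z) + b * (t * g z) := by
      simp only [Pi.add_apply, Pi.smul_apply, smul_eq_mul]; ring
    rw [e]
    refine hasSum_cg this fun w => ?_
    simp only [Pi.add_apply, Pi.smul_apply, smul_eq_mul]; ring
  · simp only [Pi.add_apply, Pi.smul_apply, smul_eq_mul, hf0, hg0]; linarith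

lemma har_pos (H : Hyp μ μ₀) {t : ℝ} (ht : 0 < t) {u : Ed 1 → ℝ} (hu : u ∈ CC μ μ₀ t) (z : Ed 1) :
    0 < u z := by
  obtain ⟨c, hc0, hc1, har⟩ := harnack H ht
  have := hu.1.lower H ht (by positivity) (har z 0)
  rw [hu.2, mul_one] at this
  exact lt_of_lt_of_le (by positivity) this

/-- extreme points are eigenfunctions of the shift -/
lemma ext_shift (H : Hyp μ μ₀) {t : ℝ} (ht : 0 < t) {u : Ed 1 → ℝ}
    (hu : u ∈ (CC μ μ₀ t).extremePoints ℝ) (s : ℤ) (z : Ed 1) :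
    u (sh s z) = u (sh s 0) * u z := by
  obtain ⟨hu, hext⟩ := hu
  obtain ⟨c0, hc0, hc1, har⟩ := harnack H ht
  set lam := u (sh s 0) with hlam
  have hlp : 0 < lam := har_pos H ht hu _
  have hdd : ∀ z, dd z (sh s z) = s.natAbs := by
    intro z; simp [dd, sh]
  set c := c0 ^ s.natAbs / 2 with hc
  have hcp : 0 < c := by positivity
  have hge : ∀ z, 2 * c * u (sh s z) ≤ u z := by
    intro z
    have := hu.1.lower H ht (by positivity) (har z (sh s z))
    rw [hdd] at this
    rw [hc]; linarith
  have hcl : c * lam ≤ 1 / 2 := by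
    have := hge 0
    rw [hu.2] at this; linarith
  set q := c * lam with hq
  have hqp : 0 < q := by positivity
  have hvC : (fun z => u (sh s z) / lam) ∈ CC μ μ₀ t := by
    refine ⟨⟨fun z => div_nonneg (hu.1.1 _) hlp.le, fun z => ?_⟩, ?_⟩
    · have := ((hu.1.shift s).2 z).mul_left lam⁻¹
      have e : t * (u (sh s z) / lam) = lam⁻¹ * (t * u (sh s z)) := by field_simp
      rw [e]
      refine hasSum_cg this fun w => ?_
      field_simp
    · simp only; rw [← hlam]; field_simp
  have hwC : (fun z => (u z - c * u (sh s z)) / (1 - q)) ∈ CC μ μ₀ t := by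
    have h1q : 0 < 1 - q := by linarith
    refine ⟨⟨fun z => div_nonneg ?_ h1q.le, fun z => ?_⟩, ?_⟩
    · have := hge z
      have := mul_nonneg hcp.le (hu.1.1 (sh s z))
      linarith
    · have := ((hu.1.2 z).sub (((hu.1.shift s).2 z).mul_left c)).mul_left (1 - q)⁻¹
      have e : t * ((u z - c * u (sh s z)) / (1 - q))
          = (1 - q)⁻¹ * (t * u z - c * (t * u (sh s z))) := by field_simp
      rw [e]
      refine hasSum_cg this fun w => ?_
      field_simp
    · simp only; rw [← hlam, hu.2, ← hq]; field_simp
  have hseg : u ∈ openSegment ℝ (fun z => u (sh s z) / lam)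
      (fun z => (u z - c * u (sh s z)) / (1 - q)) := by
    have h1q : 0 < 1 - q := by linarith
    refine ⟨q, 1 - q, hqp, h1q, by ring, ?_⟩
    ext z
    simp only [Pi.add_apply, Pi.smul_apply, smul_eq_mul]
    rw [hq] at *
    field_simp
    ring
  have := hext hvC hwC hseg
  have := congrFun this z
  rw [div_eq_iff hlp.ne'] at this
  rw [this]; ring

lemma shift_exp {u : Ed 1 → ℝ} {s : ℤ} (hs : s = 1 ∨ s = -1) {lam : ℝ} (hl : 0 < lam)
    (h : ∀ z, u (sh s z) = lam * u z) (k : ℤ) (z : Ed 1) :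
    u (sh k z) = Real.exp (s * Real.log lam * k) * u z := by
  have sadd : ∀ a b : ℤ, ∀ z, sh (a + b) z = sh a (sh b z) := by
    intro a b z; simp only [sh, Equiv.coe_fn_mk]; ext <;> simp; ring
  have s0 : ∀ z, sh 0 z = z := by intro z; simp [sh]
  have one : ∀ z, u (sh 1 z) = Real.exp (s * Real.log lam) * u z := by
    intro z
    rcases hs with rfl | rfl
    · rw [h]; simp [Real.exp_log hl]
    · have := h (sh 1 z)
      rw [← sadd] at this
      simp only [neg_add_cancel, s0] at this
      rw [this, Int.cast_neg, Int.cast_one, neg_one_mul, Real.exp_neg, Real.exp_log hl]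
      field_simp
  have neg : ∀ z, u (sh (-1) z) = Real.exp (-(s * Real.log lam)) * u z := by
    intro z
    have := one (sh (-1) z)
    rw [← sadd] at this
    simp only [add_neg_cancel, s0] at this
    rw [this, ← mul_assoc, ← Real.exp_add]; simp
  induction k generalizing z with
  | zero => simp [s0]
  | succ i ih =>
    rw [sadd, ih, one, ← mul_assoc, ← Real.exp_add]; congr 2; push_cast; ring
  | pred i ih =>
    rw [sub_eq_add_neg, sadd, ih, neg, ← mul_assoc, ← Real.exp_add]; congr 2; push_cast; ring

end

section

variable {μ μ₀ : Zd 1 → ℝ}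
open scoped ENNReal

lemma local_dec (H : Hyp μ μ₀) {α b : ℝ} (hd : d2 μ α b < 0) :
    ∃ η : ℝ, 0 < η ∧ ph μ α (b + η) < ph μ α b ∧ ph μ α b < ph μ α (b - η) := by
  have ev : ∀ᶠ e in nhdsWithin (0:ℝ) (Set.Ioi 0), d2 μ α (b + e) < 0 := by
    apply eventually_nhdsWithin_of_eventually_nhds
    apply (cont_comp2 (cont_d2 H.nn H.h3) continuous_const
      (continuous_const.add continuous_id)).continuousAt.eventually_lt continuousAt_const
    simpa using hd
  obtain ⟨e, he1, he⟩ := (ev.and self_mem_nhdsWithin).exists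
  have he : 0 < e := he
  refine ⟨e, he, ?_, ?_⟩
  · have := subgrad H.nn H.h3 α (b + e) α b
    nlinarith
  · have := subgrad H.nn H.h3 α b α (b - e)
    nlinarith

lemma u_form {u : Ed 1 → ℝ} {a : ℝ} (h : ∀ (k : ℤ) z, u (sh k z) = Real.exp (a * k) * u z) (z : Ed 1) :
    u z = Real.exp (a * (z.1 0 : ℝ)) * u (pt 0 z.2) := by
  have := h (z.1 0) (pt 0 z.2)
  rw [← this]
  congr 1
  exact (sh_zero_x z).symm

lemma ext_cases (H : Hyp μ μ₀) {t α' b₂ : ℝ} {s : ℤ} (D : ChD μ μ₀ t α' b₂ s) (ht : 0 < t)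
    {u : Ed 1 → ℝ} (hu : u ∈ (CC μ μ₀ t).extremePoints ℝ) :
    u (sh s 0) ≤ Real.exp (s * α') ∧ (u (sh s 0) = Real.exp (s * α') → u = ewE α' b₂) := by
  have hsh := ext_shift H ht hu s
  have huC := hu.1
  have hup := har_pos H ht huC
  set lam := u (sh s 0) with hlam
  have hlp : 0 < lam := hup _
  have hk := shift_exp D.hs hlp hsh
  set α := (s : ℝ) * Real.log lam with hα
  have hss : (s : ℝ) * s = 1 := by rcases D.hs with h | h <;> simp [h]
  have hlog : Real.log lam = s * α := by rw [hα, ← mul_assoc, hss, one_mul]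
  have hform := u_form hk
  obtain ⟨η, hη, hη1, hη2⟩ := local_dec H D.dneg
  rw [D.e1] at hη1 hη2
  have hv := Har.ew H D.e1 D.e2
  have key1 : lam ≤ Real.exp (s * α') := by
    by_contra hcon
    push Not at hcon
    have hgt : 0 < s * (α - α') := by
      have := Real.log_lt_log (Real.exp_pos _) hcon
      rw [Real.log_exp, hlog] at this; linarith
    -- choose a small interpolation parameter
    have cθ : Continuous fun θ : ℝ => α' + θ * (α - α') := by fun_prop
    have ev1 : ∀ᶠ θ in nhdsWithin (0:ℝ) (Set.Ioi 0), ph μ (α' + θ * (α - α')) (b₂ + η) < t := by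
      apply eventually_nhdsWithin_of_eventually_nhds
      apply (cont_comp2 (cont_ph H.nn H.h3) cθ continuous_const).continuousAt.eventually_lt
        continuousAt_const
      simpa using hη1
    have ev2 : ∀ᶠ θ in nhdsWithin (0:ℝ) (Set.Ioi 0), t < ph μ (α' + θ * (α - α')) (b₂ - η) := by
      apply eventually_nhdsWithin_of_eventually_nhds
      apply continuousAt_const.eventually_lt
        (cont_comp2 (cont_ph H.nn H.h3) cθ continuous_const).continuousAt
      simpa using hη2
    have ev3 : ∀ᶠ θ in nhdsWithin (0:ℝ) (Set.Ioi 0), θ < 1 :=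
      eventually_nhdsWithin_of_eventually_nhds (eventually_lt_nhds one_pos)
    obtain ⟨θ, ⟨⟨q1, q2⟩, q3⟩, hθ⟩ := (((ev1.and ev2).and ev3).and self_mem_nhdsWithin).exists
    have hθ : 0 < θ := hθ
    set αθ := α' + θ * (α - α') with hαθ
    have hivt := intermediate_value_Icc' (a := b₂ - η) (b := b₂ + η) (by linarith)
      (cont_comp2 (cont_ph H.nn H.h3) (continuous_const (y := αθ)) continuous_id).continuousOn
    obtain ⟨b, hb, hbt⟩ := hivt ⟨q1.le, q2.le⟩
    simp only [id] at hbt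
    have hblt : b < b₂ + η := by
      rcases lt_or_eq_of_le hb.2 with h | h
      · exact h
      · rw [h] at hbt; linarith
    have hsup := interp H huC.1 hv hup (fun z => ewE_pos _ _ _) hθ.le q3.le
    set f : ℕ → ℝ := fun y => u (pt 0 y) ^ θ * Real.exp (b₂ * y) ^ (1 - θ) with hf
    have hff : (fun z : Ed 1 => u z ^ θ * ewE α' b₂ z ^ (1 - θ))
        = fun z => Real.exp (αθ * (z.1 0 : ℝ)) * f z.2 := by
      ext z
      rw [hform z, hf, ewE, Real.exp_add]
      simp only
      rw [Real.mul_rpow (Real.exp_pos _).le (hup _).le,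
        Real.mul_rpow (Real.exp_pos _).le (Real.exp_pos _).le, ← Real.exp_mul, ← Real.exp_mul]
      have : Real.exp (αθ * (z.1 0 : ℝ)) = Real.exp (α * (z.1 0 : ℝ) * θ) * Real.exp (α' * (z.1 0 : ℝ) * (1 - θ)) := by
        rw [← Real.exp_add]; congr 1; rw [hαθ]; ring
      rw [this]; ring
    rw [hff] at hsup
    have hf0 : f 0 = 1 := by
      have : pt 0 0 = 0 := by rfl
      rw [hf]; simp [this, huC.2]
    have hfn : ∀ y, 0 ≤ f y := fun y => mul_nonneg (Real.rpow_nonneg (hup _).le _)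
      (Real.rpow_nonneg (Real.exp_pos _).le _)
    have hcmp := compD1 H hfn hsup hbt.ge q1.le hblt
    simp only [hf0, one_mul] at hcmp
    have h0 := hsup 0
    have hle := hasSum_le (fun w => mul_le_mul_of_nonneg_left
      (show ewE αθ b w ≤ Real.exp (αθ * (w.1 0 : ℝ)) * f w.2 by
        rw [ewE, Real.exp_add]
        exact mul_le_mul_of_nonneg_left (hcmp _) (Real.exp_pos _).le) (ker_nn H 0 w))
      (ker_hasSum H αθ b 0) h0.1.hasSum
    have hle2 := hle.trans h0.2
    simp only [phz, ewE_zero, mul_one] at hle2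
    simp [hf0] at hle2
    have := D.hgt αθ b (by rw [hαθ]; nlinarith)
    rcases lt_max_iff.1 this with h | h
    · linarith
    · linarith
  refine ⟨key1, fun heq => ?_⟩
  have hαα : α = α' := by
    rw [heq, Real.log_exp] at hlog
    have := congrArg (fun q => (s : ℝ) * q) hlog
    simp only [← mul_assoc, hss, one_mul] at this
    exact this.symm
  have hsup := huC.1.sup
  have hu' : u = fun z : Ed 1 => Real.exp (α' * (z.1 0 : ℝ)) * u (pt 0 z.2) := by
    ext z; rw [← hαα]; exact hform z
  rw [hu'] at hsup
  have hcmp := compD1 H (f := fun y => u (pt 0 y)) (fun y => (hup _).le) hsup D.e1.ge hη1.le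
    (by linarith)
  have hp0 : u (pt 0 0) = 1 := huC.2
  simp only [hp0, one_mul] at hcmp
  have hdiff : Har μ μ₀ t (fun z => u z - ewE α' b₂ z) := by
    refine ⟨fun z => ?_, fun z => ?_⟩
    · show 0 ≤ u z - ewE α' b₂ z
      rw [hform z, hαα, ewE, Real.exp_add, sub_nonneg]
      exact mul_le_mul_of_nonneg_left (hcmp _) (Real.exp_pos _).le
    · have := (huC.1.2 z).sub (hv.2 z)
      rw [mul_sub]
      exact hasSum_cg this fun w => by ring
  obtain ⟨c, hc0, hc1, har⟩ := harnack H ht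
  ext z
  have := hdiff.lower H ht (by positivity) (har 0 z)
  simp only [huC.2, ewE_zero, sub_self] at this
  have h2 := hdiff.1 z
  simp only at h2
  have hcp : 0 < c ^ dd 0 z := by positivity
  have : u z - ewE α' b₂ z ≤ 0 := by
    by_contra hc
    push Not at hc
    have := mul_pos hcp hc
    linarith
  linarith

lemma CC_le (H : Hyp μ μ₀) {t α' b₂ : ℝ} {s : ℤ} (D : ChD μ μ₀ t α' b₂ s) (ht : 0 < t)
    {h : Ed 1 → ℝ} (hh : h ∈ CC μ μ₀ t) : h (sh s 0) ≤ Real.exp (s * α') := by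
  rw [← closure_convexHull_extremePoints (CC_compact H ht) CC_convex] at hh
  have hcl : IsClosed {h : Ed 1 → ℝ | h (sh s 0) ≤ Real.exp (s * α')} :=
    isClosed_le (continuous_apply _) continuous_const
  have hcv : Convex ℝ {h : Ed 1 → ℝ | h (sh s 0) ≤ Real.exp (s * α')} :=
    convex_halfSpace_le (LinearMap.proj (R := ℝ) (φ := fun _ : Ed 1 => ℝ) (sh s 0)).isLinear _
  exact closure_minimal (convexHull_min (fun u hu => (ext_cases H D ht hu).1) hcv) hcl hh

lemma CC_eq (H : Hyp μ μ₀) {t α' b₂ : ℝ} {s : ℤ} (D : ChD μ μ₀ t α' b₂ s) (ht : 0 < t)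
    {h : Ed 1 → ℝ} (hh : h ∈ CC μ μ₀ t) (he : h (sh s 0) = Real.exp (s * α')) : h = ewE α' b₂ := by
  set Fc := CC μ μ₀ t ∩ {h : Ed 1 → ℝ | h (sh s 0) = Real.exp (s * α')} with hFc
  have hcl : IsClosed {h : Ed 1 → ℝ | h (sh s 0) = Real.exp (s * α')} :=
    isClosed_eq (continuous_apply _) continuous_const
  have hcv : Convex ℝ {h : Ed 1 → ℝ | h (sh s 0) = Real.exp (s * α')} :=
    convex_hyperplane (LinearMap.proj (R := ℝ) (φ := fun _ : Ed 1 => ℝ) (sh s 0)).isLinear _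
  have hcomp : IsCompact Fc := (CC_compact H ht).inter_right hcl
  have hconv : Convex ℝ Fc := CC_convex.inter hcv
  have hext : IsExtreme ℝ (CC μ μ₀ t) Fc := by
    refine ⟨Set.inter_subset_left, ?_⟩
    rintro x hx y hy z hz ⟨a, b, ha, hb, hab, rfl⟩
    refine ⟨hx, ?_⟩
    have h1 := CC_le H D ht hx
    have h2 := CC_le H D ht hy
    have h3 : a * x (sh s 0) + b * y (sh s 0) = Real.exp (s * α') := hz.2
    have hb1 : b = 1 - a := by linarith
    subst hb1
    show x (sh s 0) = _
    nlinarith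
  have hsub : Fc.extremePoints ℝ ⊆ {ewE α' b₂} := by
    intro u hu
    have hu2 := hext.extremePoints_subset_extremePoints hu
    exact (ext_cases H D ht hu2).2 hu.1.2
  have hmem : h ∈ Fc := ⟨hh, he⟩
  rw [← closure_convexHull_extremePoints hcomp hconv] at hmem
  have := closure_mono (convexHull_mono (𝕜 := ℝ) hsub) hmem
  simpa using this

end

section

variable {μ μ₀ : Zd 1 → ℝ}
open scoped ENNReal

/-- real-valued Green function -/
def gr (μ μ₀ : Zd 1 → ℝ) (t : ℝ) (z w : Ed 1) : ℝ := (GE μ μ₀ t z w).toReal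

/-- Martin ratio with respect to the origin -/
def qq (μ μ₀ : Zd 1 → ℝ) (t : ℝ) (z' z : Ed 1) : ℝ := gr μ μ₀ t z z' / gr μ μ₀ t 0 z'

lemma gr_pos (H : Hyp μ μ₀) {t : ℝ} (ht : 0 < t) (hf : ∀ z w, GE μ μ₀ t z w ≠ ∞) (z w : Ed 1) :
    0 < gr μ μ₀ t z w := ENNReal.toReal_pos (GE_ne_zero H ht _ _) (hf _ _)

lemma gr_rec (H : Hyp μ μ₀) {t : ℝ} (ht : 0 < t) (hf : ∀ z w, GE μ μ₀ t z w ≠ ∞) (z z' : Ed 1) :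
    HasSum (fun w => ker μ μ₀ z w * gr μ μ₀ t w z')
      (t * (gr μ μ₀ t z z' - if z = z' then 1 else 0)) := by
  have hr := GE_rec (μ := μ) (μ₀ := μ₀) t z z'
  set S := ∑' w, pE μ μ₀ z w * GE μ μ₀ t w z' with hS
  have hSf : S ≠ ∞ := by
    intro h
    rw [h, ENNReal.mul_top (by simpa using ht)] at hr
    exact hf z z' (by rw [hr]; simp)
  have hterm : ∀ w, pE μ μ₀ z w * GE μ μ₀ t w z' ≠ ∞ := fun w =>
    ENNReal.mul_ne_top ENNReal.ofReal_ne_top (hf _ _)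
  have h1 := ENNReal.hasSum_toReal (f := fun w => pE μ μ₀ z w * GE μ μ₀ t w z') hSf
  rw [← ENNReal.tsum_toReal_eq hterm, ← hS] at h1
  have h2 : gr μ μ₀ t z z' = (if z = z' then 1 else 0) + t⁻¹ * S.toReal := by
    rw [gr, hr, ENNReal.toReal_add _ (ENNReal.mul_ne_top ENNReal.ofReal_ne_top hSf),
      ENNReal.toReal_mul, ENNReal.toReal_ofReal (by positivity)]
    · split_ifs <;> simp
    · split_ifs <;> simp
  have h3 : t * (gr μ μ₀ t z z' - if z = z' then 1 else 0) = S.toReal := by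
    rw [h2]; field_simp; ring
  rw [h3]
  refine hasSum_cg h1 fun w => ?_
  rw [ENNReal.toReal_mul, pE, ENNReal.toReal_ofReal (ker_nn H _ _), gr]

lemma gr_harnack (H : Hyp μ μ₀) {t : ℝ} (ht : 0 < t) (hf : ∀ z w, GE μ μ₀ t z w ≠ ∞) :
    ∃ c, 0 < c ∧ c < 1 ∧ (∀ z w z', c ^ dd z w * gr μ μ₀ t w z' ≤ gr μ μ₀ t z z') ∧
      ∀ z w z', gr μ μ₀ t z w * c ^ dd w z' ≤ gr μ μ₀ t z z' := by
  obtain ⟨c, hc0, hc1, har⟩ := harnack H ht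
  refine ⟨c, hc0, hc1, fun z w z' => ?_, fun z w z' => ?_⟩
  · obtain ⟨m, hm⟩ := har z w
    have := (mul_le_mul_left hm _).trans (GE_ge_left t m z w z')
    have h2 := ENNReal.toReal_mono (hf _ _) this
    rwa [ENNReal.toReal_mul, ENNReal.toReal_ofReal (by positivity)] at h2
  · obtain ⟨m, hm⟩ := har w z'
    have := (mul_le_mul_right hm _).trans (GE_ge_right t m z w z')
    have h2 := ENNReal.toReal_mono (hf _ _) this
    rwa [ENNReal.toReal_mul, ENNReal.toReal_ofReal (by positivity)] at h2

lemma qq_cluster (H : Hyp μ μ₀) {t : ℝ} (ht : 0 < t) (hf : ∀ z w, GE μ μ₀ t z w ≠ ∞)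
    (U : Ultrafilter (Ed 1)) (hU : (U : Filter (Ed 1)) ≤ cofinite) :
    ∃ h ∈ CC μ μ₀ t, ∀ w, Tendsto (fun z' => qq μ μ₀ t z' w) U (nhds (h w)) := by
  obtain ⟨c, hc0, hc1, har, -⟩ := gr_harnack H ht hf
  have hb : ∀ z' w, 0 ≤ qq μ μ₀ t z' w ∧ qq μ μ₀ t z' w ≤ bw (-Real.log c) w := by
    intro z' w
    refine ⟨(div_pos (gr_pos H ht hf _ _) (gr_pos H ht hf _ _)).le, ?_⟩
    refine le_trans ?_ (bw_ge hc0 w)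
    rw [qq, div_le_iff₀ (gr_pos H ht hf _ _), inv_mul_eq_div, le_div_iff₀ (by positivity), mul_comm]
    exact har 0 w z'
  have hex : ∀ w, ∃ a : ℝ, Tendsto (fun z' => qq μ μ₀ t z' w) U (nhds a) := by
    intro w
    obtain ⟨a, -, ha⟩ := (isCompact_Icc (a := (0:ℝ)) (b := bw (-Real.log c) w)).ultrafilter_le_nhds'
      (U.map (fun z' => qq μ μ₀ t z' w)) (Ultrafilter.mem_map.2 (Filter.Eventually.of_forall
        fun z' => ⟨(hb z' w).1, (hb z' w).2⟩))
    exact ⟨a, ha⟩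
  choose h hh using hex
  refine ⟨h, ⟨har_lim H (F := (U : Filter (Ed 1))) (f := fun z' w => qq μ μ₀ t z' w)
    (l := -Real.log c) (Filter.Eventually.of_forall hb) (fun z => ?_) hh, ?_⟩, hh⟩
  · refine tendsto_const_nhds.congr' ?_
    have : ∀ᶠ z' in (U : Filter (Ed 1)), z' ≠ z :=
      hU (by exact Set.Finite.compl_mem_cofinite (Set.finite_singleton z))
    filter_upwards [this] with z' hz'
    have h1 := (gr_rec H ht hf z z').div_const (gr μ μ₀ t 0 z')
    rw [if_neg (Ne.symm hz'), sub_zero] at h1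
    have h2 : HasSum (fun w => ker μ μ₀ z w * qq μ μ₀ t z' w) (t * qq μ μ₀ t z' z) := by
      rw [qq, ← mul_div_assoc]
      exact hasSum_cg h1 fun w => by rw [qq, mul_div_assoc]
    rw [h2.tsum_eq, sub_self]
  · refine tendsto_nhds_unique (hh 0) (tendsto_const_nhds.congr fun z' => ?_)
    rw [qq, div_self (gr_pos H ht hf _ _).ne']

lemma ChD.ft (H : Hyp μ μ₀) {t α' b₂ : ℝ} {s : ℤ} (D : ChD μ μ₀ t α' b₂ s) (z w : Ed 1) :
    GE μ μ₀ t z w ≠ ∞ := by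
  obtain ⟨α, β, h1, h2⟩ := D.fin
  exact GE_ne_top H h1 h2 z w

lemma martin_C1 (H : Hyp μ μ₀) {t α' b₂ : ℝ} {s : ℤ} (D : ChD μ μ₀ t α' b₂ s) (ht : 0 < t)
    {ε : ℝ} (hε : 0 < ε) :
    ∀ᶠ z' in cofinite, qq μ μ₀ t z' (sh s 0) < Real.exp (s * α') + ε := by
  refine Filter.mem_iff_ultrafilter.2 fun U hU => ?_
  obtain ⟨h, hh, hlim⟩ := qq_cluster H ht (D.ft H) U hU
  have h1 := CC_le H D ht hh
  exact (hlim (sh s 0)).eventually_lt_const (by linarith)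

lemma martin_C2 (H : Hyp μ μ₀) {t α' b₂ : ℝ} {s : ℤ} (D : ChD μ μ₀ t α' b₂ s) (ht : 0 < t)
    {zs : ℕ → Ed 1} (hz : Tendsto zs atTop cofinite)
    (hr : Tendsto (fun n => qq μ μ₀ t (zs n) (sh s 0)) atTop (nhds (Real.exp (s * α')))) (z : Ed 1) :
    Tendsto (fun n => qq μ μ₀ t (zs n) z) atTop (nhds (ewE α' b₂ z)) := by
  rw [tendsto_iff_ultrafilter]
  intro V hV
  have hVz : ((V.map zs : Ultrafilter (Ed 1)) : Filter (Ed 1)) ≤ cofinite := by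
    rw [Ultrafilter.coe_map]; exact (Filter.map_mono hV).trans hz
  obtain ⟨h, hh, hlim⟩ := qq_cluster H ht (D.ft H) (V.map zs) hVz
  have hlim' : ∀ w, Tendsto (fun n => qq μ μ₀ t (zs n) w) V (nhds (h w)) := fun w => by
    have := hlim w
    rw [Ultrafilter.coe_map] at this
    exact tendsto_map'_iff.1 this
  have he : h (sh s 0) = Real.exp (s * α') :=
    tendsto_nhds_unique (hlim' _) (hr.mono_left hV)
  rw [← CC_eq H D ht hh he]
  exact hlim' z

lemma martin_conv (H : Hyp μ μ₀) {t α' b₂ : ℝ} {s : ℤ} (D : ChD μ μ₀ t α' b₂ s) (ht : 0 < t)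
    {zs : ℕ → Ed 1} (hz : Tendsto zs atTop cofinite)
    (hr : Tendsto (fun n => qq μ μ₀ t (zs n) (sh s 0)) atTop (nhds (Real.exp (s * α')))) (z₀ z : Ed 1) :
    Tendsto (fun n => martin μ μ₀ t z₀ z (zs n)) atTop (nhds (ewE α' b₂ z / ewE α' b₂ z₀)) := by
  refine ((martin_C2 H D ht hz hr z).div (martin_C2 H D ht hz hr z₀) (ewE_pos _ _ _).ne').congr ?_
  intro n
  have := (gr_pos H ht (D.ft H) 0 (zs n)).ne'
  simp only [Pi.div_apply, qq, martin]
  rw [green_eq H ht, green_eq H ht]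
  exact div_div_div_cancel_right₀ this _ _

lemma sh_pt (s x : ℤ) (y : ℕ) : sh s (pt x y) = pt (x + s) y := rfl

lemma gr_shift_pt (t : ℝ) (s x : ℤ) (y : ℕ) :
    gr μ μ₀ t (sh s 0) (pt x y) = gr μ μ₀ t 0 (pt (x - s) y) := by
  rw [gr, gr, ← GE_sh t s 0 (pt (x - s) y), sh_pt, sub_add_cancel]

lemma qq_lg (H : Hyp μ μ₀) {t : ℝ} (ht : 0 < t) (hf : ∀ z w, GE μ μ₀ t z w ≠ ∞) (s x : ℤ) (y : ℕ) :
    qq μ μ₀ t (pt x y) (sh s 0) = Real.exp (lg μ μ₀ t (x - s) y - lg μ μ₀ t x y) := by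
  have GG : ∀ w, 0 < (GE μ μ₀ t 0 w).toReal := fun w => gr_pos H ht hf 0 w
  rw [qq, gr_shift_pt, Real.exp_sub, lg, lg, Real.exp_log (GG (pt (x - s) y)),
    Real.exp_log (GG (pt x y)), gr, gr]

lemma lg_C1 (H : Hyp μ μ₀) {t α' b₂ : ℝ} {s : ℤ} (D : ChD μ μ₀ t α' b₂ s) (ht : 0 < t)
    {ε : ℝ} (hε : 0 < ε) : ∃ Y : ℕ, ∀ y : ℕ, Y ≤ y → ∀ x : ℤ,
      lg μ μ₀ t (x - s) y - lg μ μ₀ t x y ≤ s * α' + ε := by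
  have hpos : 0 < Real.exp (s * α' + ε) - Real.exp (s * α') :=
    sub_pos.2 (Real.exp_lt_exp.2 (by linarith))
  have h := martin_C1 H D ht hpos
  rw [Filter.eventually_cofinite] at h
  obtain ⟨Y, hY⟩ := (h.image Prod.snd).bddAbove
  refine ⟨Y + 1, fun y hy x => ?_⟩
  by_contra hc
  have hm : pt x y ∈ {z' | ¬ qq μ μ₀ t z' (sh s 0) < Real.exp (s * α') +
      (Real.exp (s * α' + ε) - Real.exp (s * α'))} := by
    simp only [Set.mem_ofPred_eq, not_lt]
    rw [qq_lg H ht (D.ft H), add_sub_cancel]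
    exact Real.exp_le_exp.2 (not_le.1 hc).le
  have : y ≤ Y := hY ⟨pt x y, hm, rfl⟩
  omega

lemma lg_lip (H : Hyp μ μ₀) {t : ℝ} (ht : 0 < t) (hf : ∀ z w, GE μ μ₀ t z w ≠ ∞) :
    ∃ K : ℝ, 0 < K ∧ ∀ (x : ℤ) (y : ℕ), |lg μ μ₀ t (x - 1) y - lg μ μ₀ t x y| ≤ K := by
  obtain ⟨c, hc0, hc1, -, har⟩ := gr_harnack H ht hf
  refine ⟨-Real.log c, by linarith [Real.log_neg hc0 hc1], fun x y => ?_⟩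
  have hd1 : dd (pt (x - 1) y) (pt x y) = 1 := by simp [dd, pt]
  have hd2 : dd (pt x y) (pt (x - 1) y) = 1 := by simp [dd, pt]
  have e1 := har 0 (pt (x - 1) y) (pt x y)
  have e2 := har 0 (pt x y) (pt (x - 1) y)
  rw [hd1, pow_one] at e1
  rw [hd2, pow_one] at e2
  have p1 := gr_pos H ht hf 0 (pt (x - 1) y)
  have p2 := gr_pos H ht hf 0 (pt x y)
  have l1 := Real.log_le_log (by positivity) e1
  have l2 := Real.log_le_log (by positivity) e2
  rw [Real.log_mul p1.ne' hc0.ne'] at l1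
  rw [Real.log_mul p2.ne' hc0.ne'] at l2
  simp only [gr] at l1 l2
  rw [abs_le]
  simp only [lg]
  constructor <;> linarith

lemma lg_upper (H : Hyp μ μ₀) {α β β₁ t : ℝ} (h1 : ph μ α β < t) (h2 : ph μ α β₁ < t)
    (h3 : ph μ₀ α β₁ < t) : ∃ C : ℝ, ∀ (x : ℤ) (y : ℕ), lg μ μ₀ t x y ≤ -α * x - β * y + C := by
  have hf := GE_ne_top H h2 h3
  have ht : 0 < t := lt_of_le_of_lt (ph_nonneg H.nn _ _) h1
  have h0 : max (ph μ α β) (max (ph μ α β₁) (ph μ₀ α β₁)) < t := max_lt h1 (max_lt h2 h3)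
  obtain ⟨τ, hτ1, hτ2⟩ := exists_between h0
  simp only [max_lt_iff] at hτ1
  obtain ⟨C, hC, hG⟩ := GE_upper H hτ1.1.le hτ1.2.1.le hτ1.2.2 hτ2
  refine ⟨Real.log C, fun x y => ?_⟩
  have := hG (pt x y)
  rw [← exp_lg H ht hf, ← ENNReal.ofReal_mul (Real.exp_pos _).le, ENNReal.ofReal_le_ofReal_iff hC.le,
    ewE, ← Real.exp_add, ← Real.le_log_iff_exp_le hC] at this
  simp only [pt] at this
  linarith

end

section

variable {μ μ₀ : Zd 1 → ℝ}
open scoped ENNReal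

/-- finite averaging lemma -/
lemma sel_fin (K a a' : ℝ) {ε₁ : ℝ} (hε : 0 < ε₁) : ∃ δ : ℝ, 0 < δ ∧ ∀ (N : ℕ) (r r' : ℕ → ℝ), 0 < N →
    (∀ j < N, -K ≤ r j) → (∀ j < N, r' j ≤ a' + δ) →
    ∑ j ∈ Finset.range N, r j ≤ (a + δ) * N → (a' - δ) * N ≤ ∑ j ∈ Finset.range N, r' j →
    ∃ j < N, r j ≤ a + ε₁ ∧ a' - ε₁ ≤ r' j := by
  set L := (|a| + |K| + 1) / ε₁ with hL
  have hL0 : 0 < L := by positivity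
  have hLe : L * ε₁ = |a| + |K| + 1 := by rw [hL]; field_simp
  refine ⟨min ε₁ 1 / (1 + 2 * L), by positivity, ?_⟩
  set δ := min ε₁ 1 / (1 + 2 * L) with hδ
  have hδ0 : 0 < δ := by positivity
  have hδe : δ * (1 + 2 * L) = min ε₁ 1 := by rw [hδ]; field_simp
  have hδ1 : δ * (1 + 2 * L) ≤ ε₁ := hδe ▸ min_le_left _ _
  have hδ2 : δ * (1 + 2 * L) ≤ 1 := hδe ▸ min_le_right _ _
  intro N r r' hN hr hr' hs hs'
  have hsum : ∑ j ∈ Finset.range N, ((r j - a) + L * (a' - r' j)) ≤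
      ∑ j ∈ Finset.range N, δ * (1 + L) := by
    rw [Finset.sum_add_distrib, ← Finset.mul_sum, Finset.sum_sub_distrib, Finset.sum_sub_distrib]
    simp only [Finset.sum_const, Finset.card_range, nsmul_eq_mul]
    have : L * (N * a' - ∑ j ∈ Finset.range N, r' j) ≤ L * (δ * N) :=
      mul_le_mul_of_nonneg_left (by linarith) hL0.le
    nlinarith
  obtain ⟨j, hj, hle⟩ := Finset.exists_le_of_sum_le (Finset.nonempty_range_iff.2 hN.ne') hsum
  have hj' := Finset.mem_range.1 hj
  refine ⟨j, hj', ?_, ?_⟩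
  · have := mul_le_mul_of_nonneg_left (hr' j hj') hL0.le
    nlinarith
  · have h1 := hr j hj'
    have h2 : L * (a' - r' j) ≤ L * ε₁ := by
      rw [hLe]
      have := le_abs_self a
      have := le_abs_self K
      nlinarith
    have := le_of_mul_le_mul_left h2 hL0
    linarith

/-- upper bound up to subexponential factors -/
def UpB (g : ℤ → ℕ → ℝ) (a b R : ℝ) : Prop :=
  ∀ ε : ℝ, 0 < ε → ∃ Y : ℕ, ∀ y : ℕ, Y ≤ y → ∀ x : ℤ, |(x : ℝ)| ≤ R * y → g x y ≤ -a * x - b * y + ε * y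

/-- lower bound up to subexponential factors -/
def LoB (g : ℤ → ℕ → ℝ) (a b lo R : ℝ) : Prop :=
  ∀ ε : ℝ, 0 < ε → ∃ Y : ℕ, ∀ y : ℕ, Y ≤ y → ∀ x : ℤ, lo * y ≤ x → (x : ℝ) ≤ R * y →
    -a * x - b * y - ε * y ≤ g x y

lemma tele (f : ℤ → ℕ → ℝ) (p : ℤ) (y : ℕ) (N : ℕ) :
    ∑ j ∈ Finset.range N, (f (p + j) y - f (p + j + 1) y) = f p y - f (p + N) y := by
  induction N with
  | zero => simp
  | succ n ih =>
    rw [Finset.sum_range_succ, ih]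
    push_cast
    rw [← add_assoc]; ring

lemma nat_big (c : ℝ) {k : ℝ} (hk : 0 < k) : ∃ Y : ℕ, ∀ y : ℕ, Y ≤ y → c ≤ k * y := by
  obtain ⟨Y, hY⟩ := exists_nat_ge (c / k)
  refine ⟨Y, fun y hy => ?_⟩
  have : (Y : ℝ) ≤ y := by exact_mod_cast hy
  rw [div_le_iff₀ hk] at hY
  nlinarith

lemma win {f g' : ℤ → ℕ → ℝ} {K a a' b' lo u κ R : ℝ}
    (hK : ∀ x y, -K ≤ f (x - 1) y - f x y)
    (hC : ∀ ε : ℝ, 0 < ε → ∃ Y : ℕ, ∀ y : ℕ, Y ≤ y → ∀ x : ℤ, g' (x - 1) y - g' x y ≤ a' + ε)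
    (hU : UpB g' a' b' R) (hL : LoB g' a' b' lo R) (hlo : lo < u) (hκ : 0 < κ) (hR : u + κ < R)
    (hR' : -R < lo)
    (hf : ∀ ε : ℝ, 0 < ε → ∃ Y : ℕ, ∀ y : ℕ, Y ≤ y → f ⌊u * y⌋ y - f ⌊(u + κ) * y⌋ y ≤
      a * ((⌊(u + κ) * y⌋ : ℝ) - ⌊u * y⌋) + ε * y) {ε₁ : ℝ} (hε : 0 < ε₁) :
    ∃ Y : ℕ, ∀ y : ℕ, Y ≤ y → ∃ x : ℤ, f (x - 1) y - f x y ≤ a + ε₁ ∧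
      |g' (x - 1) y - g' x y - a'| ≤ ε₁ := by
  obtain ⟨δ, hδ, hsel⟩ := sel_fin K a a' hε
  obtain ⟨Y0, h0⟩ := hC δ hδ
  obtain ⟨Y1, h1⟩ := hC ε₁ hε
  have hη : 0 < δ * κ / 4 := by positivity
  obtain ⟨Y2, h2⟩ := hU _ hη
  obtain ⟨Y3, h3⟩ := hL _ hη
  obtain ⟨Y4, h4⟩ := hf _ hη
  obtain ⟨Y5, h5⟩ := nat_big 1 (sub_pos.2 hlo)
  obtain ⟨Y6, h6⟩ := nat_big 2 hκ
  obtain ⟨Y7, h7⟩ := nat_big 1 (show 0 < lo + R by linarith)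
  refine ⟨Y0 + Y1 + Y2 + Y3 + Y4 + Y5 + Y6 + Y7, fun y hy => ?_⟩
  specialize h0 y (by omega)
  specialize h1 y (by omega)
  specialize h2 y (by omega)
  specialize h3 y (by omega)
  specialize h4 y (by omega)
  specialize h5 y (by omega)
  specialize h6 y (by omega)
  specialize h7 y (by omega)
  have hy0 : (0 : ℝ) ≤ y := Nat.cast_nonneg y
  set p := ⌊u * y⌋ with hp
  set q := ⌊(u + κ) * y⌋ with hq
  have p1 : (p : ℝ) ≤ u * y := Int.floor_le _
  have p2 : u * y < p + 1 := Int.lt_floor_add_one _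
  have q1 : (q : ℝ) ≤ (u + κ) * y := Int.floor_le _
  have q2 : (u + κ) * y < q + 1 := Int.lt_floor_add_one _
  have hpq : κ * y - 1 < (q : ℝ) - p := by nlinarith
  have hpq' : κ * y / 2 ≤ (q : ℝ) - p := by nlinarith
  have hltR : (p : ℝ) < q := by nlinarith
  have hlt : p < q := by exact_mod_cast hltR
  obtain ⟨N, hN⟩ := Int.eq_ofNat_of_zero_le (sub_nonneg.2 hlt.le)
  have hqN : q = p + N := by omega
  have hNR : (N : ℝ) = q - p := by rw [hqN]; push_cast; ring
  have hN0 : 0 < N := by omega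
  have hqR : (q : ℝ) ≤ R * y := by nlinarith
  have hqa : |(q : ℝ)| ≤ R * y := by rw [abs_le]; constructor <;> nlinarith
  have b1 := h2 q hqa
  have b2 := h3 p (by nlinarith) (by linarith)
  have hηN : δ * κ / 4 * y * 2 ≤ δ * N := by rw [hNR]; nlinarith
  obtain ⟨j, hj, hj1, hj2⟩ := hsel N (fun j => f (p + j) y - f (p + j + 1) y)
    (fun j => g' (p + j) y - g' (p + j + 1) y) hN0
    (fun j _ => by have := hK (p + j + 1) y; rwa [add_sub_cancel_right] at this)
    (fun j _ => by have := h0 (p + j + 1); rwa [add_sub_cancel_right] at this)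
    (by
      rw [tele, ← hqN, hNR]
      rw [hNR] at hηN
      have : 0 ≤ δ * κ / 4 * y := by positivity
      nlinarith)
    (by
      rw [tele, ← hqN, hNR]
      rw [hNR] at hηN
      nlinarith)
  refine ⟨p + j + 1, ?_, ?_⟩
  · rw [add_sub_cancel_right]; exact hj1
  · have := h1 (p + j + 1)
    rw [add_sub_cancel_right] at this ⊢
    rw [abs_le]
    constructor <;> linarith

/-- propagation of the lower bound to the right -/
lemma LoB_of {g : ℤ → ℕ → ℝ} {a b lo R : ℝ} (hR : 0 < R)
    (hC : ∀ ε : ℝ, 0 < ε → ∃ Y : ℕ, ∀ y : ℕ, Y ≤ y → ∀ x : ℤ, g (x - 1) y - g x y ≤ a + ε)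
    (hl : ∀ ε : ℝ, 0 < ε → ∃ v : ℝ, -R ≤ v ∧ v ≤ lo ∧ ∃ Y : ℕ, ∀ y : ℕ, Y ≤ y → ∀ x : ℤ,
      |(x : ℝ) - v * y| ≤ 1 → -a * x - b * y - ε * y ≤ g x y) : LoB g a b lo R := by
  intro ε hε
  have hδ : 0 < ε / (2 * (2 * R + 1)) := by positivity
  obtain ⟨Y0, h0⟩ := hC _ hδ
  obtain ⟨v, hv1, hv2, Y1, h1⟩ := hl (ε / 2) (by positivity)
  set δ := ε / (2 * (2 * R + 1)) with hδd
  have hδe : δ * (2 * R + 1) = ε / 2 := by rw [hδd]; field_simp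
  refine ⟨Y0 + Y1 + 1, fun y hy x hx1 hx2 => ?_⟩
  specialize h0 y (by omega)
  specialize h1 y (by omega)
  have hy1 : (1 : ℝ) ≤ y := by exact_mod_cast (show 1 ≤ y by omega)
  set r := ⌊v * y⌋ with hr
  have r1 : (r : ℝ) ≤ v * y := Int.floor_le _
  have r2 : v * y < r + 1 := Int.lt_floor_add_one _
  have hb := h1 r (by rw [abs_le]; constructor <;> linarith)
  have hrx : (r : ℝ) ≤ x := by nlinarith
  have hrx' : r ≤ x := by exact_mod_cast hrx
  obtain ⟨N, hN⟩ := Int.eq_ofNat_of_zero_le (sub_nonneg.2 hrx')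
  have hxN : x = r + N := by omega
  have hNR : (N : ℝ) = x - r := by rw [hxN]; push_cast; ring
  have ht := tele g r y N
  have hle : ∑ j ∈ Finset.range N, (g (r + j) y - g (r + j + 1) y) ≤ ∑ j ∈ Finset.range N, (a + δ) :=
    Finset.sum_le_sum fun j _ => by
      have := h0 (r + j + 1); rwa [add_sub_cancel_right] at this
  rw [ht, ← hxN] at hle
  simp only [Finset.sum_const, Finset.card_range, nsmul_eq_mul, hNR] at hle
  have hNy : (x : ℝ) - r ≤ (2 * R + 1) * y := by nlinarith
  have := mul_le_mul_of_nonneg_left hNy hδ.le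
  have h3 : δ * ((2 * R + 1) * y) = ε / 2 * y := by rw [← mul_assoc, hδe]
  nlinarith

/-- main selection lemma -/
lemma select {g g' : ℤ → ℕ → ℝ} {K a₁ b₁ a₂ b₂ a' b' v₁ v₂ κ lo R : ℝ}
    (hK : ∀ x y, |g (x - 1) y - g x y| ≤ K)
    (hC : ∀ ε : ℝ, 0 < ε → ∃ Y : ℕ, ∀ y : ℕ, Y ≤ y → ∀ x : ℤ, g' (x - 1) y - g' x y ≤ a' + ε)
    (hU' : UpB g' a' b' R)
    (hl' : ∀ ε : ℝ, 0 < ε → ∃ v : ℝ, -R ≤ v ∧ v ≤ lo ∧ ∃ Y : ℕ, ∀ y : ℕ, Y ≤ y → ∀ x : ℤ,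
      |(x : ℝ) - v * y| ≤ 1 → -a' * x - b' * y - ε * y ≤ g' x y)
    (hU1 : UpB g a₁ b₁ R) (hU2 : UpB g a₂ b₂ R)
    (hL1 : ∀ ε : ℝ, 0 < ε → ∃ Y : ℕ, ∀ y : ℕ, Y ≤ y → ∀ x : ℤ,
      |(x : ℝ) - v₁ * y| ≤ 1 → -a₁ * x - b₁ * y - ε * y ≤ g x y)
    (hL2 : ∀ ε : ℝ, 0 < ε → ∃ Y : ℕ, ∀ y : ℕ, Y ≤ y → ∀ x : ℤ,
      |(x : ℝ) - v₂ * y| ≤ 1 → -a₂ * x - b₂ * y - ε * y ≤ g x y)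
    (hκ : 0 < κ) (hlo : lo < v₁ - κ) (h12 : v₁ < v₂) (hR : v₂ + κ < R) (hR' : -R < lo)
    {ε₁ : ℝ} (hε : 0 < ε₁) :
    ∃ Y : ℕ, ∀ y : ℕ, Y ≤ y → (∃ x : ℤ, g (x - 1) y - g x y ≤ a₁ + ε₁ ∧
      |g' (x - 1) y - g' x y - a'| ≤ ε₁) ∧ (∃ x : ℤ, a₂ - ε₁ ≤ g (x - 1) y - g x y ∧
      |g' (x - 1) y - g' x y - a'| ≤ ε₁) := by
  have hRp : 0 < R := by linarith
  have hL' := LoB_of hRp hC hl'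
  obtain ⟨Y1, h1⟩ := win (f := g) (K := K) (a := a₁) (u := v₁ - κ) (κ := κ)
    (fun x y => (abs_le.1 (hK x y)).1) hC hU' hL' hlo hκ (by linarith) hR' (by
      intro ε hε
      obtain ⟨Y0, h0⟩ := hU1 (ε / 2) (by positivity)
      obtain ⟨Y1, h1⟩ := hL1 (ε / 2) (by positivity)
      obtain ⟨Y2, h2⟩ := nat_big 1 (show 0 < v₁ - κ + R by linarith)
      refine ⟨Y0 + Y1 + Y2, fun y hy => ?_⟩
      specialize h2 y (by omega)
      rw [sub_add_cancel]
      have hy0 : (0 : ℝ) ≤ y := Nat.cast_nonneg y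
      have p1 : (⌊(v₁ - κ) * y⌋ : ℝ) ≤ (v₁ - κ) * y := Int.floor_le _
      have p2 : (v₁ - κ) * y < (⌊(v₁ - κ) * y⌋ : ℝ) + 1 := Int.lt_floor_add_one _
      have q1 : (⌊v₁ * y⌋ : ℝ) ≤ v₁ * y := Int.floor_le _
      have q2 : v₁ * y < (⌊v₁ * y⌋ : ℝ) + 1 := Int.lt_floor_add_one _
      have e0 := h0 y (by omega) ⌊(v₁ - κ) * y⌋ (by rw [abs_le]; constructor <;> nlinarith)
      have e1 := h1 y (by omega) ⌊v₁ * y⌋ (by rw [abs_le]; constructor <;> linarith)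
      linarith) hε
  obtain ⟨Y2, h2⟩ := win (f := fun x y => -g x y) (K := K) (a := -a₂) (u := v₂) (κ := κ)
    (fun x y => by have := (abs_le.1 (hK x y)).2; linarith) hC hU' hL' (by linarith) hκ hR hR' (by
      intro ε hε
      obtain ⟨Y0, h0⟩ := hU2 (ε / 2) (by positivity)
      obtain ⟨Y1, h1⟩ := hL2 (ε / 2) (by positivity)
      obtain ⟨Y2, h2⟩ := nat_big 1 (show 0 < v₂ + κ + R by linarith)
      refine ⟨Y0 + Y1 + Y2, fun y hy => ?_⟩
      specialize h2 y (by omega)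
      have hy0 : (0 : ℝ) ≤ y := Nat.cast_nonneg y
      have p1 : (⌊(v₂ + κ) * y⌋ : ℝ) ≤ (v₂ + κ) * y := Int.floor_le _
      have p2 : (v₂ + κ) * y < (⌊(v₂ + κ) * y⌋ : ℝ) + 1 := Int.lt_floor_add_one _
      have q1 : (⌊v₂ * y⌋ : ℝ) ≤ v₂ * y := Int.floor_le _
      have q2 : v₂ * y < (⌊v₂ * y⌋ : ℝ) + 1 := Int.lt_floor_add_one _
      have e0 := h0 y (by omega) ⌊(v₂ + κ) * y⌋ (by rw [abs_le]; constructor <;> nlinarith)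
      have e1 := h1 y (by omega) ⌊v₂ * y⌋ (by rw [abs_le]; constructor <;> linarith)
      linarith) hε
  refine ⟨Y1 + Y2, fun y hy => ⟨h1 y (by omega), ?_⟩⟩
  obtain ⟨x, hx1, hx2⟩ := h2 y (by omega)
  exact ⟨x, by linarith, hx2⟩

end

section

variable {μ μ₀ : Zd 1 → ℝ}
open scoped ENNReal

/-- the critical point -/
structure Crit (μ μ₀ : Zd 1 → ℝ) (a b t : ℝ) : Prop where
  e1 : ph μ a b = t
  e2 : ph μ₀ a b = t
  dneg : d2 μ a b < 0
  hmin : ∀ α β, t ≤ max (ph μ α β) (ph μ₀ α β)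
  huniq : ∀ α β, max (ph μ α β) (ph μ₀ α β) = t → α = a

lemma ph0_mono (H : Hyp μ μ₀) (α : ℝ) {β β' : ℝ} (h : β ≤ β') : ph μ₀ α β ≤ ph μ₀ α β' :=
  ph_mono H.nn0 H.h30 H.low0 α h

lemma ph0_smono (H : Hyp μ μ₀) (α : ℝ) {β β' : ℝ} (h : β < β') : ph μ₀ α β < ph μ₀ α β' :=
  ph_smono H.nn0 H.h30 H.low0 (exists_up0 H) α h

lemma cph (H : Hyp μ μ₀) : Continuous fun q : ℝ × ℝ => ph μ q.1 q.2 := cont_ph H.nn H.h3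
lemma cph0 (H : Hyp μ μ₀) : Continuous fun q : ℝ × ℝ => ph μ₀ q.1 q.2 := cont_ph H.nn0 H.h30

lemma d2_neg_of (H : Hyp μ μ₀) {a : Rd 1} (hder : dBeta (phi μ) a < 0) : d2 μ (a.1 0) a.2 < 0 := by
  have hdiff : DifferentiableAt ℝ (phi μ) a := by
    by_contra h
    rw [dBeta, fderiv_zero_of_not_differentiableAt h] at hder
    simp at hder
  have hl := hdiff.hasFDerivAt.hasLineDerivAt (0, 1)
  have hl2 : HasDerivAt (fun e : ℝ => ph μ (a.1 0) (a.2 + e)) (dBeta (phi μ) a) 0 := by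
    have : (fun e : ℝ => ph μ (a.1 0) (a.2 + e)) = fun e : ℝ => phi μ (a + e • ((0, 1) : Rd 1)) := by
      ext e
      rw [phi_eq]; simp
    rw [this]; exact hl
  rw [hasDerivAt_iff_tendsto_slope_zero] at hl2
  have hev := (hl2.mono_left (nhdsWithin_mono 0 (fun x (hx : x ∈ Set.Ioi (0:ℝ)) => ne_of_gt hx))).eventually_lt_const hder
  obtain ⟨e, he, he0⟩ := (hev.and self_mem_nhdsWithin).exists
  have he0' : (0:ℝ) < e := he0
  simp only [zero_add, add_zero, smul_eq_mul] at he
  have h2 : ph μ (a.1 0) (a.2 + e) - ph μ (a.1 0) a.2 < 0 := by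
    by_contra hc
    push Not at hc
    have : 0 ≤ e⁻¹ * (ph μ (a.1 0) (a.2 + e) - ph μ (a.1 0) a.2) := by positivity
    linarith
  have h3 := subgrad H.nn H.h3 (a.1 0) a.2 (a.1 0) (a.2 + e)
  by_contra hc
  push Not at hc
  have := mul_nonneg he0'.le hc
  simp only [sub_self, zero_mul, zero_add, add_sub_cancel_left] at h3
  linarith

lemma mkCrit (H : Hyp μ μ₀) {a : Rd 1} (hder : dBeta (phi μ) a < 0)
    (hmin : ∀ b : Rd 1, max (phi μ a) (phi μ₀ a) ≤ max (phi μ b) (phi μ₀ b))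
    (huniq : ∀ b : Rd 1, max (phi μ b) (phi μ₀ b) = max (phi μ a) (phi μ₀ a) → b = a) :
    ∃ t, Crit μ μ₀ (a.1 0) a.2 t := by
  have hd := d2_neg_of H hder
  have hmin' : ∀ α β, max (ph μ (a.1 0) a.2) (ph μ₀ (a.1 0) a.2) ≤ max (ph μ α β) (ph μ₀ α β) := by
    intro α β
    have := hmin (fun _ => α, β)
    simpa only [phi_eq] using this
  obtain ⟨η, hη, hd1, -⟩ := local_dec H hd
  have heq : ph μ (a.1 0) a.2 = ph μ₀ (a.1 0) a.2 := by
    rcases lt_trichotomy (ph μ (a.1 0) a.2) (ph μ₀ (a.1 0) a.2) with h | h | h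
    · exfalso
      have hc : Continuous fun e => ph μ (a.1 0) (a.2 - e) :=
        cont_comp2 (cph H) continuous_const (by fun_prop)
      have hev : ∀ᶠ e in nhdsWithin (0:ℝ) (Set.Ioi 0), ph μ (a.1 0) (a.2 - e) < ph μ₀ (a.1 0) a.2 :=
        ((hc.tendsto 0).mono_left nhdsWithin_le_nhds).eventually_lt_const (by simpa using h)
      obtain ⟨e, he, he0⟩ := (hev.and self_mem_nhdsWithin).exists
      have he0' : (0:ℝ) < e := he0
      have h2 := ph0_smono H (a.1 0) (show a.2 - e < a.2 by linarith)
      have h3 := hmin' (a.1 0) (a.2 - e)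
      rw [max_eq_right h.le] at h3
      exact absurd h3 (not_le.2 (max_lt he h2))
    · exact h
    · exfalso
      have hc : Continuous fun θ => ph μ₀ (a.1 0) ((1 - θ) * a.2 + θ * (a.2 + η)) :=
        cont_comp2 (cph0 H) continuous_const (by fun_prop)
      have hev : ∀ᶠ e in nhdsWithin (0:ℝ) (Set.Ioi 0),
          ph μ₀ (a.1 0) ((1 - e) * a.2 + e * (a.2 + η)) < ph μ (a.1 0) a.2 :=
        ((hc.tendsto 0).mono_left nhdsWithin_le_nhds).eventually_lt_const (by simpa using h)
      have hev1 : ∀ᶠ e in nhdsWithin (0:ℝ) (Set.Ioi 0), e < 1 :=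
        (tendsto_id.mono_left nhdsWithin_le_nhds).eventually_lt_const one_pos
      obtain ⟨e, ⟨he, he1⟩, he0⟩ := ((hev.and hev1).and self_mem_nhdsWithin).exists
      have he0' : (0:ℝ) < e := he0
      have h2 := ph_convex H.nn H.h3 (a.1 0) a.2 (a.1 0) (a.2 + η) e he0'.le he1.le
      rw [← add_mul, sub_add_cancel, one_mul] at h2
      have h4 : ph μ (a.1 0) ((1 - e) * a.2 + e * (a.2 + η)) < ph μ (a.1 0) a.2 := by nlinarith
      have h3 := hmin' (a.1 0) ((1 - e) * a.2 + e * (a.2 + η))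
      rw [max_eq_left h.le] at h3
      exact absurd h3 (not_le.2 (max_lt h4 he))
  refine ⟨ph μ (a.1 0) a.2, rfl, heq.symm, hd, fun α β => ?_, fun α β h => ?_⟩
  · have := hmin' α β
    rwa [← heq, max_self] at this
  · have := huniq (fun _ => α, β) (by simp only [phi_eq]; rw [h, ← heq, max_self])
    rw [← this]

/-- upper root -/
lemma top_root (H : Hyp μ μ₀) {a b : ℝ} (hd : d2 μ a b < 0) :
    ∃ c, b < c ∧ ph μ a c = ph μ a b ∧ 0 < d2 μ a c := by
  obtain ⟨η, hη, hd1, -⟩ := local_dec H hd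
  obtain ⟨β, hβ1, hβ2⟩ := ph_large H.nn H.h3 (exists_up H) a (ph μ a b) (b + η)
  have hc : Continuous fun e => ph μ a e := cont_comp2 (cph H) continuous_const continuous_id
  obtain ⟨c, hc1, hc2⟩ := intermediate_value_Ioo hβ1.le hc.continuousOn
    (show ph μ a b ∈ Set.Ioo _ _ from ⟨hd1, hβ2⟩)
  simp only at hc2
  refine ⟨c, by linarith [hc1.1], hc2, ?_⟩
  have h := subgrad H.nn H.h3 a c a (b + η)
  by_contra hn
  push Not at hn
  have := hc1.1
  nlinarith

/-- local solvability near an upper root -/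
lemma root_loc (H : Hyp μ μ₀) {α β : ℝ} (hd : 0 < d2 μ α β) {ε : ℝ} (hε : 0 < ε) :
    ∀ᶠ q : ℝ × ℝ in nhds (α, ph μ α β), ∃ β₁, |β₁ - β| < ε ∧ ph μ q.1 β₁ = q.2 ∧ 0 < d2 μ q.1 β₁ ∧
      |d1 μ q.1 β₁ / d2 μ q.1 β₁ - d1 μ α β / d2 μ α β| < ε := by
  have c1 := cont_d1 H.nn H.h3
  have c2 := cont_d2 H.nn H.h3
  have hev1 : ∀ᶠ q : ℝ × ℝ in nhds (α, β), 0 < d2 μ q.1 q.2 :=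
    (c2.tendsto (α, β)).eventually_const_lt hd
  have hev2 : ∀ᶠ q : ℝ × ℝ in nhds (α, β),
      |d1 μ q.1 q.2 / d2 μ q.1 q.2 - d1 μ α β / d2 μ α β| < ε := by
    have := ((c1.tendsto (α, β)).div (c2.tendsto (α, β)) hd.ne')
    have := this.sub_const (d1 μ α β / d2 μ α β)
    have h0 := this.abs
    simp only [sub_self, abs_zero] at h0
    exact h0.eventually_lt_const hε
  obtain ⟨r, hr, hball⟩ := Metric.eventually_nhds_iff.1 (hev1.and hev2)
  set ρ := min (r / 2) (ε / 2) with hρ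
  have hρ0 : 0 < ρ := by positivity
  have hρr : ρ < r := lt_of_le_of_lt (min_le_left _ _) (by linarith)
  have hρε : ρ < ε := lt_of_le_of_lt (min_le_right _ _) (by linarith)
  have hbox : ∀ α₁ β₁, |α₁ - α| < r → |β₁ - β| < r → 0 < d2 μ α₁ β₁ ∧
      |d1 μ α₁ β₁ / d2 μ α₁ β₁ - d1 μ α β / d2 μ α β| < ε := by
    intro α₁ β₁ h1 h2
    refine hball (y := (α₁, β₁)) ?_
    rw [Prod.dist_eq, Real.dist_eq, Real.dist_eq]
    exact max_lt h1 h2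
  have hlow : ph μ α (β - ρ) < ph μ α β := by
    have h1 := (hbox α (β - ρ) (by simpa using hr) (by
      rw [sub_sub_cancel_left, abs_neg, abs_of_pos hρ0]; exact hρr)).1
    have h2 := subgrad H.nn H.h3 α (β - ρ) α β
    nlinarith
  have hhigh : ph μ α β < ph μ α (β + ρ) := by
    have h2 := subgrad H.nn H.h3 α β α (β + ρ)
    nlinarith
  have hl1 : Tendsto (fun q : ℝ × ℝ => ph μ q.1 (β - ρ) - q.2) (nhds (α, ph μ α β))
      (nhds (ph μ α (β - ρ) - ph μ α β)) :=
    (((cph H).comp (continuous_fst.prodMk continuous_const)).sub continuous_snd).tendsto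
      ((α, ph μ α β) : ℝ × ℝ)
  have hl2 : Tendsto (fun q : ℝ × ℝ => ph μ q.1 (β + ρ) - q.2) (nhds (α, ph μ α β))
      (nhds (ph μ α (β + ρ) - ph μ α β)) :=
    (((cph H).comp (continuous_fst.prodMk continuous_const)).sub continuous_snd).tendsto
      ((α, ph μ α β) : ℝ × ℝ)
  have hl3 : Tendsto (fun q : ℝ × ℝ => |q.1 - α|) (nhds (α, ph μ α β)) (nhds 0) := by
    have : Continuous fun q : ℝ × ℝ => |q.1 - α| := by fun_prop
    simpa using this.tendsto (α, ph μ α β)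
  filter_upwards [hl1.eventually_lt_const (sub_neg.2 hlow), hl2.eventually_const_lt (sub_pos.2 hhigh),
    hl3.eventually_lt_const hr] with q h1 h2 h3
  have hc : Continuous fun e => ph μ q.1 e := cont_comp2 (cph H) continuous_const continuous_id
  obtain ⟨c, hc1, hc2⟩ := intermediate_value_Ioo (show β - ρ ≤ β + ρ by linarith) hc.continuousOn
    (show q.2 ∈ Set.Ioo _ _ from ⟨by linarith, by linarith⟩)
  simp only at hc2
  have hcb : |c - β| < ρ := by rw [abs_lt]; constructor <;> linarith [hc1.1, hc1.2]
  obtain ⟨g1, g2⟩ := hbox q.1 c h3 (hcb.trans hρr)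
  exact ⟨c, hcb.trans hρε, hc2, g1, g2⟩

lemma slope_mono (H : Hyp μ μ₀) {α β α₁ β₁ : ℝ} (he : ph μ α β = ph μ α₁ β₁) (hd : 0 < d2 μ α β)
    (hd1 : 0 < d2 μ α₁ β₁) (hα : α < α₁) : d1 μ α β / d2 μ α β < d1 μ α₁ β₁ / d2 μ α₁ β₁ := by
  have h1 := sgs H (α := α) (β := β) (α' := α₁) (β' := β₁) (Or.inl (by linarith))
  have h2 := sgs H (α := α₁) (β := β₁) (α' := α) (β' := β) (Or.inl (by linarith))
  set v := d1 μ α β / d2 μ α β with hv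
  set v₁ := d1 μ α₁ β₁ / d2 μ α₁ β₁ with hv₁
  have e1 : d1 μ α β = v * d2 μ α β := by rw [hv]; field_simp
  have e2 : d1 μ α₁ β₁ = v₁ * d2 μ α₁ β₁ := by rw [hv₁]; field_simp
  rw [e1] at h1
  rw [e2] at h2
  have h3 : ((α₁ - α) * v + (β₁ - β)) * d2 μ α β < 0 := by linarith
  have h4 : ((α - α₁) * v₁ + (β - β₁)) * d2 μ α₁ β₁ < 0 := by linarith
  have h6 : (α₁ - α) * v + (β₁ - β) < 0 := by
    by_contra hc; push Not at hc
    have := mul_nonneg hc hd.le; linarith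
  have h7 : (α - α₁) * v₁ + (β - β₁) < 0 := by
    by_contra hc; push Not at hc
    have := mul_nonneg hc hd1.le; linarith
  by_contra hc
  push Not at hc
  nlinarith

end

section

variable {μ μ₀ : Zd 1 → ℝ}
open scoped ENNReal

/-- a point of the upper boundary at level `t` with an interior point below it -/
structure TopP (μ μ₀ : Zd 1 → ℝ) (t α β b : ℝ) : Prop where
  e : ph μ α β = t
  d : 0 < d2 μ α β
  i1 : ph μ α b < t
  i2 : ph μ₀ α b < t
  lt : b < β

/-- slope of the normal -/
def slp (μ : Zd 1 → ℝ) (α β : ℝ) : ℝ := d1 μ α β / d2 μ α β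

lemma par1 (H : Hyp μ μ₀) {a b ts c : ℝ} (C : Crit μ μ₀ a b ts) (hbc : b < c) (hc : ph μ a c = ts)
    (hd : 0 < d2 μ a c) : ∃ t, ts < t ∧ ∃ s : ℤ, (s = 1 ∨ s = -1) ∧ ∃ A₁ B₁ A₂ B₂,
      TopP μ μ₀ t A₁ B₁ b ∧ TopP μ μ₀ t A₂ B₂ b ∧ s * A₁ < s * A₂ ∧
      s * slp μ A₁ B₁ < s * slp μ A₂ B₂ ∧ s * slp μ a c < s * slp μ A₁ B₁ := by
  have hloc := root_loc H hd (sub_pos.2 hbc)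
  rw [hc] at hloc
  obtain ⟨r, hr, hball⟩ := Metric.eventually_nhds_iff.1 hloc
  set t := ts + r / 2 with ht
  have htt : ts < t := by linarith
  have hev1 : ∀ᶠ α in nhds a, ph μ α b < t :=
    ((cont_comp2 (cph H) continuous_id continuous_const).tendsto a).eventually_lt_const
      (by simp only [id]; rw [C.e1]; exact htt)
  have hev2 : ∀ᶠ α in nhds a, ph μ₀ α b < t :=
    ((cont_comp2 (cph0 H) continuous_id continuous_const).tendsto a).eventually_lt_const
      (by simp only [id]; rw [C.e2]; exact htt)
  obtain ⟨δ, hδ, hb2⟩ := Metric.eventually_nhds_iff.1 (hev1.and hev2)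
  have hpt : ∀ α, |α - a| < min r δ → ∃ B, TopP μ μ₀ t α B b := by
    intro α hα
    obtain ⟨B, hB1, hB2, hB3, -⟩ := hball (y := (α, t)) (by
      rw [Prod.dist_eq, Real.dist_eq, Real.dist_eq]
      refine max_lt (hα.trans_le (min_le_left _ _)) ?_
      simp only [ht, add_sub_cancel_left]
      rw [abs_of_pos (by linarith)]; linarith)
    have h := hb2 (y := α) (by rw [Real.dist_eq]; exact hα.trans_le (min_le_right _ _))
    exact ⟨B, hB2, hB3, h.1, h.2, by linarith [(abs_lt.1 hB1).1]⟩
  set m := min r δ with hm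
  have hm0 : 0 < m := lt_min hr hδ
  have hk : ∀ k : ℝ, 0 ≤ k → k < 5 → |a + m * k / 5 - a| < m := by
    intro k h0 h5
    rw [add_sub_cancel_left, abs_of_nonneg (by positivity)]
    nlinarith
  obtain ⟨B1, T1⟩ := hpt (a + m * 1 / 5) (hk 1 (by norm_num) (by norm_num))
  obtain ⟨B2, T2⟩ := hpt (a + m * 2 / 5) (hk 2 (by norm_num) (by norm_num))
  obtain ⟨B3, T3⟩ := hpt (a + m * 3 / 5) (hk 3 (by norm_num) (by norm_num))
  obtain ⟨B4, T4⟩ := hpt (a + m * 4 / 5) (hk 4 (by norm_num) (by norm_num))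
  have s12 := slope_mono H (T1.e.trans T2.e.symm) T1.d T2.d (by linarith)
  have s23 := slope_mono H (T2.e.trans T3.e.symm) T2.d T3.d (by linarith)
  have s34 := slope_mono H (T3.e.trans T4.e.symm) T3.d T4.d (by linarith)
  refine ⟨t, htt, ?_⟩
  by_cases hcase : slp μ a c < slp μ (a + m * 3 / 5) B3
  · refine ⟨1, Or.inl rfl, _, _, _, _, T3, T4, ?_, ?_, ?_⟩
    · push_cast; linarith
    · push_cast; simp only [slp]; linarith
    · push_cast; linarith
  · push Not at hcase
    refine ⟨-1, Or.inr rfl, _, _, _, _, T2, T1, ?_, ?_, ?_⟩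
    · push_cast; linarith
    · push_cast; simp only [slp]; linarith
    · push_cast; simp only [slp] at hcase ⊢; linarith

set_option maxHeartbeats 1000000 in
lemma par2 (H : Hyp μ μ₀) {a b ts c : ℝ} (C : Crit μ μ₀ a b ts) (hbc : b < c) (hc : ph μ a c = ts)
    (hd : 0 < d2 μ a c) {t : ℝ} (ht : ts < t) {s : ℤ} (hs : s = 1 ∨ s = -1) {ε : ℝ} (hε : 0 < ε) :
    ∃ α' b₂ t' β', ts < t' ∧ t' < t ∧ ChD μ μ₀ t' α' b₂ s ∧ ph μ α' β' = t' ∧ 0 < d2 μ α' β' ∧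
      b₂ < β' ∧ |slp μ α' β' - slp μ a c| < ε := by
  have hss : (s : ℝ) * s = 1 := by rcases hs with h | h <;> simp [h]
  have hsabs : |(s : ℝ)| = 1 := by rcases hs with h | h <;> simp [h]
  have hloc := root_loc H hd (lt_min hε (show 0 < (c - b) / 2 by linarith))
  rw [hc] at hloc
  have hten : Tendsto (fun q : ℝ × ℝ => (q.1, ph μ q.1 q.2)) (nhds (a, b)) (nhds (a, ts)) := by
    have := (continuous_fst.prodMk (cph H)).tendsto (a, b)
    simpa only [C.e1] using this
  have hev1 := hten.eventually hloc
  have hev2 : ∀ᶠ q : ℝ × ℝ in nhds (a, b), ph μ q.1 q.2 < t :=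
    ((cph H).tendsto (a, b)).eventually_lt_const (by simp only; rw [C.e1]; exact ht)
  have hev3 : ∀ᶠ q : ℝ × ℝ in nhds (a, b), d2 μ q.1 q.2 < 0 :=
    ((cont_d2 H.nn H.h3).tendsto (a, b)).eventually_lt_const C.dneg
  obtain ⟨r, hr, hball⟩ := Metric.eventually_nhds_iff.1 ((hev1.and hev2).and hev3)
  have hbox : ∀ α β, |α - a| < r → |β - b| < r → _ := fun α β h1 h2 => hball (y := (α, β)) (by
    rw [Prod.dist_eq, Real.dist_eq, Real.dist_eq]; exact max_lt h1 h2)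
  set ρ := min (r / 2) ((c - b) / 4) with hρ
  have hρ0 : 0 < ρ := lt_min (by linarith) (by linarith)
  have hρr : ρ < r := lt_of_le_of_lt (min_le_left _ _) (by linarith)
  have hρc : ρ ≤ (c - b) / 4 := min_le_right _ _
  have l1 : 0 < ph μ a (b - ρ) - ph μ₀ a (b - ρ) := by
    have h1 := subgrad H.nn H.h3 a b a (b - ρ)
    have h2 := ph0_smono H a (show b - ρ < b by linarith)
    have := C.dneg
    rw [C.e1] at h1; rw [C.e2] at h2
    nlinarith
  have l2 : ph μ a (b + ρ) - ph μ₀ a (b + ρ) < 0 := by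
    have h1 := subgrad H.nn H.h3 a (b + ρ) a b
    have h2 := ph0_smono H a (show b < b + ρ by linarith)
    have h3 := (hbox a (b + ρ) (by simpa using hr) (by
      rw [add_sub_cancel_left, abs_of_pos hρ0]; exact hρr)).2
    simp only at h3
    rw [C.e1] at h1; rw [C.e2] at h2
    nlinarith
  have ev1 : ∀ᶠ α in nhds a, 0 < ph μ α (b - ρ) - ph μ₀ α (b - ρ) :=
    (((cont_comp2 (cph H) continuous_id continuous_const).sub
      (cont_comp2 (cph0 H) continuous_id continuous_const)).tendsto a).eventually_const_lt l1
  have ev2 : ∀ᶠ α in nhds a, ph μ α (b + ρ) - ph μ₀ α (b + ρ) < 0 :=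
    (((cont_comp2 (cph H) continuous_id continuous_const).sub
      (cont_comp2 (cph0 H) continuous_id continuous_const)).tendsto a).eventually_lt_const l2
  obtain ⟨δ, hδ, hb2⟩ := Metric.eventually_nhds_iff.1 (ev1.and ev2)
  set η := min r δ / 2 with hη
  have hm0 : 0 < min r δ := lt_min hr hδ
  have hη0 : 0 < η := by positivity
  have hηr : η < r := by have := min_le_left r δ; linarith
  have hηδ : η < δ := by have := min_le_right r δ; linarith
  set α' := a + s * η with hα'
  have hαa : |α' - a| = η := by
    rw [hα', add_sub_cancel_left, abs_mul, hsabs, one_mul, abs_of_pos hη0]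
  obtain ⟨k1, k2⟩ := hb2 (y := α') (by rw [Real.dist_eq, hαa]; exact hηδ)
  have hcont : Continuous fun e => ph μ₀ α' e - ph μ α' e :=
    (cont_comp2 (cph0 H) continuous_const continuous_id).sub
      (cont_comp2 (cph H) continuous_const continuous_id)
  obtain ⟨b₂, hb₂, hz⟩ := intermediate_value_Ioo (show b - ρ ≤ b + ρ by linarith) hcont.continuousOn
    (show (0:ℝ) ∈ Set.Ioo _ _ from ⟨by linarith, by linarith⟩)
  simp only at hz
  have hb2b : |b₂ - b| < ρ := by rw [abs_lt]; constructor <;> linarith [hb₂.1, hb₂.2]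
  obtain ⟨⟨⟨β', hβ1, hβ2, hβ3, hβ4⟩, hlt⟩, hdn⟩ := hbox α' b₂ (by rw [hαa]; exact hηr) (hb2b.trans hρr)
  simp only at hβ2 hβ3 hβ4 hlt hdn
  have hne : α' ≠ a := by
    intro h; rw [h, sub_self, abs_zero] at hαa; linarith
  have heq : ph μ₀ α' b₂ = ph μ α' b₂ := by linarith
  have hgt : ts < ph μ α' b₂ := by
    have h1 := C.hmin α' b₂
    rw [heq, max_self] at h1
    refine lt_of_le_of_ne h1 fun h => hne (C.huniq α' b₂ ?_)
    rw [heq, max_self, h]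
  refine ⟨α', b₂, ph μ α' b₂, β', hgt, hlt, ⟨hs, rfl, heq, hdn, ?_, ⟨a, b, ?_, ?_⟩⟩, hβ2, hβ3, ?_, ?_⟩
  · intro α bb hpos
    by_contra hcon
    push Not at hcon
    obtain ⟨hc1, hc2⟩ := max_le_iff.1 hcon
    set x := s * (α - α') with hx
    have hαx : α = a + s * (η + x) := by
      rw [hx, hα']
      linear_combination (-(α - (a + s * η))) * hss
    set θ := η / (η + x) with hθ
    have hθ0 : 0 < θ := by positivity
    have hθ1 : θ < 1 := by rw [hθ, div_lt_one (by positivity)]; linarith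
    have hθe : θ * (η + x) = η := by rw [hθ]; field_simp
    have hcomb : (1 - θ) * a + θ * α = α' := by
      rw [hαx, hα']; linear_combination s * hθe
    have m1 := ph_convex H.nn H.h3 a b α bb θ hθ0.le hθ1.le
    have m2 := ph_convex H.nn0 H.h30 a b α bb θ hθ0.le hθ1.le
    rw [hcomb, C.e1] at m1
    rw [hcomb, C.e2] at m2
    set bt := (1 - θ) * b + θ * bb
    have n1 : ph μ α' bt < ph μ α' b₂ := by nlinarith
    have n2 : ph μ₀ α' bt < ph μ α' b₂ := by nlinarith
    rcases le_or_gt b₂ bt with h | h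
    · have := ph0_mono H α' h
      linarith
    · have := subgrad H.nn H.h3 α' b₂ α' bt
      nlinarith
  · rw [C.e1]; exact hgt
  · rw [C.e2]; exact hgt
  · have h1 := (abs_lt.1 (hβ1.trans_le (min_le_right _ _))).1
    have h2 := (abs_lt.1 hb2b).2
    linarith
  · exact hβ4.trans_le (min_le_left _ _)

end

section

variable {μ μ₀ : Zd 1 → ℝ}
open scoped ENNReal

lemma s_facts {s : ℤ} (hs : s = 1 ∨ s = -1) : (s : ℝ) * s = 1 ∧ |(s : ℝ)| = 1 := by
  rcases hs with h | h <;> simp [h]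

lemma UpB_of (H : Hyp μ μ₀) {s : ℤ} (hs : s = 1 ∨ s = -1) {a₀ b₀ α β b t R : ℝ}
    (h1 : ph μ a₀ b₀ < t) (h2 : ph μ₀ a₀ b₀ < t) (h3 : ph μ α β ≤ t) (h4 : ph μ α b ≤ t)
    (h5 : ph μ₀ α b ≤ t) (hR : 0 ≤ R) : UpB (fun x y => lg μ μ₀ t (s * x) y) (s * α) β R := by
  intro ε hε
  obtain ⟨-, hsabs⟩ := s_facts hs
  set M := |α - a₀| * R + |β - b₀| with hM
  have hM0 : 0 ≤ M := by positivity
  set e := min (1 / 2) (ε / (2 * (M + 1))) with he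
  have he0 : 0 < e := by positivity
  have he1 : e ≤ 1 / 2 := min_le_left _ _
  have heM : e * M ≤ ε / 2 := by
    have : e ≤ ε / (2 * (M + 1)) := min_le_right _ _
    rw [le_div_iff₀ (by positivity)] at this
    nlinarith
  have key : ∀ (ν : Zd 1 → ℝ), (∀ z, 0 ≤ ν z) → H3 ν → ∀ β b₀, ph ν a₀ b₀ < t → ph ν α β ≤ t →
      ph ν ((1 - (1 - e)) * a₀ + (1 - e) * α) ((1 - (1 - e)) * b₀ + (1 - e) * β) < t := by
    intro ν hν hν3 β b₀ g1 g2
    have := ph_convex hν hν3 a₀ b₀ α β (1 - e) (by linarith) (by linarith)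
    nlinarith
  obtain ⟨C, hC⟩ := lg_upper H (key μ H.nn H.h3 β b₀ h1 h3) (key μ H.nn H.h3 b b₀ h1 h4)
    (key μ₀ H.nn0 H.h30 b b₀ h2 h5)
  obtain ⟨Y, hY⟩ := nat_big C (show 0 < ε / 2 by linarith)
  refine ⟨Y, fun y hy x hx => ?_⟩
  specialize hY y hy
  have hy0 : (0 : ℝ) ≤ y := Nat.cast_nonneg y
  have hb := hC (s * x) y
  push_cast at hb
  set X : ℝ := (s : ℝ) * x with hX
  have hXa : |X| ≤ R * y := by rw [hX, abs_mul, hsabs, one_mul]; exact hx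
  have g1 : (α - a₀) * X ≤ |α - a₀| * (R * y) :=
    (le_abs_self _).trans (by rw [abs_mul]; exact mul_le_mul_of_nonneg_left hXa (abs_nonneg _))
  have g2 : (β - b₀) * y ≤ |β - b₀| * y := mul_le_mul_of_nonneg_right (le_abs_self _) hy0
  have g3 : e * ((α - a₀) * X + (β - b₀) * y) ≤ e * (M * y) :=
    mul_le_mul_of_nonneg_left (by rw [hM]; linarith) he0.le
  have g4 : e * M * y ≤ ε / 2 * y := mul_le_mul_of_nonneg_right heM hy0
  have : -(s * α) * x = -α * X := by rw [hX]; ring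
  rw [this]
  refine hb.trans ?_
  linarith

lemma low_top (H : Hyp μ μ₀) {s : ℤ} (hs : s = 1 ∨ s = -1) {t α β b : ℝ} (T : TopP μ μ₀ t α β b)
    {ε : ℝ} (hε : 0 < ε) : ∃ Y : ℕ, ∀ y : ℕ, Y ≤ y → ∀ x : ℤ, |(x : ℝ) - s * slp μ α β * y| ≤ 1 →
      -(s * α) * x - β * y - ε * y ≤ lg μ μ₀ t (s * x) y := by
  obtain ⟨hss, hsabs⟩ := s_facts hs
  obtain ⟨Y, hY⟩ := lowerG H T.e T.i1 T.i2 (ph0_smono H α T.lt) T.d hε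
  refine ⟨Y, fun y hy x hx => ?_⟩
  have := hY y hy (s * x) (by
    push_cast
    have e : (s : ℝ) * x - d1 μ α β / d2 μ α β * y = s * (x - s * slp μ α β * y) := by
      rw [slp]; linear_combination (d1 μ α β / d2 μ α β * y) * hss
    rw [e, abs_mul, hsabs, one_mul]; exact hx)
  push_cast at this
  linarith

lemma low_near (H : Hyp μ μ₀) {s : ℤ} (hs : s = 1 ∨ s = -1) {a₀ b₀ α β b t lo R : ℝ}
    (h1 : ph μ a₀ b₀ < t) (h2 : ph μ₀ a₀ b₀ < t) (h3 : ph μ α β = t) (h4 : ph μ α b ≤ t)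
    (h5 : ph μ₀ α b ≤ t) (hd : 0 < d2 μ α β) (hb : b < β) (hlo : s * slp μ α β < lo)
    (hloR : lo ≤ R) (hR : -R < s * slp μ α β) {ε : ℝ} (hε : 0 < ε) :
    ∃ v : ℝ, -R ≤ v ∧ v ≤ lo ∧ ∃ Y : ℕ, ∀ y : ℕ, Y ≤ y → ∀ x : ℤ, |(x : ℝ) - v * y| ≤ 1 →
      -(s * α) * x - β * y - ε * y ≤ lg μ μ₀ t (s * x) y := by
  obtain ⟨hss, hsabs⟩ := s_facts hs
  have hRp : 0 < R := by linarith
  set ε₂ := min (min (ε / 4) ((β - b) / 2)) (min (lo - s * slp μ α β) (s * slp μ α β + R)) with hε₂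
  have hε₂0 : 0 < ε₂ := lt_min (lt_min (by linarith) (by linarith)) (lt_min (by linarith) (by linarith))
  have q1 : ε₂ ≤ ε / 4 := (min_le_left _ _).trans (min_le_left _ _)
  have q2 : ε₂ ≤ (β - b) / 2 := (min_le_left _ _).trans (min_le_right _ _)
  have q3 : ε₂ ≤ lo - s * slp μ α β := (min_le_right _ _).trans (min_le_left _ _)
  have q4 : ε₂ ≤ s * slp μ α β + R := (min_le_right _ _).trans (min_le_right _ _)
  have hloc := root_loc H hd hε₂0
  rw [h3] at hloc
  have cA : Continuous fun e : ℝ => (1 - (1 - e)) * a₀ + (1 - e) * α := by fun_prop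
  have cB : Continuous fun e : ℝ => (1 - (1 - e)) * b₀ + (1 - e) * b := by fun_prop
  have tA : Tendsto (fun e : ℝ => (1 - (1 - e)) * a₀ + (1 - e) * α) (nhdsWithin 0 (Set.Ioi 0)) (nhds α) := by
    have := (cA.tendsto 0).mono_left (nhdsWithin_le_nhds (s := Set.Ioi 0))
    simpa using this
  have tB : Tendsto (fun e : ℝ => (1 - (1 - e)) * b₀ + (1 - e) * b) (nhdsWithin 0 (Set.Ioi 0)) (nhds b) := by
    have := (cB.tendsto 0).mono_left (nhdsWithin_le_nhds (s := Set.Ioi 0))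
    simpa using this
  have ev1 := (tA.prodMk_nhds (tendsto_const_nhds (x := t))).eventually hloc
  have ev2 : ∀ᶠ e : ℝ in nhdsWithin 0 (Set.Ioi 0),
      |((1 - (1 - e)) * a₀ + (1 - e) * α) - α| < ε / (4 * (R + 1)) := by
    have := (tA.sub_const α).abs
    simp only [sub_self, abs_zero] at this
    exact this.eventually_lt_const (by positivity)
  have ev3 : ∀ᶠ e : ℝ in nhdsWithin 0 (Set.Ioi 0), (1 - (1 - e)) * b₀ + (1 - e) * b < (b + β) / 2 :=
    tB.eventually_lt_const (by linarith)
  have ev4 : ∀ᶠ e in nhdsWithin (0:ℝ) (Set.Ioi 0), e < 1 :=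
    (tendsto_id.mono_left nhdsWithin_le_nhds).eventually_lt_const one_pos
  obtain ⟨e, ⟨⟨⟨⟨β'', r1, r2, r3, r4⟩, he2⟩, he3⟩, he4⟩, he0⟩ :=
    ((((ev1.and ev2).and ev3).and ev4).and self_mem_nhdsWithin).exists
  have he0' : (0:ℝ) < e := he0
  have key : ∀ (ν : Zd 1 → ℝ), (∀ z, 0 ≤ ν z) → H3 ν → ph ν a₀ b₀ < t → ph ν α b ≤ t →
      ph ν ((1 - (1 - e)) * a₀ + (1 - e) * α) ((1 - (1 - e)) * b₀ + (1 - e) * b) < t := by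
    intro ν hν hν3 g1 g2
    have := ph_convex hν hν3 a₀ b₀ α b (1 - e) (by linarith) (by linarith)
    nlinarith
  have k1 := key μ H.nn H.h3 h1 h4
  have k2 := key μ₀ H.nn0 H.h30 h2 h5
  set α'' := (1 - (1 - e)) * a₀ + (1 - e) * α with hα''
  set b'' := (1 - (1 - e)) * b₀ + (1 - e) * b with hb''
  simp only at r2 r3 r4
  have hβb : |β'' - β| < ε₂ := r1
  have T : TopP μ μ₀ t α'' β'' b'' := ⟨r2, r3, k1, k2, by linarith [(abs_lt.1 hβb).1]⟩
  obtain ⟨Y, hY⟩ := low_top H hs T (show 0 < ε / 2 by linarith)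
  have hsl : |s * slp μ α'' β'' - s * slp μ α β| < ε₂ := by
    rw [← mul_sub, abs_mul, hsabs, one_mul]; exact r4
  have hv1 : -R ≤ s * slp μ α'' β'' := by linarith [(abs_lt.1 hsl).1]
  have hv2 : s * slp μ α'' β'' ≤ lo := by linarith [(abs_lt.1 hsl).2]
  refine ⟨s * slp μ α'' β'', hv1, hv2, Y + 1, fun y hy x hx => ?_⟩
  have hb := hY y (by omega) x hx
  have hy1 : (1 : ℝ) ≤ y := by exact_mod_cast (show 1 ≤ y by omega)
  have hxR : |(x : ℝ)| ≤ (R + 1) * y := by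
    obtain ⟨x1, x2⟩ := abs_le.1 hx
    rw [abs_le]
    constructor <;> nlinarith
  have g1 : s * (α'' - α) * x ≤ ε / 4 * y := by
    refine (le_abs_self _).trans ?_
    rw [abs_mul, abs_mul, hsabs, one_mul]
    calc |α'' - α| * |(x : ℝ)| ≤ ε / (4 * (R + 1)) * ((R + 1) * y) :=
          mul_le_mul he2.le hxR (abs_nonneg _) (by positivity)
      _ = ε / 4 * y := by field_simp
  have g2 : (β'' - β) * y ≤ ε / 4 * y :=
    mul_le_mul_of_nonneg_right (by linarith [(abs_lt.1 hβb).2]) (by linarith)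
  refine le_trans ?_ hb
  linarith

lemma tendsto_cof {zs : ℕ → Ed 1} (h : ∀ n, n ≤ (zs n).2) : Tendsto zs atTop cofinite := by
  rw [Tendsto, le_cofinite_iff_eventually_ne]
  intro z
  rw [eventually_map]
  filter_upwards [eventually_gt_atTop z.2] with n hn heq
  have := h n
  rw [heq] at this
  omega

lemma euclNorm_ge (z : Ed 1) : (z.2 : ℝ) ≤ euclNorm (vecE z) := by
  rw [euclNorm]
  apply Real.le_sqrt_of_sq_le
  have : 0 ≤ ∑ i, (vecE z).1 i ^ 2 := Finset.sum_nonneg fun i _ => sq_nonneg _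
  simp only [vecE] at this ⊢
  linarith

lemma diverge (H : Hyp μ μ₀) {t : ℝ} (ht : 0 < t) (hf : ∀ z w, GE μ μ₀ t z w ≠ ∞) {s : ℤ}
    (z₀ : Ed 1) {zs : ℕ → Ed 1} {m₁ m₂ : ℝ} (hm : m₁ < m₂)
    (h1 : ∀ n, Even n → qq μ μ₀ t (zs n) (sh s 0) ≤ m₁)
    (h2 : ∀ n, ¬ Even n → m₂ ≤ qq μ μ₀ t (zs n) (sh s 0)) :
    ∃ z : Ed 1, ¬ ∃ L : ℝ, Tendsto (fun n => martin μ μ₀ t z₀ z (zs n)) atTop (nhds L) := by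
  by_contra hcon
  push Not at hcon
  obtain ⟨L1, hL1⟩ := hcon (sh s 0)
  obtain ⟨L0, hL0⟩ := hcon 0
  obtain ⟨c, hc0, hc1, har, -⟩ := gr_harnack H ht hf
  have hL0p : 0 < L0 := by
    refine lt_of_lt_of_le (pow_pos hc0 (dd 0 z₀)) (ge_of_tendsto' hL0 fun n => ?_)
    rw [martin, green_eq H ht, green_eq H ht]
    exact (le_div_iff₀ (gr_pos H ht hf z₀ (zs n))).2 (har 0 z₀ (zs n))
  have hq : Tendsto (fun n => qq μ μ₀ t (zs n) (sh s 0)) atTop (nhds (L1 / L0)) := by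
    refine (hL1.div hL0 hL0p.ne').congr fun n => ?_
    have p := (gr_pos H ht hf z₀ (zs n)).ne'
    simp only [Pi.div_apply, qq, martin]
    rw [green_eq H ht, green_eq H ht, green_eq H ht]
    exact div_div_div_cancel_right₀ p _ _
  have t1 : Tendsto (fun n : ℕ => 2 * n) atTop atTop :=
    tendsto_atTop_mono (fun n => by simp only [id]; omega) tendsto_id
  have t2 : Tendsto (fun n : ℕ => 2 * n + 1) atTop atTop :=
    tendsto_atTop_mono (fun n => by simp only [id]; omega) tendsto_id
  have e1 := le_of_tendsto' (hq.comp t1) fun n => h1 (2 * n) (even_two_mul n)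
  have e2 := ge_of_tendsto' (hq.comp t2) fun n => h2 (2 * n + 1) (by simp)
  linarith

set_option maxHeartbeats 1000000 in
lemma main_core (H : Hyp μ μ₀) {a b ts : ℝ} (C : Crit μ μ₀ a b ts) (z₀ : Ed 1) :
    ∃ t t' : ℝ, rho μ μ₀ < t ∧ rho μ μ₀ < t' ∧ t ≠ t' ∧
      ∃ zseq : ℕ → Ed 1,
        Tendsto (fun n => euclNorm (vecE (zseq n))) atTop atTop ∧
        (∀ z : Ed 1, ∃ L : ℝ,
          Tendsto (fun n => martin μ μ₀ t' z₀ z (zseq n)) atTop (nhds L)) ∧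
        (∃ z : Ed 1, ¬ ∃ L : ℝ,
          Tendsto (fun n => martin μ μ₀ t z₀ z (zseq n)) atTop (nhds L)) := by
  obtain ⟨c, hbc, hc, hd⟩ := top_root H C.dneg
  rw [C.e1] at hc
  obtain ⟨t, htt, s, hs, A₁, B₁, A₂, B₂, T₁, T₂, hA, hV, hG⟩ := par1 H C hbc hc hd
  obtain ⟨hss, hsabs⟩ := s_facts hs
  set G := s * slp μ A₁ B₁ - s * slp μ a c with hGd
  have hG0 : 0 < G := by linarith
  obtain ⟨α', b₂, t', β', ht1, ht2, D, hb1, hb2, hb3, hb4⟩ := par2 H C hbc hc hd htt hs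
    (show 0 < G / 4 by linarith)
  have hts : 0 < ts := C.e1 ▸ ph_pos H.nn H.h3 (let ⟨z, _, h⟩ := exists_up H; ⟨z, h⟩) a b
  have ht0 : 0 < t := by linarith
  have ht0' : 0 < t' := by linarith
  have hrho : rho μ μ₀ ≤ ts := by
    have := rho_le H a b
    rwa [C.e1, C.e2, max_self] at this
  have i1 : ph μ a b < t := by rw [C.e1]; exact htt
  have i2 : ph μ₀ a b < t := by rw [C.e2]; exact htt
  have i1' : ph μ a b < t' := by rw [C.e1]; exact ht1
  have i2' : ph μ₀ a b < t' := by rw [C.e2]; exact ht1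
  have hf := GE_ne_top H i1 i2
  have hf' := GE_ne_top H i1' i2'
  have hsl : |s * slp μ α' β' - s * slp μ a c| < G / 4 := by
    rw [← mul_sub, abs_mul, hsabs, one_mul]; exact hb4
  obtain ⟨hsl1, hsl2⟩ := abs_lt.1 hsl
  set v := s * slp μ a c with hv
  set V₁ := s * slp μ A₁ B₁ with hV₁
  set V₂ := s * slp μ A₂ B₂ with hV₂
  set R := |v| + |V₁| + |V₂| + G + 1 with hR
  have w1 := neg_abs_le v
  have w2 := le_abs_self v
  have w3 := le_abs_self V₁
  have w4 := le_abs_self V₂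
  have w5 := abs_nonneg v
  have w6 := abs_nonneg V₁
  have w7 := abs_nonneg V₂
  have hR0 : 0 ≤ R := by linarith
  obtain ⟨K, hK0, hK⟩ := lg_lip H ht0 hf
  have hsub : ∀ x : ℤ, s * (x - 1) = s * x - s := fun x => by ring
  have hsel : ∀ ε₁ : ℝ, 0 < ε₁ → _ := fun ε₁ hε₁ => select
    (g := fun x y => lg μ μ₀ t (s * x) y) (g' := fun x y => lg μ μ₀ t' (s * x) y) (K := K)
    (a₁ := s * A₁) (b₁ := B₁) (a₂ := s * A₂) (b₂ := B₂) (a' := s * α') (b' := β')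
    (v₁ := V₁) (v₂ := V₂) (κ := G / 4) (lo := v + G / 2) (R := R)
    (fun x y => by
      rcases hs with h | h
      · rw [h]; simpa using hK x y
      · rw [h, abs_sub_comm]
        have := hK (-x + 1) y
        simpa [add_comm, sub_eq_add_neg] using this)
    (fun ε hε => by
      obtain ⟨Y, hY⟩ := lg_C1 H D ht0' hε
      exact ⟨Y, fun y hy x => by simp only [hsub]; exact hY y hy (s * x)⟩)
    (UpB_of H hs i1' i2' hb1.le D.e1.le D.e2.le hR0)
    (fun ε hε => low_near H hs i1' i2' hb1 D.e1.le D.e2.le hb2 hb3 (by linarith) (by linarith)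
      (by linarith) hε)
    (UpB_of H hs i1 i2 T₁.e.le T₁.i1.le T₁.i2.le hR0)
    (UpB_of H hs i1 i2 T₂.e.le T₂.i1.le T₂.i2.le hR0)
    (fun ε hε => low_top H hs T₁ hε) (fun ε hε => low_top H hs T₂ hε)
    (by linarith) (by linarith) hV (by linarith) (by linarith) hε₁
  set gap := (s * A₂ - s * A₁) / 3 with hgap
  have hgap0 : 0 < gap := by rw [hgap]; linarith
  have hεn : ∀ n : ℕ, 0 < min (1 / ((n : ℝ) + 1)) gap := fun n => lt_min (by positivity) hgap0
  have hex : ∀ n : ℕ, ∃ (x : ℤ) (y : ℕ), n ≤ y ∧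
      |lg μ μ₀ t' (s * x - s) y - lg μ μ₀ t' (s * x) y - s * α'| ≤ 1 / ((n : ℝ) + 1) ∧
      (Even n → lg μ μ₀ t (s * x - s) y - lg μ μ₀ t (s * x) y ≤ s * A₁ + gap) ∧
      (¬ Even n → s * A₂ - gap ≤ lg μ μ₀ t (s * x - s) y - lg μ μ₀ t (s * x) y) := by
    intro n
    obtain ⟨Y, hY⟩ := hsel _ (hεn n)
    obtain ⟨⟨x1, p1, p2⟩, ⟨x2, p3, p4⟩⟩ := hY (Y + n) (by omega)
    simp only [hsub] at p1 p2 p3 p4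
    have m1 := min_le_left (1 / ((n : ℝ) + 1)) gap
    have m2 := min_le_right (1 / ((n : ℝ) + 1)) gap
    by_cases hn : Even n
    · exact ⟨x1, Y + n, by omega, p2.trans m1, fun _ => p1.trans (by linarith), fun h => absurd hn h⟩
    · exact ⟨x2, Y + n, by omega, p4.trans m1, fun h => absurd h hn, fun _ => le_trans (by linarith) p3⟩
  choose x y hy hx1 hx2 hx3 using hex
  have hcof : Tendsto (fun n => pt (s * x n) (y n)) atTop cofinite := tendsto_cof fun n => hy n
  refine ⟨t, t', by linarith, by linarith, ht2.ne', fun n => pt (s * x n) (y n), ?_, ?_, ?_⟩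
  · refine tendsto_atTop_mono (fun n => ?_) tendsto_natCast_atTop_atTop
    refine le_trans ?_ (euclNorm_ge _)
    exact_mod_cast hy n
  · intro z
    refine ⟨_, martin_conv H D ht0' hcof ?_ z₀ z⟩
    have h0 : Tendsto (fun n => lg μ μ₀ t' (s * x n - s) (y n) - lg μ μ₀ t' (s * x n) (y n)) atTop
        (nhds (s * α')) := by
      rw [tendsto_iff_dist_tendsto_zero]
      refine squeeze_zero (fun n => dist_nonneg) (fun n => ?_) tendsto_one_div_add_atTop_nhds_zero_nat
      rw [Real.dist_eq]; exact hx1 n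
    refine ((Real.continuous_exp.tendsto _).comp h0).congr fun n => ?_
    rw [qq_lg H ht0' hf']; rfl
  · refine diverge H ht0 hf z₀ (s := s) (m₁ := Real.exp (s * A₁ + gap)) (m₂ := Real.exp (s * A₂ - gap))
      (Real.exp_lt_exp.2 ?_) (fun n hn => ?_) (fun n hn => ?_)
    · linarith
    · rw [qq_lg H ht0 hf]; exact Real.exp_le_exp.2 (hx2 n hn)
    · rw [qq_lg H ht0 hf]; exact Real.exp_le_exp.2 (hx3 n hn)

end

/-- Proposition 2.1: for `d = 2` (here the Lean parameter is `1`),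
under (H0)-(H4), if the minimum of `max(φ, φ₀)` is attained at a unique point `a*`,
if `inf max(φ,φ₀) > inf φ` and `(∂φ/∂β)(a*) < 0`, then the `t`-Martin
compactification is unstable: there are `t ≠ t'` above `ρ(P)` and a sequence
`z_n` with `|z_n| → ∞` along which the `t'`-Martin kernels all converge while
some `t`-Martin kernel does not. -/
theorem martin_compactification_unstable (μ μ₀ : Zd 1 → ℝ)
    (hμ : IsMeasure μ) (hμ₀ : IsMeasure μ₀)
    (h0 : H0 μ μ₀) (h1 : H1 μ μ₀) (h2 : H2 μ) (h3 : H3 μ) (h3' : H3 μ₀) (h4 : H4 μ)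
    (astar : Rd 1)
    (hmin : ∀ a : Rd 1, max (phi μ astar) (phi μ₀ astar) ≤ max (phi μ a) (phi μ₀ a))
    (huniq : ∀ a : Rd 1,
      max (phi μ a) (phi μ₀ a) = max (phi μ astar) (phi μ₀ astar) → a = astar)
    (hgap : sInf (Set.range fun a : Rd 1 => phi μ a) <
      sInf (Set.range fun a : Rd 1 => max (phi μ a) (phi μ₀ a)))
    (hder : dBeta (phi μ) astar < 0)
    (z₀ : Ed 1) :
    ∃ t t' : ℝ, rho μ μ₀ < t ∧ rho μ μ₀ < t' ∧ t ≠ t' ∧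
      ∃ zseq : ℕ → Ed 1,
        Tendsto (fun n => euclNorm (vecE (zseq n))) atTop atTop ∧
        (∀ z : Ed 1, ∃ L : ℝ,
          Tendsto (fun n => martin μ μ₀ t' z₀ z (zseq n)) atTop (nhds L)) ∧
        (∃ z : Ed 1, ¬ ∃ L : ℝ,
          Tendsto (fun n => martin μ μ₀ t z₀ z (zseq n)) atTop (nhds L)) := by
  have H : Hyp μ μ₀ := ⟨hμ.1, hμ₀.1, h0.1, h0.2, h1, h2, h3, h3'⟩
  obtain ⟨t, C⟩ := mkCrit H hder hmin huniq
  exact main_core H C z₀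
end RWHalfspace
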